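/- arXiv:2306.11567 — 5 statements merged into one kernel-verified Lean document; each statement's English description precedes it below -/
import Mathlib

section
/- Let d ≥ 1, T ∈ (-∞, ∞], α ∈ (0,2), λ > 0, p ∈ (1,∞), and γ ∈ (αp/2 - 1, 2p - 1). Then there exists a constant N > 0, depending only on d, α, γ, p, such that for every smooth function u : ℝ × ℝ^d → ℝ with compact support contained in (-∞,T) × ℝ^{d-1} × (0,∞), setting f(t,x) = x_d^{-α}(u_t(t,x) + λ u(t,x)) - Δu(t,x), one has λ^{1/2} ‖χ^{-α/2} Du‖_{L_p(Ω_T, x_d^γ dz)} ≤ N ‖f‖_{L_p(Ω_T, x_d^γ dz)}. -/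
open MeasureTheory ENNReal Set

noncomputable section

abbrev Ed (d : ℕ) : Type := EuclideanSpace ℝ (Fin d)

/-- The last coordinate `x_d` of a point `x ∈ ℝ^d` (junk value `0` if `d = 0`). -/
def xd {d : ℕ} (x : Ed d) : ℝ :=
  if h : 0 < d then x ⟨d - 1, Nat.sub_lt h one_pos⟩ else 0

/-- `Ω_T = (-∞, T) × ℝ^d_+`. -/
def OmegaT (d : ℕ) (T : EReal) : Set (ℝ × Ed d) :=
  {z | (z.1 : EReal) < T ∧ 0 < xd z.2}

/-- Time derivative `u_t`. -/
def ut {d : ℕ} (u : ℝ × Ed d → ℝ) (z : ℝ × Ed d) : ℝ :=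
  deriv (fun s => u (s, z.2)) z.1

/-- Spatial gradient `Du`. -/
def Du {d : ℕ} (u : ℝ × Ed d → ℝ) (z : ℝ × Ed d) : Ed d →L[ℝ] ℝ :=
  fderiv ℝ (fun y => u (z.1, y)) z.2

/-- Spatial Hessian `D²u`. -/
def D2u {d : ℕ} (u : ℝ × Ed d → ℝ) (z : ℝ × Ed d) : Ed d →L[ℝ] Ed d →L[ℝ] ℝ :=
  fderiv ℝ (fun y => Du u (z.1, y)) z.2

/-- Spatial Laplacian `Δu`. -/
def lap {d : ℕ} (u : ℝ × Ed d → ℝ) (z : ℝ × Ed d) : ℝ :=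
  ∑ i : Fin d, D2u u z (EuclideanSpace.single i 1) (EuclideanSpace.single i 1)

/-- Weighted Lebesgue norm `‖g‖_{L_p(Ω_T, x_d^γ dz)}`. -/
def wLp (d : ℕ) (T : EReal) (p γ : ℝ) (g : ℝ × Ed d → ℝ) : ℝ≥0∞ :=
  (∫⁻ z in OmegaT d T, ENNReal.ofReal (|g z| ^ p * xd z.2 ^ γ)) ^ (1 / p)

/-- The derivative of `g` in the direction `v`, as a function of the base point. -/
def dirDeriv {X : Type*} [NormedAddCommGroup X] [NormedSpace ℝ X] (v : X) (g : X → ℝ) : X → ℝ :=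
  fun x => fderiv ℝ g x v

section IBP
variable {X : Type*} [NormedAddCommGroup X] [NormedSpace ℝ X]

theorem ContDiff.dirDeriv {g : X → ℝ} (hg : ContDiff ℝ (⊤ : ℕ∞) g) (v : X) :
    ContDiff ℝ (⊤ : ℕ∞) (dirDeriv v g) :=
  (hg.fderiv_right (m := (⊤ : ℕ∞)) (by exact_mod_cast le_top)).clm_apply contDiff_const

theorem dirDeriv_eq_zero_of_notMem {g : X → ℝ} {K : Set X} (hK : IsClosed K)
    (hg : ∀ x ∉ K, g x = 0) (v : X) : ∀ x ∉ K, dirDeriv v g x = 0 := by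
  intro x hx
  have : g =ᶠ[nhds x] fun _ => 0 := by
    filter_upwards [hK.isOpen_compl.mem_nhds hx] with y hy using hg y hy
  simp [dirDeriv, this.fderiv_eq]

theorem dirDeriv_comm {g : X → ℝ} (hg : ContDiff ℝ (⊤ : ℕ∞) g) (v w : X) :
    dirDeriv v (dirDeriv w g) = dirDeriv w (dirDeriv v g) := by
  funext x
  have h1 : DifferentiableAt ℝ (fderiv ℝ g) x :=
    ((hg.of_le (show (2 : WithTop ℕ∞) ≤ _ from WithTop.coe_le_coe.2 (le_top (a := (2 : ℕ∞))))).fderiv_right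
      (m := 1)
      (by norm_num)).differentiable (by simp) x
  have key : ∀ a b : X, dirDeriv a (dirDeriv b g) x = fderiv ℝ (fderiv ℝ g) x a b := by
    intro a b
    unfold dirDeriv
    rw [fderiv_clm_apply h1 (differentiableAt_const b)]
    simp
  rw [key, key]
  have := (hg.contDiffAt (x := x)).isSymmSndFDerivAt
    (by simpa using (show (2 : WithTop ℕ∞) ≤ _ from WithTop.coe_le_coe.2 (le_top (a := (2 : ℕ∞)))))
  exact this v w

theorem dirDeriv_comp {g : X → ℝ} {x : X} {φ : ℝ → ℝ} {φ' : ℝ} (hφ : HasDerivAt φ φ' (g x))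
    (hg : DifferentiableAt ℝ g x) (v : X) :
    dirDeriv v (fun y => φ (g y)) x = φ' * dirDeriv v g x := by
  have := (hφ.comp_hasFDerivAt x hg.hasFDerivAt).fderiv
  simp only [dirDeriv]
  rw [show (fun y => φ (g y)) = φ ∘ g from rfl, this]
  simp

theorem dirDeriv_mul {g k : X → ℝ} {x : X} (hg : DifferentiableAt ℝ g x)
    (hk : DifferentiableAt ℝ k x) (v : X) :
    dirDeriv v (fun y => g y * k y) x = g x * dirDeriv v k x + k x * dirDeriv v g x := by
  simp only [dirDeriv]
  rw [fderiv_fun_mul hg hk]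
  simp

variable [FiniteDimensional ℝ X] [MeasurableSpace X] [BorelSpace X]
  (μ : Measure X) [μ.IsAddHaarMeasure]

theorem integral_dirDeriv_eq_zero {g : X → ℝ} (hg : ContDiff ℝ 1 g) (hc : HasCompactSupport g)
    (v : X) : ∫ x, dirDeriv v g x ∂μ = 0 := by
  have hcont : Continuous (dirDeriv v g) :=
    (hg.continuous_fderiv (by simp)).clm_apply continuous_const
  have hs : HasCompactSupport (dirDeriv v g) := hc.fderiv_apply (𝕜 := ℝ) v
  have h := integral_bilinear_hasFDerivAt_right_eq_neg_left_of_integrable (μ := μ)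
    (f := fun _ : X => (1 : ℝ)) (f' := fun _ => 0) (g := g) (g' := fderiv ℝ g) (v := v)
    (B := ContinuousLinearMap.mul ℝ ℝ) (by simp)
    (by simpa using
      (show Integrable (fun x => fderiv ℝ g x v) μ from hcont.integrable_of_hasCompactSupport hs))
    (by simpa using hg.continuous.integrable_of_hasCompactSupport hc)
    (fun x _ => hasFDerivAt_const _ _) (fun x _ => (hg.differentiable (by simp) x).hasFDerivAt)
  simpa [dirDeriv] using h

/-- Integration by parts against a weight that depends only on `ℓ x`. -/
theorem setIntegral_weight_dirDeriv {K : Set X} (hK : IsCompact K) {ℓ : X →L[ℝ] ℝ}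
    (hℓ : ∀ x ∈ K, 0 < ℓ x) {W : X → ℝ} (hW : ContDiff ℝ 1 W) (hWK : ∀ x ∉ K, W x = 0)
    {Ψ Ψ' : ℝ → ℝ} (hΨ : ∀ s, 0 < s → HasDerivAt Ψ (Ψ' s) s) (hΨ' : ContinuousOn Ψ' (Ioi 0))
    (v : X) :
    ∫ x in K, (Ψ (ℓ x) * dirDeriv v W x + ℓ v * Ψ' (ℓ x) * W x) ∂μ = 0 := by
  set g : X → ℝ := fun x => Ψ (ℓ x) * W x with hg
  have hgK : ∀ x ∉ K, g x = 0 := fun x hx => by simp [hg, hWK x hx]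
  have hΨc : ContDiffOn ℝ 1 Ψ (Ioi 0) := by
    rw [show (1 : WithTop ℕ∞) = 0 + 1 by simp, contDiffOn_succ_iff_deriv_of_isOpen isOpen_Ioi]
    refine ⟨fun s hs => (hΨ s hs).differentiableAt.differentiableWithinAt, by simp, ?_⟩
    rw [contDiffOn_zero]
    exact hΨ'.congr fun s hs => (hΨ s hs).deriv
  have hgc : ContDiff ℝ 1 g := by
    rw [contDiff_iff_contDiffAt]
    intro x
    by_cases hx : 0 < ℓ x
    · exact ((hΨc.contDiffAt (isOpen_Ioi.mem_nhds hx)).comp x ℓ.contDiff.contDiffAt).mul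
        hW.contDiffAt
    · have hxK : x ∉ K := fun h => hx (hℓ x h)
      have : g =ᶠ[nhds x] fun _ => 0 := by
        filter_upwards [hK.isClosed.isOpen_compl.mem_nhds hxK] with y hy using hgK y hy
      exact contDiffAt_const.congr_of_eventuallyEq this
  have hgs : HasCompactSupport g := HasCompactSupport.intro hK hgK
  rw [← integral_dirDeriv_eq_zero μ hgc hgs v,
    ← setIntegral_eq_integral_of_forall_compl_eq_zero
      (dirDeriv_eq_zero_of_notMem hK.isClosed hgK v)]
  refine setIntegral_congr_fun hK.measurableSet fun x hx => ?_
  have h1 := (hΨ _ (hℓ x hx)).comp_hasFDerivAt x ℓ.hasFDerivAt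
  have hWd : DifferentiableAt ℝ W x := hW.differentiable (by simp) x
  have := dirDeriv_mul (g := fun y => Ψ (ℓ y)) (k := W) h1.differentiableAt hWd v
  simp only [hg]
  rw [this, dirDeriv_comp (g := fun y => ℓ y) (hΨ _ (hℓ x hx)) ℓ.differentiableAt]
  simp only [dirDeriv, ContinuousLinearMap.fderiv]
  ring

end IBP

section Reg

/-- The derivative of the regularised power `(s² + δ²)^(p/2)` of `s`. -/
def regDeriv (p δ s : ℝ) : ℝ := p * (s * (s ^ 2 + δ ^ 2) ^ (p / 2 - 1))

/-- The ratio of the second derivative of `(s² + δ²)^(p/2)` to `p (s² + δ²)^(p/2-1)`. -/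
def regRatio (p δ s : ℝ) : ℝ := ((p - 1) * s ^ 2 + δ ^ 2) / (s ^ 2 + δ ^ 2)

variable {p δ : ℝ}

theorem hasDerivAt_reg (hδ : 0 < δ) (s : ℝ) :
    HasDerivAt (fun s : ℝ => (s ^ 2 + δ ^ 2) ^ (p / 2) - δ ^ p) (regDeriv p δ s) s := by
  have h0 : s ^ 2 + δ ^ 2 ≠ 0 := by positivity
  have h1 : HasDerivAt (fun s : ℝ => s ^ 2 + δ ^ 2) (2 * s) s := by
    simpa using (hasDerivAt_pow 2 s).add_const (δ ^ 2)
  refine ((h1.rpow_const (p := p / 2) (Or.inl h0)).sub_const (δ ^ p)).congr_deriv ?_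
  unfold regDeriv
  ring

theorem hasDerivAt_regDeriv (hδ : 0 < δ) (s : ℝ) :
    HasDerivAt (regDeriv p δ) (p * ((s ^ 2 + δ ^ 2) ^ (p / 2 - 1) * regRatio p δ s)) s := by
  have h0 : s ^ 2 + δ ^ 2 ≠ 0 := by positivity
  have h1 : HasDerivAt (fun s : ℝ => s ^ 2 + δ ^ 2) (2 * s) s := by
    simpa using (hasDerivAt_pow 2 s).add_const (δ ^ 2)
  have := ((hasDerivAt_id s).mul (h1.rpow_const (p := p / 2 - 1) (Or.inl h0))).const_mul p
  refine this.congr_deriv ?_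
  rw [Real.rpow_sub_one h0 (p / 2 - 1)]
  simp only [id, regRatio]
  field_simp
  ring

theorem contDiff_reg (hδ : 0 < δ) :
    ContDiff ℝ (⊤ : ℕ∞) (fun s : ℝ => (s ^ 2 + δ ^ 2) ^ (p / 2) - δ ^ p) :=
  (ContDiff.rpow_const_of_ne (by fun_prop) fun s => by positivity).sub contDiff_const

theorem contDiff_regDeriv (hδ : 0 < δ) : ContDiff ℝ (⊤ : ℕ∞) (regDeriv p δ) :=
  contDiff_const.mul (contDiff_id.mul
    (ContDiff.rpow_const_of_ne (by fun_prop) fun s => by positivity))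

end Reg

section Energy
section IsNullOn
variable {X : Type*} [MeasurableSpace X]

/-- `g` is integrable on `K` with vanishing integral. -/
def IsNullOn (μ : Measure X) (K : Set X) (g : X → ℝ) : Prop :=
  IntegrableOn g K μ ∧ ∫ x in K, g x ∂μ = 0

namespace IsNullOn
variable {μ : Measure X} {K : Set X} {g k : X → ℝ}

theorem add (hg : IsNullOn μ K g) (hk : IsNullOn μ K k) : IsNullOn μ K fun x => g x + k x :=
  ⟨hg.1.add hk.1, by rw [integral_add hg.1 hk.1, hg.2, hk.2, add_zero]⟩

theorem sub (hg : IsNullOn μ K g) (hk : IsNullOn μ K k) : IsNullOn μ K fun x => g x - k x :=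
  ⟨hg.1.sub hk.1, by rw [integral_sub hg.1 hk.1, hg.2, hk.2, sub_zero]⟩

theorem const_mul (c : ℝ) (hg : IsNullOn μ K g) : IsNullOn μ K fun x => c * g x :=
  ⟨Integrable.const_mul hg.1 c, by rw [integral_const_mul, hg.2, mul_zero]⟩

theorem sum {ι : Type*} [Fintype ι] {g : ι → X → ℝ} (hg : ∀ i, IsNullOn μ K (g i)) :
    IsNullOn μ K fun x => ∑ i, g i x :=
  ⟨integrable_finsetSum _ fun i _ => (hg i).1, by
    rw [integral_finsetSum _ fun i _ => (hg i).1]; simp [fun i => (hg i).2]⟩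

theorem congr (hK : MeasurableSet K) (hg : IsNullOn μ K g) (h : ∀ x ∈ K, g x = k x) :
    IsNullOn μ K k :=
  ⟨hg.1.congr_fun h hK, by rw [← hg.2]; exact (setIntegral_congr_fun hK h).symm⟩

theorem integral_le (hK : MeasurableSet K) (hg : IsNullOn μ K g) {J Z : X → ℝ}
    (hJ : IntegrableOn J K μ) (hZ : IntegrableOn Z K μ) (h : ∀ x ∈ K, J x ≤ g x + Z x) :
    ∫ x in K, J x ∂μ ≤ ∫ x in K, Z x ∂μ :=
  calc ∫ x in K, J x ∂μ ≤ ∫ x in K, (g x + Z x) ∂μ :=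
        setIntegral_mono_on hJ (hg.1.add hZ) hK h
    _ = ∫ x in K, Z x ∂μ := by rw [integral_add hg.1 hZ, hg.2, zero_add]

end IsNullOn
end IsNullOn

variable {X : Type*} [NormedAddCommGroup X] [NormedSpace ℝ X] [MeasurableSpace X]

/-- The operator `ℓ^{-α} (∂_τ u + λ u) - ∑ᵢ ∂_{eᵢ}² u`. -/
def degenOp {ι : Type*} [Fintype ι] (ℓ : X →L[ℝ] ℝ) (τ : X) (e : ι → X) (α lam : ℝ)
    (u : X → ℝ) : X → ℝ :=
  fun x => ℓ x ^ (-α) * (dirDeriv τ u x + lam * u x) -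
    ∑ i, dirDeriv (e i) (dirDeriv (e i) u) x

variable [FiniteDimensional ℝ X] [BorelSpace X] (μ : Measure X) [μ.IsAddHaarMeasure]
  {ι : Type*} [Fintype ι] {K : Set X} {ℓ : X →L[ℝ] ℝ}

theorem isNullOn_weight_dirDeriv (hK : IsCompact K) (hℓ : ∀ x ∈ K, 0 < ℓ x) {W : X → ℝ}
    (hW : ContDiff ℝ (⊤ : ℕ∞) W) (hWK : ∀ x ∉ K, W x = 0)
    {Ψ Ψ' : ℝ → ℝ} (hΨ : ∀ s, 0 < s → HasDerivAt Ψ (Ψ' s) s) (hΨ' : ContinuousOn Ψ' (Ioi 0))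
    (v : X) :
    IsNullOn μ K fun x => Ψ (ℓ x) * dirDeriv v W x + ℓ v * Ψ' (ℓ x) * W x := by
  refine ⟨ContinuousOn.integrableOn_compact hK ?_,
    setIntegral_weight_dirDeriv μ hK hℓ (hW.of_le (by exact_mod_cast le_top)) hWK hΨ hΨ' v⟩
  have hm : MapsTo ℓ K (Ioi 0) := hℓ
  have h1 : ContinuousOn (fun x => Ψ (ℓ x)) K :=
    ContinuousOn.comp (t := Ioi 0) (fun s hs => (hΨ s hs).continuousAt.continuousWithinAt)
      ℓ.continuous.continuousOn hm
  have h2 : ContinuousOn (fun x => Ψ' (ℓ x)) K := hΨ'.comp ℓ.continuous.continuousOn hm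
  exact (h1.mul (hW.dirDeriv v).continuous.continuousOn).add
    ((continuousOn_const.mul h2).mul hW.continuous.continuousOn)

variable {u : X → ℝ} {τ : X} {e : ι → X} {α lam : ℝ} {Φ Φ₁ Φ₂ : ℝ → ℝ} {ψ B B₁ : ℝ → ℝ}

theorem hasDerivAt_rpow_mul {s : ℝ} (hs : 0 < s) (hψ : HasDerivAt ψ (B s * ψ s / s) s) (c : ℝ) :
    HasDerivAt (fun s => s ^ c * ψ s) (s ^ c * ((c + B s) * ψ s / s)) s := by
  refine ((Real.hasDerivAt_rpow_const (p := c) (Or.inl hs.ne')).mul hψ).congr_deriv ?_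
  rw [Real.rpow_sub_one hs.ne']
  field_simp

theorem isNullOn_rpow_mul (hK : IsCompact K) (hℓ : ∀ x ∈ K, 0 < ℓ x) {W : X → ℝ}
    (hW : ContDiff ℝ (⊤ : ℕ∞) W) (hWK : ∀ x ∉ K, W x = 0)
    (hψ : ∀ s, 0 < s → HasDerivAt ψ (B s * ψ s / s) s) (hB : ContinuousOn B (Ioi 0))
    (c : ℝ) (v : X) :
    IsNullOn μ K fun x => ℓ x ^ c * ψ (ℓ x) *
      (dirDeriv v W x + ℓ v * (c + B (ℓ x)) / ℓ x * W x) := by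
  have := isNullOn_weight_dirDeriv μ hK hℓ hW hWK
    (fun s hs => hasDerivAt_rpow_mul hs (hψ s hs) c) ?_ v
  · refine this.congr hK.measurableSet fun x hx => ?_
    ring
  · have h1 : ContinuousOn ψ (Ioi 0) := fun s hs => (hψ s hs).continuousAt.continuousWithinAt
    exact (continuousOn_id.rpow_const fun s hs => Or.inl (ne_of_gt hs)).mul
      (((continuousOn_const.add hB).mul h1).div continuousOn_id fun s hs => ne_of_gt hs)

theorem isNullOn_energy (hK : IsCompact K) (hℓ : ∀ x ∈ K, 0 < ℓ x)
    (hu : ContDiff ℝ (⊤ : ℕ∞) u) (huK : ∀ x ∉ K, u x = 0)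
    (hτ : ℓ τ = 0) (he : ∑ i, ℓ (e i) ^ 2 = 1)
    (hΦ : ContDiff ℝ (⊤ : ℕ∞) Φ) (hΦ₁ : ContDiff ℝ (⊤ : ℕ∞) Φ₁) (hΦ0 : Φ 0 = 0) (hΦ₁0 : Φ₁ 0 = 0)
    (hd : ∀ s, HasDerivAt Φ (Φ₁ s) s) (hd₁ : ∀ s, HasDerivAt Φ₁ (Φ₂ s) s)
    (hψ : ∀ s, 0 < s → HasDerivAt ψ (B s * ψ s / s) s)
    (hB : ∀ s, 0 < s → HasDerivAt B (B₁ s / s) s) (hB₁ : ContinuousOn B₁ (Ioi 0)) (m : ℝ) :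
    IsNullOn μ K fun x => ψ (ℓ x) *
      (lam * ℓ x ^ (-α) * (Φ₁ (u x) * u x) + Φ₂ (u x) * ∑ i, dirDeriv (e i) u x ^ 2
        + m / ℓ x * (Φ₁ (u x) * ∑ i, ℓ (e i) * dirDeriv (e i) u x)
        + ((m - B (ℓ x)) * (B (ℓ x) - 1) - B₁ (ℓ x)) / ℓ x ^ 2 * Φ (u x)
        - Φ₁ (u x) * degenOp ℓ τ e α lam u x) := by
  have hBc : ContinuousOn B (Ioi 0) := fun s hs => (hB s hs).continuousAt.continuousWithinAt
  have hψc : ContinuousOn ψ (Ioi 0) := fun s hs => (hψ s hs).continuousAt.continuousWithinAt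
  have hu' : ∀ x, DifferentiableAt ℝ u x := fun x => hu.differentiable (by simp) x
  have hΦu : ∀ v x, dirDeriv v (fun y => Φ (u y)) x = Φ₁ (u x) * dirDeriv v u x :=
    fun v x => dirDeriv_comp (hd _) (hu' x) v
  have hΦK : ∀ x ∉ K, Φ (u x) = 0 := fun x hx => by rw [huK x hx, hΦ0]
  have ha := isNullOn_rpow_mul μ hK hℓ (hΦ.comp hu) hΦK hψ hBc (-α) τ
  have hb : ∀ i, _ := fun i => isNullOn_rpow_mul μ hK hℓ (W := fun x => Φ₁ (u x) * dirDeriv (e i) u x)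
    ((hΦ₁.comp hu).mul (hu.dirDeriv (e i))) (fun x hx => by simp [huK x hx, hΦ₁0]) hψ hBc 0 (e i)
  have hc := isNullOn_weight_dirDeriv μ hK hℓ (hΦ.comp hu) hΦK
    (Ψ := fun s => (m - B s) * ψ s / s)
    (Ψ' := fun s => ((m - B s) * (B s - 1) - B₁ s) * ψ s / s ^ 2) ?_ ?_ (∑ i, ℓ (e i) • e i)
  · refine (((IsNullOn.sum hb).sub ha).add hc).congr hK.measurableSet fun x hx => ?_
    have hx0 : ℓ x ≠ 0 := (hℓ x hx).ne'
    have e1 : ∀ i, dirDeriv (e i) (fun x => Φ₁ (u x) * dirDeriv (e i) u x) x =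
        Φ₁ (u x) * dirDeriv (e i) (dirDeriv (e i) u) x + Φ₂ (u x) * dirDeriv (e i) u x ^ 2 := by
      intro i
      rw [dirDeriv_mul (g := fun x => Φ₁ (u x)) ((hΦ₁.comp hu).differentiable (by simp) x)
        ((hu.dirDeriv _).differentiable (by simp) x), dirDeriv_comp (hd₁ _) (hu' x)]
      ring
    have e2 : ℓ (∑ i, ℓ (e i) • e i) = 1 := by
      simp only [map_sum, map_smul, smul_eq_mul, ← pow_two, he]
    have e3 : dirDeriv (∑ i, ℓ (e i) • e i) u x = ∑ i, ℓ (e i) * dirDeriv (e i) u x := by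
      simp [dirDeriv, map_sum]
    have e4 : (∑ i, ℓ x ^ (0 : ℝ) * ψ (ℓ x) *
        (dirDeriv (e i) (fun x => Φ₁ (u x) * dirDeriv (e i) u x) x +
          ℓ (e i) * (0 + B (ℓ x)) / ℓ x * (Φ₁ (u x) * dirDeriv (e i) u x))) =
        ψ (ℓ x) * (Φ₁ (u x) * ∑ i, dirDeriv (e i) (dirDeriv (e i) u) x +
          Φ₂ (u x) * ∑ i, dirDeriv (e i) u x ^ 2 +
          B (ℓ x) / ℓ x * (Φ₁ (u x) * ∑ i, ℓ (e i) * dirDeriv (e i) u x)) := by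
      simp only [e1, Real.rpow_zero, Finset.mul_sum, ← Finset.sum_add_distrib]
      refine Finset.sum_congr rfl fun i _ => by ring
    rw [e4]
    simp only [Function.comp_def]
    rw [hΦu, hΦu, e2, e3, hτ, degenOp]
    field_simp
    ring
  · intro s hs
    refine ((((hB s hs).const_sub m).mul (hψ s hs)).div (hasDerivAt_id s) hs.ne').congr_deriv ?_
    simp only [id, Pi.mul_apply]
    field_simp
    ring
  · refine ContinuousOn.div ?_ (by fun_prop) fun s hs => pow_ne_zero _ (ne_of_gt hs)
    exact (((continuousOn_const.sub hBc).mul (hBc.sub continuousOn_const)).sub hB₁).mul hψc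

/-- Energy identity obtained by testing the equation differentiated in the direction `e k`. -/
theorem isNullOn_gradient_energy (hK : IsCompact K) (hℓ : ∀ x ∈ K, 0 < ℓ x)
    (hu : ContDiff ℝ (⊤ : ℕ∞) u) (huK : ∀ x ∉ K, u x = 0) (hτ : ℓ τ = 0)
    (hΦ : ContDiff ℝ (⊤ : ℕ∞) Φ) (hΦ₁ : ContDiff ℝ (⊤ : ℕ∞) Φ₁) (hΦ0 : Φ 0 = 0) (hΦ₁0 : Φ₁ 0 = 0)
    (hd : ∀ s, HasDerivAt Φ (Φ₁ s) s) (hd₁ : ∀ s, HasDerivAt Φ₁ (Φ₂ s) s)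
    (hψ : ∀ s, 0 < s → HasDerivAt ψ (B s * ψ s / s) s) (hB : ContinuousOn B (Ioi 0))
    (k : ι) {v : X → ℝ} (hv : v = dirDeriv (e k) u) :
    IsNullOn μ K fun x => ψ (ℓ x) *
      (Φ₂ (v x) * dirDeriv (e k) v x * degenOp ℓ τ e α lam u x
        + lam * ℓ x ^ (-α) * (Φ₁ (v x) * v x)
        + ℓ (e k) * (B (ℓ x) - α) / ℓ x * (Φ₁ (v x) * degenOp ℓ τ e α lam u x)
        + ℓ (e k) * (α / ℓ x * (Φ₂ (v x) * ∑ i, dirDeriv (e i) v x * dirDeriv (e i) u x)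
          + α * (B (ℓ x) - 1) / ℓ x ^ 2 * (Φ₁ (v x) * ∑ i, ℓ (e i) * dirDeriv (e i) u x))
        + Φ₂ (v x) * ∑ i, dirDeriv (e i) v x ^ 2
        + B (ℓ x) / ℓ x * (Φ₁ (v x) * ∑ i, ℓ (e i) * dirDeriv (e i) v x)) := by
  have hvs : ContDiff ℝ (⊤ : ℕ∞) v := hv ▸ hu.dirDeriv _
  have hvK : ∀ x ∉ K, v x = 0 := hv ▸ dirDeriv_eq_zero_of_notMem hK.isClosed huK _
  have hv' : ∀ x, DifferentiableAt ℝ v x := fun x => hvs.differentiable (by simp) x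
  have hΦ₁v : ContDiff ℝ (⊤ : ℕ∞) fun x => Φ₁ (v x) := hΦ₁.comp hvs
  have hΦ₁K : ∀ x ∉ K, Φ₁ (v x) = 0 := fun x hx => by rw [hvK x hx, hΦ₁0]
  have dΦ₁ : ∀ w x, dirDeriv w (fun y => Φ₁ (v y)) x = Φ₂ (v x) * dirDeriv w v x :=
    fun w x => dirDeriv_comp (hd₁ _) (hv' x) w
  have dprod : ∀ {W : X → ℝ} (_ : ContDiff ℝ (⊤ : ℕ∞) W) (w x),
      dirDeriv w (fun y => Φ₁ (v y) * W y) x =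
        Φ₁ (v x) * dirDeriv w W x + W x * (Φ₂ (v x) * dirDeriv w v x) := by
    intro W hW w x
    rw [dirDeriv_mul (hΦ₁v.differentiable (by simp) x) (hW.differentiable (by simp) x), dΦ₁]
  have hH : ContDiff ℝ (⊤ : ℕ∞) fun x => dirDeriv τ u x + lam * u x :=
    (hu.dirDeriv τ).add (contDiff_const.mul hu)
  have hL : ContDiff ℝ (⊤ : ℕ∞) fun x => ∑ i, dirDeriv (e i) (dirDeriv (e i) u) x :=
    ContDiff.sum fun i _ => (hu.dirDeriv _).dirDeriv _
  have dH : ∀ x, dirDeriv (e k) (fun x => dirDeriv τ u x + lam * u x) x =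
      dirDeriv τ v x + lam * v x := by
    intro x
    have h1 : DifferentiableAt ℝ (dirDeriv τ u) x := (hu.dirDeriv τ).differentiable (by simp) x
    have h2 : DifferentiableAt ℝ u x := hu.differentiable (by simp) x
    rw [hv, dirDeriv_comm hu τ (e k)]
    change fderiv ℝ (fun x => dirDeriv τ u x + lam * u x) x (e k) = _
    rw [fderiv_fun_add h1 (h2.const_mul lam), fderiv_const_mul h2]
    simp [dirDeriv]
  have dL : ∀ x, dirDeriv (e k) (fun x => ∑ i, dirDeriv (e i) (dirDeriv (e i) u) x) x =
      ∑ i, dirDeriv (e i) (dirDeriv (e i) v) x := by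
    intro x
    have h1 : ∀ i ∈ Finset.univ, DifferentiableAt ℝ (dirDeriv (e i) (dirDeriv (e i) u)) x :=
      fun i _ => ((hu.dirDeriv _).dirDeriv _).differentiable (by simp) x
    have h2 : ∀ i, dirDeriv (e k) (dirDeriv (e i) (dirDeriv (e i) u)) =
        dirDeriv (e i) (dirDeriv (e i) v) := fun i => by
      rw [dirDeriv_comm (hu.dirDeriv _), dirDeriv_comm hu, ← hv]
    simp only [← h2]
    change fderiv ℝ (fun x => ∑ i, dirDeriv (e i) (dirDeriv (e i) u) x) x (e k) = _
    rw [fderiv_fun_sum h1]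
    simp [dirDeriv]
  have ha := isNullOn_rpow_mul μ hK hℓ (hΦ₁v.mul hH)
    (fun x hx => by simp [hΦ₁K x hx]) hψ hB (-α) (e k)
  have hb := isNullOn_rpow_mul μ hK hℓ (hΦ.comp hvs)
    (fun x hx => by simp [hvK x hx, hΦ0]) hψ hB (-α) τ
  have hc := isNullOn_rpow_mul μ hK hℓ (hΦ₁v.mul hL)
    (fun x hx => by simp [hΦ₁K x hx]) hψ hB 0 (e k)
  have hd' : ∀ i, _ := fun i => isNullOn_rpow_mul μ hK hℓ (hΦ₁v.mul (hvs.dirDeriv (e i)))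
    (fun x hx => by simp [hΦ₁K x hx]) hψ hB 0 (e i)
  have he' : ∀ i, _ := fun i => isNullOn_rpow_mul μ hK hℓ (hΦ₁v.mul (hu.dirDeriv (e i)))
    (fun x hx => by simp [hΦ₁K x hx]) hψ hB (-1) (e i)
  refine ((((ha.sub hb).sub hc).add (IsNullOn.sum hd')).add
    ((IsNullOn.sum he').const_mul (ℓ (e k) * α))).congr hK.measurableSet fun x hx => ?_
  have hx0 : ℓ x ≠ 0 := (hℓ x hx).ne'
  simp only [Function.comp_def]
  rw [dprod hH, dprod hL, dH, dL, dirDeriv_comp (hd _) (hv' x), hτ]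
  simp only [dprod (hvs.dirDeriv _), dprod (hu.dirDeriv _), Real.rpow_zero, Real.rpow_neg_one]
  have e1 : (∑ i, 1 * ψ (ℓ x) * (Φ₁ (v x) * dirDeriv (e i) (dirDeriv (e i) v) x +
        dirDeriv (e i) v x * (Φ₂ (v x) * dirDeriv (e i) v x) +
        ℓ (e i) * (0 + B (ℓ x)) / ℓ x * (Φ₁ (v x) * dirDeriv (e i) v x))) =
      ψ (ℓ x) * (Φ₁ (v x) * ∑ i, dirDeriv (e i) (dirDeriv (e i) v) x +
        Φ₂ (v x) * ∑ i, dirDeriv (e i) v x ^ 2 +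
        B (ℓ x) / ℓ x * (Φ₁ (v x) * ∑ i, ℓ (e i) * dirDeriv (e i) v x)) := by
    simp only [Finset.mul_sum, ← Finset.sum_add_distrib]
    exact Finset.sum_congr rfl fun i _ => by ring
  have e2 : (∑ i, (ℓ x)⁻¹ * ψ (ℓ x) * (Φ₁ (v x) * dirDeriv (e i) (dirDeriv (e i) u) x +
        dirDeriv (e i) u x * (Φ₂ (v x) * dirDeriv (e i) v x) +
        ℓ (e i) * (-1 + B (ℓ x)) / ℓ x * (Φ₁ (v x) * dirDeriv (e i) u x))) =
      ψ (ℓ x) / ℓ x * (Φ₁ (v x) * ∑ i, dirDeriv (e i) (dirDeriv (e i) u) x +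
        Φ₂ (v x) * ∑ i, dirDeriv (e i) v x * dirDeriv (e i) u x +
        (B (ℓ x) - 1) / ℓ x * (Φ₁ (v x) * ∑ i, ℓ (e i) * dirDeriv (e i) u x)) := by
    simp only [Finset.mul_sum, ← Finset.sum_add_distrib]
    exact Finset.sum_congr rfl fun i _ => by ring
  rw [e1, e2, degenOp]
  generalize (∑ i, dirDeriv (e i) (dirDeriv (e i) u) x) = s1
  generalize (∑ i, dirDeriv (e i) (dirDeriv (e i) v) x) = s2
  field_simp
  ring

/-- Integration by parts identity linking the gradient to the function itself. -/
theorem isNullOn_interpolation (hK : IsCompact K) (hℓ : ∀ x ∈ K, 0 < ℓ x)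
    (hu : ContDiff ℝ (⊤ : ℕ∞) u) (huK : ∀ x ∉ K, u x = 0)
    (hΦ₁ : ContDiff ℝ (⊤ : ℕ∞) Φ₁) (hd₁ : ∀ s, HasDerivAt Φ₁ (Φ₂ s) s)
    (hψ : ∀ s, 0 < s → HasDerivAt ψ (B s * ψ s / s) s) (hB : ContinuousOn B (Ioi 0))
    (w : X) {v : X → ℝ} (hv : v = dirDeriv w u) :
    IsNullOn μ K fun x => ψ (ℓ x) / ℓ x ^ 2 *
      (Φ₂ (v x) * dirDeriv w v x * u x + Φ₁ (v x) * v x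
        + ℓ w * (B (ℓ x) - 2) / ℓ x * (Φ₁ (v x) * u x)) := by
  have hvs : ContDiff ℝ (⊤ : ℕ∞) v := hv ▸ hu.dirDeriv _
  have hΦ₁v : ContDiff ℝ (⊤ : ℕ∞) fun x => Φ₁ (v x) := hΦ₁.comp hvs
  refine (isNullOn_rpow_mul μ hK hℓ (hΦ₁v.mul hu) (fun x hx => by simp [huK x hx])
    hψ hB (-2) w).congr hK.measurableSet fun x hx => ?_
  have hx0 := hℓ x hx
  rw [dirDeriv_mul (hΦ₁v.differentiable (by simp) x) (hu.differentiable (by simp) x),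
    dirDeriv_comp (hd₁ _) (hvs.differentiable (by simp) x), ← hv,
    show (-2 : ℝ) = -(2 : ℕ) by norm_num, Real.rpow_neg hx0.le, Real.rpow_natCast]
  field_simp
  ring

end Energy

section Pointwise

theorem exists_rpow_mul_rpow_le {κ ζ : ℝ} (hκ : 0 ≤ κ) (hκ' : κ < 1) (hζ : 0 < ζ) :
    ∃ C : ℝ, 0 < C ∧ ∀ A B : ℝ, 0 ≤ A → 0 ≤ B → A ^ κ * B ^ (1 - κ) ≤ ζ * A + C * B := by
  set ξ : ℝ := ζ ^ (1 / (1 - κ)) with hξ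
  have h1 : 0 < 1 - κ := by linarith
  have hξ0 : 0 < ξ := Real.rpow_pos_of_pos hζ _
  have hξ1 : ξ ^ (1 - κ) = ζ := by
    rw [hξ, ← Real.rpow_mul hζ.le, one_div_mul_cancel h1.ne', Real.rpow_one]
  refine ⟨(1 / ξ) ^ κ, by positivity, fun A B hA hB => ?_⟩
  have split : ∀ Y : ℝ, 0 ≤ Y → Y ^ κ * Y ^ (1 - κ) = Y := by
    intro Y hY
    rw [← Real.rpow_add' hY (by simp)]
    simp
  rcases le_total B (ξ * A) with h | h
  · calc A ^ κ * B ^ (1 - κ) ≤ A ^ κ * (ξ * A) ^ (1 - κ) := by gcongr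
      _ = ζ * (A ^ κ * A ^ (1 - κ)) := by rw [Real.mul_rpow hξ0.le hA, hξ1]; ring
      _ ≤ ζ * A + (1 / ξ) ^ κ * B := by rw [split A hA]; linarith [show 0 ≤ (1 / ξ) ^ κ * B by positivity]
  · have h' : A ≤ 1 / ξ * B := by
      rw [one_div, inv_mul_eq_div, le_div_iff₀ hξ0]; linarith
    calc A ^ κ * B ^ (1 - κ) ≤ (1 / ξ * B) ^ κ * B ^ (1 - κ) := by gcongr
      _ = (1 / ξ) ^ κ * (B ^ κ * B ^ (1 - κ)) := by rw [Real.mul_rpow (by positivity) hB]; ring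
      _ ≤ ζ * A + (1 / ξ) ^ κ * B := by rw [split B hB]; linarith [show 0 ≤ ζ * A by positivity]

/-- Young's inequality in the weighted form used to absorb the right-hand side. -/
theorem exists_young {p r ζ : ℝ} (hr : 0 < r) (hrp : r ≤ p) (hζ : 0 < ζ) :
    ∃ C : ℝ, 0 < C ∧ ∀ m S g : ℝ, 0 < m → 0 < S →
      S ^ ((p - r) / 2) * |g| ^ r ≤
        ζ * (m ^ 2 * S ^ (p / 2)) + C * (m ^ (-(2 * (p - r) / r)) * |g| ^ p) := by
  have hp : 0 < p := hr.trans_le hrp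
  obtain ⟨C, hC, h⟩ := exists_rpow_mul_rpow_le (κ := (p - r) / p) (ζ := ζ)
    (div_nonneg (by linarith) hp.le) (by rw [div_lt_one hp]; linarith) hζ
  refine ⟨C, hC, fun m S g hm hS => ?_⟩
  refine le_trans (le_of_eq ?_) (h (m ^ 2 * S ^ (p / 2)) (m ^ (-(2 * (p - r) / r)) * |g| ^ p)
    (by positivity) (by positivity))
  rw [Real.mul_rpow (by positivity) (by positivity), Real.mul_rpow (by positivity) (by positivity),
    ← Real.rpow_natCast m 2, ← Real.rpow_mul hm.le, ← Real.rpow_mul hS.le, ← Real.rpow_mul hm.le,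
    ← Real.rpow_mul (abs_nonneg g)]
  rw [show p / 2 * ((p - r) / p) = (p - r) / 2 by field_simp,
    show p * (1 - (p - r) / p) = r by field_simp; ring,
    show -(2 * (p - r) / r) * (1 - (p - r) / p) = -(((2 : ℕ) : ℝ) * ((p - r) / p)) by
      push_cast; field_simp; ring, Real.rpow_neg hm.le]
  have : m ^ (((2 : ℕ) : ℝ) * ((p - r) / p)) ≠ 0 := (Real.rpow_pos_of_pos hm _).ne'
  field_simp

variable {p δ : ℝ}

theorem reg_split {S : ℝ} (hS : 0 < S) : S ^ (p / 2) = S ^ (p / 2 - 1) * S := by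
  rw [Real.rpow_sub_one hS.ne']
  field_simp

theorem reg_lower (hp : 0 < p) (hδ : 0 < δ) (s : ℝ) :
    (s ^ 2 + δ ^ 2) ^ (p / 2) / 2 - 2 ^ (p / 2) * δ ^ p ≤
      (s ^ 2 + δ ^ 2) ^ (p / 2 - 1) * s ^ 2 := by
  have hS : 0 < s ^ 2 + δ ^ 2 := by positivity
  have hh : 0 < (s ^ 2 + δ ^ 2) ^ (p / 2 - 1) := Real.rpow_pos_of_pos hS _
  have hd : 0 < 2 ^ (p / 2) * δ ^ p := by positivity
  rcases le_total (2 * δ ^ 2) (s ^ 2 + δ ^ 2) with h | h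
  · rw [reg_split hS]
    nlinarith
  · have : (s ^ 2 + δ ^ 2) ^ (p / 2) ≤ 2 ^ (p / 2) * δ ^ p := by
      calc (s ^ 2 + δ ^ 2) ^ (p / 2) ≤ (2 * δ ^ 2) ^ (p / 2) := by gcongr
        _ = _ := by
          rw [Real.mul_rpow (by norm_num) (by positivity), ← Real.rpow_natCast δ 2,
            ← Real.rpow_mul hδ.le]
          congr 2
          push_cast; ring
    have : 0 ≤ (s ^ 2 + δ ^ 2) ^ (p / 2) := by positivity
    have : 0 ≤ (s ^ 2 + δ ^ 2) ^ (p / 2 - 1) * s ^ 2 := by positivity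
    linarith

theorem le_regRatio {a₀ : ℝ} (h1 : a₀ ≤ 1) (h2 : a₀ ≤ p - 1) (hδ : 0 < δ) (s : ℝ) :
    a₀ ≤ regRatio p δ s := by
  rw [regRatio, le_div_iff₀ (by positivity)]
  nlinarith [sq_nonneg s, sq_nonneg δ]

theorem regRatio_le {a₁ : ℝ} (h1 : 1 ≤ a₁) (h2 : p - 1 ≤ a₁) (hδ : 0 < δ) (s : ℝ) :
    regRatio p δ s ≤ a₁ := by
  rw [regRatio, div_le_iff₀ (by positivity)]
  nlinarith [sq_nonneg s, sq_nonneg δ]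

set_option maxHeartbeats 1000000 in
theorem energy_pointwise (hp : 1 < p) {η c₁ CQ CH m : ℝ} (hη : 0 < η) (hη1 : η < 1) (hc₁ : 0 < c₁)
    (hCQ : 0 ≤ CQ) (hCH : 0 ≤ CH) :
    ∃ c C : ℝ, 0 < c ∧ 0 < C ∧ ∀ (δ x θ ψ Q s Y Z f wt : ℝ), 0 < δ → 0 < x → 0 < θ → 0 < ψ → 0 ≤ wt →
      |Q| ≤ CQ * (1 + θ) ^ 2 →
      c₁ * (1 + θ) ^ 2 ≤ θ ^ 2 / 2 + Q / p - m ^ 2 / (4 * (1 - η) * (p - 1)) →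
      ψ * ((1 + θ) / x) ^ (-(2 * (p - 1))) ≤ CH * wt →
      Z ^ 2 ≤ Y →
      c * (ψ * ((s ^ 2 + δ ^ 2) ^ (p / 2 - 1) * Y + ((1 + θ) / x) ^ 2 * (s ^ 2 + δ ^ 2) ^ (p / 2))) ≤
        ψ * (θ ^ 2 / x ^ 2 * (regDeriv p δ s * s)
          + p * ((s ^ 2 + δ ^ 2) ^ (p / 2 - 1) * regRatio p δ s) * Y
          + m / x * (regDeriv p δ s * Z) + Q / x ^ 2 * ((s ^ 2 + δ ^ 2) ^ (p / 2) - δ ^ p)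
          - regDeriv p δ s * f)
        + (C * (|f| ^ p * wt) + C * (δ ^ p * (ψ * ((1 + θ) / x) ^ 2))) := by
  obtain ⟨Cy, hCy, hy⟩ := exists_young (p := p) (r := 1) (ζ := c₁ / 2) one_pos hp.le (by positivity)
  set a₀ : ℝ := min 1 (p - 1) with ha₀
  have ha₀0 : 0 < a₀ := lt_min one_pos (by linarith)
  set c : ℝ := p * min (η * a₀) (c₁ / 2) with hc
  refine ⟨c, p * (Cy * CH + 2 ^ (p / 2) + CQ), by positivity, by positivity, ?_⟩
  intro δ x θ ψ Q s Y Z f wt hδ hx hθ hψ hwt hQ hQ1 hH hZ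
  have hS : 0 < s ^ 2 + δ ^ 2 := by positivity
  have hlow := reg_lower (p := p) (by linarith) hδ s
  have ha := le_regRatio (p := p) (min_le_left 1 (p - 1)) (min_le_right 1 (p - 1)) hδ s
  have hra : regRatio p δ s * (s ^ 2 + δ ^ 2) = (p - 1) * s ^ 2 + δ ^ 2 := by
    rw [regRatio]; field_simp
  have hyy := hy ((1 + θ) / x) (s ^ 2 + δ ^ 2) f (by positivity) hS
  have hsplit := reg_split (p := p) hS
  have hhs : (s ^ 2 + δ ^ 2) ^ (p / 2 - 1) * |s| ≤ (s ^ 2 + δ ^ 2) ^ ((p - 1) / 2) := by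
    have : |s| ≤ (s ^ 2 + δ ^ 2) ^ (1 / 2 : ℝ) := by
      rw [← Real.sqrt_eq_rpow]
      exact Real.abs_le_sqrt (by nlinarith [sq_nonneg δ])
    calc _ ≤ (s ^ 2 + δ ^ 2) ^ (p / 2 - 1) * (s ^ 2 + δ ^ 2) ^ (1 / 2 : ℝ) := by gcongr
      _ = _ := by rw [← Real.rpow_add hS]; congr 1; ring
  unfold regDeriv
  set S := s ^ 2 + δ ^ 2 with hSdef
  set h := S ^ (p / 2 - 1) with hh
  set R := S ^ (p / 2) with hR
  set a := regRatio p δ s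
  set K := ((1 + θ) / x) ^ 2 with hK
  have hh0 : 0 < h := Real.rpow_pos_of_pos hS _
  have hR0 : 0 < R := Real.rpow_pos_of_pos hS _
  have hd0 : 0 < δ ^ p := Real.rpow_pos_of_pos hδ _
  have ha0 : 0 < a := ha₀0.trans_le ha
  have hY : 0 ≤ Y := (sq_nonneg Z).trans hZ
  have h1η : 0 < 1 - η := by linarith
  have hp1 : 0 < p - 1 := by linarith
  have hKx : K = (1 + θ) ^ 2 / x ^ 2 := by rw [hK]; field_simp
  -- completing the square in the first-order term
  have hsq : -((1 - η) * a * Y) - m ^ 2 / (4 * (1 - η) * (p - 1)) * S / x ^ 2 ≤ m / x * (s * Z) := by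
    have h1 : 0 ≤ ((1 - η) * a * Z + m * s / (2 * x)) ^ 2 / ((1 - η) * a) := by positivity
    have h2 : ((1 - η) * a * Z + m * s / (2 * x)) ^ 2 / ((1 - η) * a) =
        (1 - η) * a * Z ^ 2 + m / x * (s * Z) + m ^ 2 / (4 * (1 - η) * x ^ 2) * (s ^ 2 / a) := by
      field_simp; ring
    have h3 : s ^ 2 / a ≤ S / (p - 1) := by
      rw [div_le_div_iff₀ ha0 hp1]; nlinarith [sq_nonneg δ]
    have h4 : m ^ 2 / (4 * (1 - η) * x ^ 2) * (s ^ 2 / a) ≤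
        m ^ 2 / (4 * (1 - η) * x ^ 2) * (S / (p - 1)) := by gcongr
    have h5 : m ^ 2 / (4 * (1 - η) * x ^ 2) * (S / (p - 1)) =
        m ^ 2 / (4 * (1 - η) * (p - 1)) * S / x ^ 2 := by field_simp
    have h6 : (1 - η) * a * Z ^ 2 ≤ (1 - η) * a * Y := by gcongr
    linarith
  have hf : h * (s * f) ≤ c₁ / 2 * (K * R) + Cy * (((1 + θ) / x) ^ (-(2 * (p - 1))) * |f| ^ p) := by
    calc h * (s * f) ≤ h * (|s| * |f|) := by
          refine mul_le_mul_of_nonneg_left ?_ hh0.le; rw [← abs_mul]; exact le_abs_self _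
      _ = h * |s| * |f| := by ring
      _ ≤ S ^ ((p - 1) / 2) * |f| := by gcongr
      _ ≤ _ := by simpa using hyy
  have hf2 : ψ * (Cy * (((1 + θ) / x) ^ (-(2 * (p - 1))) * |f| ^ p)) ≤ Cy * CH * (|f| ^ p * wt) := by
    calc _ = Cy * |f| ^ p * (ψ * ((1 + θ) / x) ^ (-(2 * (p - 1)))) := by ring
      _ ≤ Cy * |f| ^ p * (CH * wt) := by gcongr
      _ = _ := by ring
  have hx2 : 0 < x ^ 2 := by positivity
  have hmain : η * a₀ * (h * Y) + c₁ / 2 * (K * R) ≤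
      θ ^ 2 / x ^ 2 * (s * h * s) + h * a * Y + m / x * (s * h * Z) + Q / p / x ^ 2 * (R - δ ^ p)
        - h * (s * f) + Cy * (((1 + θ) / x) ^ (-(2 * (p - 1))) * |f| ^ p)
        + (2 ^ (p / 2) + CQ) * (δ ^ p * K) := by
    have t1 : θ ^ 2 / x ^ 2 * (R / 2 - 2 ^ (p / 2) * δ ^ p) ≤ θ ^ 2 / x ^ 2 * (s * h * s) := by
      rw [show s * h * s = h * s ^ 2 by ring]; gcongr
    have t2 : h * (-((1 - η) * a * Y) - m ^ 2 / (4 * (1 - η) * (p - 1)) * S / x ^ 2) ≤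
        m / x * (s * h * Z) := by
      rw [show m / x * (s * h * Z) = h * (m / x * (s * Z)) by ring]; gcongr
    have t3 : Q / p / x ^ 2 * δ ^ p ≤ CQ * (δ ^ p * K) := by
      have : Q / p ≤ CQ * (1 + θ) ^ 2 := by
        rw [div_le_iff₀ (by linarith)]
        exact ((le_abs_self Q).trans hQ).trans (le_mul_of_one_le_right (by positivity) hp.le)
      calc _ ≤ CQ * (1 + θ) ^ 2 / x ^ 2 * δ ^ p := by gcongr
        _ = _ := by rw [hKx]; ring
    have t4 : θ ^ 2 / x ^ 2 * (2 ^ (p / 2) * δ ^ p) ≤ 2 ^ (p / 2) * (δ ^ p * K) := by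
      calc _ = 2 ^ (p / 2) * (δ ^ p * (θ ^ 2 / x ^ 2)) := by ring
        _ ≤ _ := by rw [hKx]; gcongr; exact le_add_of_nonneg_left zero_le_one
    have t5 : c₁ * (K * R) ≤
        (θ ^ 2 / 2 + Q / p - m ^ 2 / (4 * (1 - η) * (p - 1))) * (R / x ^ 2) := by
      calc _ = c₁ * (1 + θ) ^ 2 * (R / x ^ 2) := by rw [hKx]; ring
        _ ≤ _ := by gcongr
    have t6 : η * a₀ * (h * Y) ≤ η * a * (h * Y) := by gcongr
    have t7 : h * (m ^ 2 / (4 * (1 - η) * (p - 1)) * S / x ^ 2) =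
        m ^ 2 / (4 * (1 - η) * (p - 1)) * (R / x ^ 2) := by rw [hsplit]; ring
    have t8 : θ ^ 2 / x ^ 2 * (R / 2) = θ ^ 2 / 2 * (R / x ^ 2) := by ring
    have t9 : Q / p / x ^ 2 * R = Q / p * (R / x ^ 2) := by ring
    have t2' : -(h * a * Y) + η * a * (h * Y) -
        m ^ 2 / (4 * (1 - η) * (p - 1)) * (R / x ^ 2) ≤ m / x * (s * h * Z) := by
      rw [← t7]; refine le_trans (le_of_eq ?_) t2; ring
    have t5' : (θ ^ 2 / 2 + Q / p - m ^ 2 / (4 * (1 - η) * (p - 1))) * (R / x ^ 2) =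
        θ ^ 2 / 2 * (R / x ^ 2) + Q / p * (R / x ^ 2) -
          m ^ 2 / (4 * (1 - η) * (p - 1)) * (R / x ^ 2) := by ring
    rw [mul_sub, t8] at t1
    rw [mul_sub, t9, add_mul]
    linarith
  have hcle : c * (ψ * (h * Y + K * R)) ≤ p * (ψ * (η * a₀ * (h * Y) + c₁ / 2 * (K * R))) := by
    have e1 : min (η * a₀) (c₁ / 2) * (h * Y) ≤ η * a₀ * (h * Y) := by
      gcongr; exact min_le_left _ _
    have e2 : min (η * a₀) (c₁ / 2) * (K * R) ≤ c₁ / 2 * (K * R) := by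
      gcongr; exact min_le_right _ _
    calc c * (ψ * (h * Y + K * R)) = p * (ψ * (min (η * a₀) (c₁ / 2) * (h * Y) +
          min (η * a₀) (c₁ / 2) * (K * R))) := by rw [hc]; ring
      _ ≤ _ := by gcongr
  refine hcle.trans ?_
  have hfin := mul_le_mul_of_nonneg_left (mul_le_mul_of_nonneg_left hmain hψ.le)
    (show 0 ≤ p by linarith)
  refine hfin.trans ?_
  have z1 : p * (ψ * (Q / p / x ^ 2 * (R - δ ^ p))) = ψ * (Q / x ^ 2 * (R - δ ^ p)) := by
    field_simp
  have hfw : 0 ≤ |f| ^ p * wt := by positivity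
  have hdK : 0 ≤ δ ^ p * (ψ * K) := by positivity
  have z3 : p * (Cy * CH) * (|f| ^ p * wt) ≤ p * (Cy * CH + 2 ^ (p / 2) + CQ) * (|f| ^ p * wt) := by
    gcongr
    have : (0 : ℝ) ≤ 2 ^ (p / 2) := by positivity
    linarith
  have z4 : p * (2 ^ (p / 2) + CQ) * (δ ^ p * (ψ * K)) ≤
      p * (Cy * CH + 2 ^ (p / 2) + CQ) * (δ ^ p * (ψ * K)) := by
    gcongr
    have : 0 ≤ Cy * CH := by positivity
    linarith
  have z5 := mul_le_mul_of_nonneg_left hf2 (show 0 ≤ p by linarith)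
  calc _ = p * (ψ * (θ ^ 2 / x ^ 2 * (s * h * s))) + p * (ψ * (h * a * Y)) +
        p * (ψ * (m / x * (s * h * Z))) + p * (ψ * (Q / p / x ^ 2 * (R - δ ^ p)))
        - p * (ψ * (h * (s * f))) + p * (ψ * (Cy * (((1 + θ) / x) ^ (-(2 * (p - 1))) * |f| ^ p)))
        + p * (2 ^ (p / 2) + CQ) * (δ ^ p * (ψ * K)) := by ring
    _ ≤ p * (ψ * (θ ^ 2 / x ^ 2 * (s * h * s))) + p * (ψ * (h * a * Y)) +
        p * (ψ * (m / x * (s * h * Z))) + ψ * (Q / x ^ 2 * (R - δ ^ p))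
        - p * (ψ * (h * (s * f))) + (p * (Cy * CH + 2 ^ (p / 2) + CQ) * (|f| ^ p * wt)
        + p * (Cy * CH + 2 ^ (p / 2) + CQ) * (δ ^ p * (ψ * K))) := by
          rw [z1]; linarith
    _ = _ := by ring

end Pointwise

section Bernstein

theorem neg_le_mul_mul {b τ β : ℝ} (hτ : 0 < τ) (hβ : |β| ≤ b) (X Y : ℝ) :
    -(τ * X ^ 2) - b ^ 2 / (4 * τ) * Y ^ 2 ≤ β * (X * Y) := by
  have hb : β ^ 2 ≤ b ^ 2 := sq_le_sq' (by linarith [neg_abs_le β]) ((le_abs_self β).trans hβ)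
  have h1 : 0 ≤ (2 * τ * X + β * Y) ^ 2 / (4 * τ) := by positivity
  have h2 : (2 * τ * X + β * Y) ^ 2 / (4 * τ) =
      τ * X ^ 2 + β * (X * Y) + β ^ 2 / (4 * τ) * Y ^ 2 := by field_simp; ring
  have h3 : β ^ 2 / (4 * τ) * Y ^ 2 ≤ b ^ 2 / (4 * τ) * Y ^ 2 := by gcongr
  linarith

variable {ι : Type*} [Fintype ι]

theorem gradient_energy_scaled {α b₀ a₁ : ℝ} (hα : 0 ≤ α) (hb₀ : 0 ≤ b₀) :
    ∃ C₁ : ℝ, 0 < C₁ ∧ ∀ M : ℝ, 0 < M → ∃ C₂ : ℝ, 0 < C₂ ∧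
      ∀ (k : ι) (c v D : ι → ℝ) (a B θ g q : ℝ), (∀ i, |c i| ≤ 1) → 1 ≤ a → a ≤ a₁ → |B| ≤ b₀ →
        (θ ^ 2 + M / 2) * v k ^ 2 - C₁ * (g ^ 2 + v k ^ 2 + ∑ i, v i ^ 2) - C₂ * q ^ 2 ≤
          a * D k * g + θ ^ 2 * v k ^ 2 + c k * (B - α) * (v k * g)
            + c k * (α * (a * ∑ i, D i * v i) + α * (B - 1) * (v k * ∑ i, c i * v i))
            + a * ∑ i, D i ^ 2 + B * (v k * ∑ i, c i * D i)
            + M * (a * D k * q + v k ^ 2 + c k * (B - 2) * (v k * q)) := by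
  set n : ℝ := (Fintype.card ι : ℝ) with hn
  set P : ℝ := (α * a₁) ^ 2 / (4 * (1 / 8)) + (α * (b₀ + 1)) ^ 2 / (4 * 1)
  set V : ℝ := b₀ ^ 2 / (4 * (1 / 8)) + 1
  have hP : 0 ≤ P := by positivity
  have hV : 0 ≤ V := by positivity
  refine ⟨a₁ ^ 2 / (4 * (1 / 8)) + (b₀ + α) ^ 2 / (4 * 1) + 1 + P + n * V, by positivity,
    fun M hM => ⟨(M * a₁) ^ 2 / (4 * (1 / 8)) + (M * (b₀ + 2)) ^ 2 / (4 * (M / 2)),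
      by positivity, ?_⟩⟩
  intro k c v D a B θ g q hc ha ha' hB
  have ha0 : 0 ≤ a := by linarith
  have habs : |a| ≤ a₁ := by rwa [abs_of_nonneg ha0]
  have hBα : |B - α| ≤ b₀ + α := (abs_sub _ _).trans (by rw [abs_of_nonneg hα]; linarith)
  have hB1 : |B - 1| ≤ b₀ + 1 := (abs_sub _ _).trans (by rw [abs_one]; linarith)
  have hB2 : |B - 2| ≤ b₀ + 2 := (abs_sub _ _).trans (by rw [abs_two]; linarith)
  have cmul : ∀ i (t T : ℝ), |t| ≤ T → |c i * t| ≤ T := fun i t T h => by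
    rw [abs_mul]
    exact (mul_le_of_le_one_left (abs_nonneg _) (hc i)).trans h
  have hi : ∀ i, 3 / 4 * D i ^ 2 - P * v i ^ 2 - V * v k ^ 2 ≤
      c k * (α * (a * (D i * v i))) + c k * (α * (B - 1) * (v k * (c i * v i)))
        + a * D i ^ 2 + B * (v k * (c i * D i)) := by
    intro i
    have h1 := neg_le_mul_mul (τ := 1 / 8) (b := α * a₁) (β := c k * (α * a)) (by norm_num)
      (cmul k _ _ (by rw [abs_mul, abs_of_nonneg hα]; gcongr)) (D i) (v i)
    have h2 := neg_le_mul_mul (τ := 1) (b := α * (b₀ + 1)) (β := c k * (c i * (α * (B - 1))))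
      (by norm_num)
      (cmul k _ _ (cmul i _ _ (by rw [abs_mul, abs_of_nonneg hα]; gcongr))) (v k) (v i)
    have h3 := neg_le_mul_mul (τ := 1 / 8) (b := b₀) (β := c i * B) (by norm_num)
      (cmul i _ _ hB) (D i) (v k)
    have h4 : D i ^ 2 ≤ a * D i ^ 2 := le_mul_of_one_le_left (sq_nonneg _) ha
    calc _ = D i ^ 2 + (-(1 / 8 * D i ^ 2) - (α * a₁) ^ 2 / (4 * (1 / 8)) * v i ^ 2) +
          (-(1 * v k ^ 2) - (α * (b₀ + 1)) ^ 2 / (4 * 1) * v i ^ 2) +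
          (-(1 / 8 * D i ^ 2) - b₀ ^ 2 / (4 * (1 / 8)) * v k ^ 2) := by simp only [P, V]; ring
      _ ≤ a * D i ^ 2 + c k * (α * a) * (D i * v i) + c k * (c i * (α * (B - 1))) * (v k * v i)
          + c i * B * (D i * v k) := by linarith
      _ = _ := by ring
  have hsum := Finset.sum_le_sum fun i (_ : i ∈ Finset.univ) => hi i
  simp only [Finset.sum_add_distrib, Finset.sum_sub_distrib, ← Finset.mul_sum, Finset.sum_const,
    Finset.card_univ, nsmul_eq_mul] at hsum
  rw [← hn] at hsum
  have hDk : D k ^ 2 ≤ ∑ i, D i ^ 2 :=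
    Finset.single_le_sum (f := fun i => D i ^ 2) (fun i _ => sq_nonneg _) (Finset.mem_univ k)
  have g1 := neg_le_mul_mul (τ := 1 / 8) (b := a₁) (by norm_num) habs (D k) g
  have g2 := neg_le_mul_mul (τ := 1) (b := b₀ + α) (by norm_num) (cmul k _ _ hBα) (v k) g
  have g3 := neg_le_mul_mul (τ := 1 / 8) (b := M * a₁) (β := M * a) (by norm_num)
    (by rw [abs_mul, abs_of_pos hM]; gcongr) (D k) q
  have g4 := neg_le_mul_mul (τ := M / 2) (b := M * (b₀ + 2)) (β := M * (c k * (B - 2)))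
    (by positivity) (by rw [abs_mul, abs_of_pos hM]; gcongr; exact cmul k _ _ hB2) (v k) q
  have hs : 0 ≤ ∑ i, v i ^ 2 := Finset.sum_nonneg fun i _ => sq_nonneg _
  have k1 : 0 ≤ (a₁ ^ 2 / (4 * (1 / 8)) + (b₀ + α) ^ 2 / (4 * 1) + 1 + n * V) * ∑ i, v i ^ 2 := by
    positivity
  have k2 : 0 ≤ (a₁ ^ 2 / (4 * (1 / 8)) + (b₀ + α) ^ 2 / (4 * 1) + P) * v k ^ 2 := by positivity
  have k3 : 0 ≤ (1 + P + n * V) * g ^ 2 := by positivity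

  linarith [sq_nonneg (D k)]

theorem reg_mul_sq_le {p δ : ℝ} (hp : 2 ≤ p) (hδ : 0 < δ) (s r : ℝ) :
    (s ^ 2 + δ ^ 2) ^ (p / 2 - 1) * r ^ 2 ≤ (s ^ 2 + δ ^ 2) ^ (p / 2) + (r ^ 2 + δ ^ 2) ^ (p / 2) := by
  have hS : 0 < s ^ 2 + δ ^ 2 := by positivity
  have hR : 0 < r ^ 2 + δ ^ 2 := by positivity
  rcases le_total (r ^ 2) (s ^ 2) with h | h
  · have : (s ^ 2 + δ ^ 2) ^ (p / 2 - 1) * r ^ 2 ≤ (s ^ 2 + δ ^ 2) ^ (p / 2) := by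
      rw [reg_split hS]; gcongr; nlinarith [sq_nonneg δ]
    linarith [Real.rpow_pos_of_pos hR (p / 2)]
  · have : (s ^ 2 + δ ^ 2) ^ (p / 2 - 1) * r ^ 2 ≤ (r ^ 2 + δ ^ 2) ^ (p / 2) := by
      rw [reg_split hR]
      gcongr
      · linarith
      · nlinarith [sq_nonneg δ]
    linarith [Real.rpow_pos_of_pos hS (p / 2)]

theorem gradient_energy_reg {p α b₀ : ℝ} (hp : 2 ≤ p) (hα : 0 ≤ α) (hb₀ : 0 ≤ b₀) :
    ∃ M C : ℝ, 0 < M ∧ 0 < C ∧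
      ∀ (c v : ι → ℝ) (D : ι → ι → ℝ) (δ B θ g q : ℝ), (∀ i, |c i| ≤ 1) → 0 < δ → 0 < θ →
        |B| ≤ b₀ →
        (1 + θ) ^ 2 / 8 * ∑ k, (v k ^ 2 + δ ^ 2) ^ (p / 2) ≤
          ∑ k, (v k ^ 2 + δ ^ 2) ^ (p / 2 - 1) *
            (regRatio p δ (v k) * D k k * g + θ ^ 2 * v k ^ 2 + c k * (B - α) * (v k * g)
            + c k * (α * (regRatio p δ (v k) * ∑ i, D k i * v i)
              + α * (B - 1) * (v k * ∑ i, c i * v i))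
            + regRatio p δ (v k) * ∑ i, D k i ^ 2 + B * (v k * ∑ i, c i * D k i)
            + M * (regRatio p δ (v k) * D k k * q + v k ^ 2 + c k * (B - 2) * (v k * q)))
          + C * ((1 + θ) ^ (-(p - 2)) * |g| ^ p + |q| ^ p + δ ^ p * (1 + θ) ^ 2) := by
  obtain ⟨C₁, hC₁, H⟩ := gradient_energy_scaled (ι := ι) (a₁ := p - 1 + 1) hα hb₀
  set n : ℝ := (Fintype.card ι : ℝ) with hn
  have hn0 : 0 ≤ n := Nat.cast_nonneg _
  set M : ℝ := 4 * (C₁ * (1 + 2 * n) + 1) with hM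
  have hM0 : 0 < M := by positivity
  obtain ⟨C₂, hC₂, H⟩ := H M hM0
  obtain ⟨Y₁, hY₁, y₁⟩ := exists_young (p := p) (r := 2) (ζ := 1 / (8 * C₁)) two_pos hp
    (by positivity)
  obtain ⟨Y₂, hY₂, y₂⟩ := exists_young (p := p) (r := 2) (ζ := 1 / (4 * C₂)) two_pos hp
    (by positivity)
  refine ⟨M, n * (C₁ * Y₁ + C₂ * Y₂ + (1 + M / 2) * 2 ^ (p / 2)) + 1, hM0, by positivity, ?_⟩
  intro c v D δ B θ g q hc hδ hθ hB
  have hθ2 : θ ^ 2 + M / 2 ≤ (1 + M / 2) * (1 + θ) ^ 2 := by nlinarith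
  have hδp : 0 < δ ^ p := Real.rpow_pos_of_pos hδ _
  set G := (1 + θ) ^ (-(p - 2)) * |g| ^ p with hG
  have hG0 : 0 ≤ G := by positivity
  have hq0 : 0 ≤ |q| ^ p := by positivity
  have key : ∀ k, (θ ^ 2 / 2 + M / 4 - C₁ - (1 + θ) ^ 2 / 8 - 1 / 4) * (v k ^ 2 + δ ^ 2) ^ (p / 2)
      - C₁ * ∑ i, ((v k ^ 2 + δ ^ 2) ^ (p / 2) + (v i ^ 2 + δ ^ 2) ^ (p / 2))
      - (C₁ * Y₁ + C₂ * Y₂ + (1 + M / 2) * 2 ^ (p / 2)) * (G + |q| ^ p + δ ^ p * (1 + θ) ^ 2) ≤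
      (v k ^ 2 + δ ^ 2) ^ (p / 2 - 1) *
            (regRatio p δ (v k) * D k k * g + θ ^ 2 * v k ^ 2 + c k * (B - α) * (v k * g)
            + c k * (α * (regRatio p δ (v k) * ∑ i, D k i * v i)
              + α * (B - 1) * (v k * ∑ i, c i * v i))
            + regRatio p δ (v k) * ∑ i, D k i ^ 2 + B * (v k * ∑ i, c i * D k i)
            + M * (regRatio p δ (v k) * D k k * q + v k ^ 2 + c k * (B - 2) * (v k * q))) := by
    intro k
    have hS : 0 < v k ^ 2 + δ ^ 2 := by positivity
    have hh : 0 < (v k ^ 2 + δ ^ 2) ^ (p / 2 - 1) := Real.rpow_pos_of_pos hS _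
    have hR : 0 < (v k ^ 2 + δ ^ 2) ^ (p / 2) := Real.rpow_pos_of_pos hS _
    refine le_trans ?_ (mul_le_mul_of_nonneg_left (H k c v (D k) _ B θ g q hc
      (le_regRatio (p := p) le_rfl (by linarith) hδ _)
      (regRatio_le (p := p) (by linarith) (by linarith) hδ _) hB) hh.le)
    have hlow := mul_le_mul_of_nonneg_left (reg_lower (p := p) (by linarith) hδ (v k))
      (show 0 ≤ θ ^ 2 + M / 2 by positivity)
    have hup : (v k ^ 2 + δ ^ 2) ^ (p / 2 - 1) * v k ^ 2 ≤ (v k ^ 2 + δ ^ 2) ^ (p / 2) := by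
      rw [reg_split hS]; gcongr; linarith [sq_nonneg δ]
    have hcross := Finset.sum_le_sum fun i (_ : i ∈ Finset.univ) =>
      reg_mul_sq_le hp hδ (v k) (v i)
    rw [← Finset.mul_sum] at hcross
    have hy₁ := mul_le_mul_of_nonneg_left (y₁ (1 + θ) _ g (by positivity) hS) hC₁.le
    have hy₂ := mul_le_mul_of_nonneg_left (y₂ 1 _ q one_pos hS) hC₂.le
    rw [show (p - 2) / 2 = p / 2 - 1 by ring, show 2 * (p - 2) / 2 = p - 2 by ring] at hy₁ hy₂
    rw [Real.one_rpow, one_pow, one_mul, one_mul] at hy₂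
    rw [Real.rpow_two, sq_abs] at hy₁ hy₂
    rw [← hG] at hy₁
    generalize (v k ^ 2 + δ ^ 2) ^ (p / 2 - 1) = h at *
    set R := (v k ^ 2 + δ ^ 2) ^ (p / 2)
    have e₁ : C₁ * (1 / (8 * C₁) * ((1 + θ) ^ 2 * R) + Y₁ * G) =
        (1 + θ) ^ 2 / 8 * R + C₁ * Y₁ * G := by field_simp
    have e₂ : C₂ * (1 / (4 * C₂) * R + Y₂ * |q| ^ p) = 1 / 4 * R + C₂ * Y₂ * |q| ^ p := by
      field_simp
    rw [e₁] at hy₁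
    rw [e₂] at hy₂
    have h1 := mul_le_mul_of_nonneg_left hup hC₁.le
    have h2 := mul_le_mul_of_nonneg_left hcross hC₁.le
    have h3 : (θ ^ 2 + M / 2) * (2 ^ (p / 2) * δ ^ p) ≤
        (1 + M / 2) * 2 ^ (p / 2) * (δ ^ p * (1 + θ) ^ 2) := by
      calc _ ≤ (1 + M / 2) * (1 + θ) ^ 2 * (2 ^ (p / 2) * δ ^ p) := by gcongr
        _ = _ := by ring
    have k1 : 0 ≤ (C₁ * Y₁ + (1 + M / 2) * 2 ^ (p / 2)) * |q| ^ p := by positivity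
    have k2 : 0 ≤ (C₂ * Y₂ + (1 + M / 2) * 2 ^ (p / 2)) * G := by positivity
    have k3 : 0 ≤ (C₁ * Y₁ + C₂ * Y₂) * (δ ^ p * (1 + θ) ^ 2) := by positivity
    clear_value R
    linarith
  have hsum := Finset.sum_le_sum fun k (_ : k ∈ Finset.univ) => key k
  simp only [Finset.sum_sub_distrib, ← Finset.mul_sum, Finset.sum_add_distrib, Finset.sum_const,
    Finset.card_univ, nsmul_eq_mul] at hsum
  rw [← hn] at hsum
  set S := ∑ k, (v k ^ 2 + δ ^ 2) ^ (p / 2)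
  have hS0 : 0 ≤ S := Finset.sum_nonneg fun i _ => by positivity
  have hco : (1 + θ) ^ 2 / 8 ≤
      θ ^ 2 / 2 + M / 4 - C₁ - (1 + θ) ^ 2 / 8 - 1 / 4 - C₁ * (2 * n) := by
    rw [hM]; nlinarith [sq_nonneg (θ - 1)]
  have hE : 0 ≤ G + |q| ^ p + δ ^ p * (1 + θ) ^ 2 := by positivity
  have h4 := mul_le_mul_of_nonneg_right hco hS0
  linarith

end Bernstein

section GradientPointwise
variable {ι : Type*} [Fintype ι]

theorem gradient_pointwise {p α b₀ CG : ℝ} (hp : 2 ≤ p) (hα : 0 ≤ α) (hb₀ : 0 ≤ b₀)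
    (hCG : 0 ≤ CG) :
    ∃ M C : ℝ, 0 < C ∧
      ∀ (c v : ι → ℝ) (D : ι → ι → ℝ) (δ x θ ψ B f u wt wq : ℝ), (∀ i, |c i| ≤ 1) → 0 < δ → 0 < x →
        0 < θ → 0 < ψ → 0 ≤ wt → 0 ≤ wq → |B| ≤ b₀ →
        ψ / x ^ 2 * ((1 + θ) ^ (-(p - 2)) * x ^ p) ≤ CG * wt →
        ψ / x ^ 2 ≤ CG * (wq * x ^ p) →
        p / 8 * (ψ * ((1 + θ) / x) ^ 2 * ∑ k, (v k ^ 2 + δ ^ 2) ^ (p / 2)) ≤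
          ∑ k, (ψ *
            (p * ((v k ^ 2 + δ ^ 2) ^ (p / 2 - 1) * regRatio p δ (v k)) * D k k * f
            + θ ^ 2 / x ^ 2 * (regDeriv p δ (v k) * v k)
            + c k * (B - α) / x * (regDeriv p δ (v k) * f)
            + c k * (α / x * (p * ((v k ^ 2 + δ ^ 2) ^ (p / 2 - 1) * regRatio p δ (v k)) *
                  ∑ i, D k i * v i)
              + α * (B - 1) / x ^ 2 * (regDeriv p δ (v k) * ∑ i, c i * v i))
            + p * ((v k ^ 2 + δ ^ 2) ^ (p / 2 - 1) * regRatio p δ (v k)) * ∑ i, D k i ^ 2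
            + B / x * (regDeriv p δ (v k) * ∑ i, c i * D k i))
            + M * (ψ / x ^ 2 *
              (p * ((v k ^ 2 + δ ^ 2) ^ (p / 2 - 1) * regRatio p δ (v k)) * D k k * u
              + regDeriv p δ (v k) * v k + c k * (B - 2) / x * (regDeriv p δ (v k) * u))))
          + (C * (|f| ^ p * wt) + C * (|u| ^ p * wq) + C * (δ ^ p * (ψ * ((1 + θ) / x) ^ 2))) := by
  obtain ⟨M, C, hM, hC, H⟩ := gradient_energy_reg (ι := ι) hp hα hb₀
  refine ⟨M, p * C * (CG + 1), by positivity, ?_⟩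
  intro c v D δ x θ ψ B f u wt wq hc hδ hx hθ hψ hwt hwq hB h1 h2
  have hp0 : 0 < p := by linarith
  have key := mul_le_mul_of_nonneg_left (H c v (fun k i => x * D k i) δ B θ (x * f) (u / x)
    hc hδ hθ hB) (show 0 ≤ p * (ψ / x ^ 2) by positivity)
  have hxp : 0 < x ^ p := Real.rpow_pos_of_pos hx _
  have hδp : 0 < δ ^ p := Real.rpow_pos_of_pos hδ _
  have ef : ψ / x ^ 2 * ((1 + θ) ^ (-(p - 2)) * |x * f| ^ p) ≤ CG * (|f| ^ p * wt) := by
    rw [abs_mul, abs_of_pos hx, Real.mul_rpow hx.le (abs_nonneg f)]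
    calc _ = |f| ^ p * (ψ / x ^ 2 * ((1 + θ) ^ (-(p - 2)) * x ^ p)) := by ring
      _ ≤ |f| ^ p * (CG * wt) := by gcongr
      _ = _ := by ring
  have eu : ψ / x ^ 2 * |u / x| ^ p ≤ CG * (|u| ^ p * wq) := by
    rw [abs_div, abs_of_pos hx, Real.div_rpow (abs_nonneg u) hx.le]
    calc _ ≤ CG * (wq * x ^ p) * (|u| ^ p / x ^ p) := by gcongr
      _ = _ := by field_simp
  have hK : ψ / x ^ 2 * (1 + θ) ^ 2 = ψ * ((1 + θ) / x) ^ 2 := by field_simp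
  have hE : p * (ψ / x ^ 2) * (C * ((1 + θ) ^ (-(p - 2)) * |x * f| ^ p + |u / x| ^ p +
      δ ^ p * (1 + θ) ^ 2)) ≤ p * C * (CG + 1) * (|f| ^ p * wt) + p * C * (CG + 1) * (|u| ^ p * wq)
        + p * C * (CG + 1) * (δ ^ p * (ψ * ((1 + θ) / x) ^ 2)) := by
    have i1 : 0 ≤ |f| ^ p * wt := by positivity
    have i2 : 0 ≤ |u| ^ p * wq := by positivity
    have i3 : 0 ≤ CG * (δ ^ p * (ψ * ((1 + θ) / x) ^ 2)) := by positivity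
    calc _ = p * C * (ψ / x ^ 2 * ((1 + θ) ^ (-(p - 2)) * |x * f| ^ p) + ψ / x ^ 2 * |u / x| ^ p +
          δ ^ p * (ψ / x ^ 2 * (1 + θ) ^ 2)) := by ring
      _ ≤ p * C * ((CG + 1) * (|f| ^ p * wt) + (CG + 1) * (|u| ^ p * wq) +
          (CG + 1) * (δ ^ p * (ψ * ((1 + θ) / x) ^ 2))) := by
            rw [hK]
            refine mul_le_mul_of_nonneg_left ?_ (by positivity)
            have i4 : 0 ≤ δ ^ p * (ψ * ((1 + θ) / x) ^ 2) := by positivity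
            linarith
      _ = _ := by ring
  have hl : p * (ψ / x ^ 2) * ((1 + θ) ^ 2 / 8 * ∑ k, (v k ^ 2 + δ ^ 2) ^ (p / 2)) =
      p / 8 * (ψ * ((1 + θ) / x) ^ 2 * ∑ k, (v k ^ 2 + δ ^ 2) ^ (p / 2)) := by
    rw [← hK]; ring
  rw [hl, mul_add] at key
  refine key.trans (add_le_add (le_of_eq ?_) hE)
  rw [Finset.mul_sum]
  refine Finset.sum_congr rfl fun k _ => ?_
  have s1 : ∑ i, x * D k i * v i = x * ∑ i, D k i * v i := by
    rw [Finset.mul_sum]; exact Finset.sum_congr rfl fun i _ => by ring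
  have s2 : ∑ i, (x * D k i) ^ 2 = x ^ 2 * ∑ i, D k i ^ 2 := by
    rw [Finset.mul_sum]; exact Finset.sum_congr rfl fun i _ => by ring
  have s3 : ∑ i, c i * (x * D k i) = x * ∑ i, c i * D k i := by
    rw [Finset.mul_sum]; exact Finset.sum_congr rfl fun i _ => by ring
  rw [s1, s2, s3]
  unfold regDeriv
  field_simp

end GradientPointwise

section Weights

/-- The weight `x^β θ^μ (1 + ε θ)^κ` with `θ = k x^ν`. -/
def degenWeight (β μ κ ε ν k x : ℝ) : ℝ :=
  x ^ β * (k * x ^ ν) ^ μ * (1 + ε * (k * x ^ ν)) ^ κ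

/-- The function `x ψ'(x) / ψ(x)` for the weight `ψ = degenWeight β μ κ ε ν k`. -/
def degenWeightLogDeriv (β μ κ ε ν k x : ℝ) : ℝ :=
  β + μ * ν + κ * ν * (ε * (k * x ^ ν) / (1 + ε * (k * x ^ ν)))

variable {β μ κ ε ν k x : ℝ}

theorem degenWeight_pos (hε : 0 ≤ ε) (hk : 0 < k) (hx : 0 < x) : 0 < degenWeight β μ κ ε ν k x := by
  unfold degenWeight; positivity

theorem hasDerivAt_mul_rpow (hx : 0 < x) :
    HasDerivAt (fun s => k * s ^ ν) (ν * (k * x ^ ν) / x) x := by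
  refine ((Real.hasDerivAt_rpow_const (p := ν) (Or.inl hx.ne')).const_mul k).congr_deriv ?_
  rw [Real.rpow_sub_one hx.ne']; ring

theorem hasDerivAt_degenWeight (hε : 0 ≤ ε) (hk : 0 < k) (hx : 0 < x) :
    HasDerivAt (degenWeight β μ κ ε ν k)
      (degenWeightLogDeriv β μ κ ε ν k x * degenWeight β μ κ ε ν k x / x) x := by
  have hθ : 0 < k * x ^ ν := by positivity
  have hy : 0 < 1 + ε * (k * x ^ ν) := by positivity
  have h1 := Real.hasDerivAt_rpow_const (p := β) (Or.inl hx.ne')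
  have h2 := (hasDerivAt_mul_rpow (k := k) (ν := ν) hx).rpow_const (p := μ) (Or.inl hθ.ne')
  have h3 := (((hasDerivAt_mul_rpow (k := k) (ν := ν) hx).const_mul ε).const_add 1).rpow_const
    (p := κ) (Or.inl hy.ne')
  refine ((h1.mul h2).mul h3).congr_deriv ?_
  unfold degenWeight degenWeightLogDeriv
  simp only [Pi.mul_apply]
  rw [Real.rpow_sub_one hx.ne', Real.rpow_sub_one hθ.ne', Real.rpow_sub_one hy.ne']
  field_simp

theorem hasDerivAt_degenWeightLogDeriv (hε : 0 ≤ ε) (hk : 0 < k) (hx : 0 < x) :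
    HasDerivAt (degenWeightLogDeriv β μ κ ε ν k)
      (κ * ν ^ 2 * (ε * (k * x ^ ν) / (1 + ε * (k * x ^ ν)) ^ 2) / x) x := by
  have hy : 1 + ε * (k * x ^ ν) ≠ 0 := by positivity
  have h := (hasDerivAt_mul_rpow (k := k) (ν := ν) hx).const_mul ε
  refine (((h.div (h.const_add 1) hy).const_mul (κ * ν)).const_add (β + μ * ν)).congr_deriv ?_
  field_simp
  ring

theorem continuousOn_degenWeight (hε : 0 ≤ ε) (hk : 0 < k) :
    ContinuousOn (degenWeight β μ κ ε ν k) (Ioi 0) := fun _ hs =>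
  (hasDerivAt_degenWeight hε hk hs).continuousAt.continuousWithinAt

theorem continuousOn_degenWeightLogDeriv (hε : 0 ≤ ε) (hk : 0 < k) :
    ContinuousOn (degenWeightLogDeriv β μ κ ε ν k) (Ioi 0) := fun _ hs =>
  (hasDerivAt_degenWeightLogDeriv hε hk hs).continuousAt.continuousWithinAt

theorem continuousOn_degenWeightLogDeriv_deriv (hε : 0 ≤ ε) (hk : 0 < k) :
    ContinuousOn (fun x => κ * ν ^ 2 * (ε * (k * x ^ ν) / (1 + ε * (k * x ^ ν)) ^ 2)) (Ioi 0) := by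
  have h : ContinuousOn (fun x : ℝ => ε * (k * x ^ ν)) (Ioi 0) := fun s hs =>
    ((hasDerivAt_mul_rpow hs).const_mul ε).continuousAt.continuousWithinAt
  refine continuousOn_const.mul (h.div ((continuousOn_const.add h).pow 2) fun s hs => ?_)
  have hs' : (0 : ℝ) < s := hs
  positivity

theorem abs_degenWeightLogDeriv_le (hε : 0 ≤ ε) (hk : 0 < k) (hx : 0 < x) :
    |degenWeightLogDeriv β μ κ ε ν k x| ≤ |β + μ * ν| + |κ * ν| := by
  have hθ : 0 ≤ ε * (k * x ^ ν) := by positivity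
  have ht : |ε * (k * x ^ ν) / (1 + ε * (k * x ^ ν))| ≤ 1 := by
    rw [abs_of_nonneg (by positivity), div_le_one (by positivity)]; linarith
  refine (abs_add_le _ _).trans (add_le_add_right ?_ _)
  rw [abs_mul]
  exact mul_le_of_le_one_right (abs_nonneg _) ht

theorem one_add_mul_rpow_le {θ : ℝ} (hε : 0 < ε) (hε1 : ε ≤ 1) (hθ : 0 < θ) (κ : ℝ) :
    (1 + ε * θ) ^ κ ≤ (1 + ε ^ κ) * (1 + θ) ^ κ := by
  have h1 : 1 + ε * θ ≤ 1 + θ := by nlinarith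
  have h2 : ε * (1 + θ) ≤ 1 + ε * θ := by nlinarith
  have hp : 0 < (1 + θ) ^ κ := by positivity
  have hq : 0 < ε ^ κ * (1 + θ) ^ κ := by positivity
  rcases le_total 0 κ with h | h
  · have : (1 + ε * θ) ^ κ ≤ (1 + θ) ^ κ := by gcongr
    linarith
  · have := Real.rpow_le_rpow_of_nonpos (by positivity) h2 h
    rw [Real.mul_rpow hε.le (by positivity)] at this
    linarith

theorem rpow_one_add_le {θ : ℝ} (hε : 0 < ε) (hε1 : ε ≤ 1) (hθ : 0 < θ) (κ : ℝ) :
    (1 + θ) ^ κ ≤ (1 + ε ^ (-κ)) * (1 + ε * θ) ^ κ := by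
  have h := one_add_mul_rpow_le hε hε1 hθ (-κ)
  rw [Real.rpow_neg (by positivity), Real.rpow_neg (by positivity : 0 ≤ 1 + θ)] at h
  have h1 : 0 < (1 + θ) ^ κ := by positivity
  have h2 : 0 < (1 + ε * θ) ^ κ := by positivity
  rw [← div_eq_mul_inv, inv_eq_one_div, div_le_div_iff₀ h2 h1] at h
  linarith

/-- Admissible exponents for the energy weight. -/
theorem exists_energy_params {p γ : ℝ} (hp : 1 < p) (hν : 0 < ν)
    (h1 : 1 - p < γ - 2 * p + 2 + p * ν)
    (h2 : γ - 2 * p + 2 < 1) :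
    ∃ μ, 0 ≤ μ ∧ μ ≤ p ∧ 1 - p < γ - 2 * p + 2 + μ * ν ∧ γ - 2 * p + 2 + μ * ν < 1 := by
  set b₀ := γ - 2 * p + 2
  set b := max b₀ (min (b₀ + p * ν) (1 - p / 2)) with hb
  have hb0 : b₀ ≤ b := le_max_left _ _
  have hb1 : b ≤ b₀ + p * ν :=
    max_le (by have : 0 ≤ p * ν := by positivity
               linarith) (min_le_left _ _)
  have e : b₀ + (b - b₀) / ν * ν = b := by field_simp; ring
  refine ⟨(b - b₀) / ν, div_nonneg (by linarith) hν.le, ?_, ?_, ?_⟩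
  · rw [div_le_iff₀ hν]; linarith
  · rw [e]; exact lt_max_of_lt_right (lt_min h1 (by linarith))
  · rw [e]; exact max_lt h2 ((min_le_right _ _).trans_lt (by linarith))

theorem exists_energy_coercive {p b κ : ℝ} (hp : 1 < p) (hb : 1 - p < b) (hb1 : b < 1)
    (hν : 0 ≤ ν) :
    ∃ ε η c₁ CQ m : ℝ, 0 < ε ∧ ε ≤ 1 ∧ 0 < η ∧ η < 1 ∧ 0 < c₁ ∧ 0 ≤ CQ ∧ ∀ θ Q B : ℝ, 0 < θ →
      B = b + κ * ν * (ε * θ / (1 + ε * θ)) →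
      Q = (m - B) * (B - 1) - κ * ν ^ 2 * (ε * θ / (1 + ε * θ) ^ 2) →
      |Q| ≤ CQ * (1 + θ) ^ 2 ∧
        c₁ * (1 + θ) ^ 2 ≤ θ ^ 2 / 2 + Q / p - m ^ 2 / (4 * (1 - η) * (p - 1)) := by
  have hp0 : 0 < p := by linarith
  have hp1 : 0 < p - 1 := by linarith
  have hb' : 0 < 1 - b := by linarith
  have hb'' : 0 < b + p - 1 := by linarith
  set m := -(2 * (p - 1) * (1 - b) / p) with hm
  set c₀ := (1 - b) * (b + p - 1) / p ^ 2 with hc₀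
  have hc₀0 : 0 < c₀ := by positivity
  set A := m ^ 2 / (4 * (p - 1)) with hA
  have hA0 : 0 < A := by
    have : m ≠ 0 := by rw [hm]; exact neg_ne_zero.2 (by positivity)
    positivity
  have hη : 1 - (c₀ / 2) / (A + c₀ / 2) = A / (A + c₀ / 2) := by field_simp; ring
  set k := κ * ν
  set E := |k| * (|m - b| + |b - 1| + |k| + ν) with hE
  have hE0 : 0 ≤ E := by positivity
  set c' := min c₀ 1 / 2 with hc'
  have hc'0 : 0 < c' := by positivity
  have hc'1 : c' ≤ c₀ / 2 := by rw [hc']; gcongr; exact min_le_left _ _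
  have hc'2 : c' ≤ 1 / 2 := by rw [hc']; gcongr; exact min_le_right _ _
  set ε := min 1 (c' / (E / p + 1)) with hεdef
  have hε0 : 0 < ε := by positivity
  have hε : ε * (E / p) ≤ c' := by
    have h := min_le_right 1 (c' / (E / p + 1))
    rw [← hεdef, le_div_iff₀ (by positivity)] at h
    linarith
  refine ⟨ε, (c₀ / 2) / (A + c₀ / 2), c' / 4, |(m - b) * (b - 1)| + E, m, hε0, min_le_left _ _,
    by positivity, ?_, by positivity, by positivity, ?_⟩
  · rw [div_lt_one (by positivity)]; linarith
  intro θ Q B hθ hB hQ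
  set t := ε * θ / (1 + ε * θ) with ht
  have ht0 : 0 ≤ t := by positivity
  have ht1 : t ≤ 1 := by rw [ht, div_le_one (by positivity)]; linarith
  have htθ : t ≤ ε * θ := by
    rw [ht]; exact div_le_self (by positivity) (by have : 0 < ε * θ := by positivity
                                                   linarith)
  have hQt : Q = (m - b) * (b - 1) + t * (k * ((m - b) - (b - 1) - k * t - ν * (1 - t))) := by
    have : ε * θ / (1 + ε * θ) ^ 2 = t * (1 - t) := by rw [ht]; field_simp; ring
    rw [hQ, hB, this]
    simp only [k]
    ring
  have hk : |k * ((m - b) - (b - 1) - k * t - ν * (1 - t))| ≤ E := by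
    rw [abs_mul, hE]
    gcongr
    refine (abs_sub _ _).trans (add_le_add ((abs_sub _ _).trans (add_le_add (abs_sub _ _) ?_)) ?_)
    · rw [abs_mul, abs_of_nonneg ht0]; exact mul_le_of_le_one_right (abs_nonneg _) ht1
    · rw [abs_mul, abs_of_nonneg hν, abs_of_nonneg (by linarith)]
      exact mul_le_of_le_one_right hν (by linarith)
  have htE : |t * (k * ((m - b) - (b - 1) - k * t - ν * (1 - t)))| ≤ t * E := by
    rw [abs_mul, abs_of_nonneg ht0]; gcongr
  constructor
  · have h1 : |Q| ≤ |(m - b) * (b - 1)| + E := by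
      rw [hQt]
      exact (abs_add_le _ _).trans (add_le_add le_rfl (htE.trans (mul_le_of_le_one_left hE0 ht1)))
    exact h1.trans (le_mul_of_one_le_right (by positivity) (by nlinarith))
  · have h0 : (m - b) * (b - 1) / p = A + c₀ := by
      rw [hA, hm, hc₀]; field_simp; ring
    have h1 : m ^ 2 / (4 * (1 - (c₀ / 2) / (A + c₀ / 2)) * (p - 1)) = A + c₀ / 2 := by
      have : m ^ 2 = A * (4 * (p - 1)) := by rw [hA]; field_simp
      rw [hη, this]; field_simp
    have h2 : A + c₀ - c' * θ ≤ Q / p := by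
      rw [← h0, hQt, add_div]
      have h3 := (abs_le.1 htE).1
      have h4 : t * E / p ≤ c' * θ := by
        calc t * E / p ≤ ε * θ * E / p := by gcongr
          _ = ε * (E / p) * θ := by ring
          _ ≤ c' * θ := by gcongr
      have h5 : -(t * E) / p ≤ t * (k * ((m - b) - (b - 1) - k * t - ν * (1 - t))) / p := by gcongr
      rw [neg_div] at h5
      linarith
    rw [h1]
    have h6 : 0 ≤ c' * (θ - 1) ^ 2 := by positivity
    have h7 : c' * θ ^ 2 ≤ 1 / 2 * θ ^ 2 := by gcongr
    linarith

end Weights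

section WeightComparison
variable {p γ μ ε ν k x : ℝ}

theorem energyWeight_le (hμ : 0 ≤ μ) (hε : 0 < ε) (hε1 : ε ≤ 1) (hk : 0 < k) (hx : 0 < x) :
    degenWeight (γ - 2 * p + 2) μ (2 * p - 2 - μ) ε ν k x *
      ((1 + k * x ^ ν) / x) ^ (-(2 * (p - 1))) ≤ (1 + ε ^ (2 * p - 2 - μ)) * x ^ γ := by
  have hθ : 0 < k * x ^ ν := by positivity
  unfold degenWeight
  set θ := k * x ^ ν
  have h1 := one_add_mul_rpow_le hε hε1 hθ (2 * p - 2 - μ)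
  have h2 : θ ^ μ ≤ (1 + θ) ^ μ := by gcongr; linarith
  rw [Real.div_rpow (by positivity) hx.le]
  calc _ ≤ x ^ (γ - 2 * p + 2) * (1 + θ) ^ μ * ((1 + ε ^ (2 * p - 2 - μ)) *
          (1 + θ) ^ (2 * p - 2 - μ)) * ((1 + θ) ^ (-(2 * (p - 1))) / x ^ (-(2 * (p - 1)))) := by
        gcongr
    _ = (1 + ε ^ (2 * p - 2 - μ)) * (x ^ (γ - 2 * p + 2) / x ^ (-(2 * (p - 1)))) *
          ((1 + θ) ^ μ * (1 + θ) ^ (2 * p - 2 - μ) * (1 + θ) ^ (-(2 * (p - 1)))) := by ring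
    _ = _ := by
        rw [← Real.rpow_sub hx, ← Real.rpow_add (by positivity), ← Real.rpow_add (by positivity)]
        rw [show μ + (2 * p - 2 - μ) + -(2 * (p - 1)) = 0 by ring, Real.rpow_zero, mul_one]
        congr 2; ring

theorem le_energyWeight (hμ : μ ≤ p) (hε : 0 < ε) (hε1 : ε ≤ 1) (hk : 0 < k)
    (hx : 0 < x) :
    (k * x ^ ν) ^ p * x ^ (γ - p) ≤ (1 + ε ^ (-(2 * p - 2 - μ))) *
      (degenWeight (γ - 2 * p + 2) μ (2 * p - 2 - μ) ε ν k x * ((1 + k * x ^ ν) / x) ^ (2 - p)) := by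
  have hθ : 0 < k * x ^ ν := by positivity
  unfold degenWeight
  set θ := k * x ^ ν
  have h1 := rpow_one_add_le hε hε1 hθ (2 * p - 2 - μ)
  have h2 : θ ^ (p - μ) ≤ (1 + θ) ^ (p - μ) := by
    have : 0 ≤ p - μ := by linarith
    gcongr; linarith
  rw [Real.div_rpow (by positivity) hx.le]
  calc θ ^ p * x ^ (γ - p) = x ^ (γ - p) * θ ^ μ * θ ^ (p - μ) := by
        rw [mul_assoc, ← Real.rpow_add hθ]; ring_nf
    _ ≤ x ^ (γ - p) * θ ^ μ * (1 + θ) ^ (p - μ) := by gcongr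
    _ = x ^ (γ - 2 * p + 2) / x ^ (2 - p) * θ ^ μ * (1 + θ) ^ (2 - p) *
          (1 + θ) ^ (2 * p - 2 - μ) := by
        rw [← Real.rpow_sub hx, mul_assoc _ ((1 + θ) ^ _), ← Real.rpow_add (by positivity)]
        congr 2 <;> ring_nf
    _ ≤ x ^ (γ - 2 * p + 2) / x ^ (2 - p) * θ ^ μ * (1 + θ) ^ (2 - p) *
          ((1 + ε ^ (-(2 * p - 2 - μ))) * (1 + ε * θ) ^ (2 * p - 2 - μ)) := by gcongr
    _ = _ := by ring

theorem gradientWeight_le (hp : 0 ≤ p) (hk : 0 < k) (hx : 0 < x) :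
    degenWeight (γ - p + 2) p (-2) 1 ν k x / x ^ 2 *
      ((1 + k * x ^ ν) ^ (-(p - 2)) * x ^ p) ≤ x ^ γ := by
  have hθ : 0 < k * x ^ ν := by positivity
  unfold degenWeight
  set θ := k * x ^ ν
  rw [one_mul]
  have h2 : θ ^ p ≤ (1 + θ) ^ p := by gcongr; linarith
  calc _ = x ^ (γ - p + 2) / x ^ (2 : ℝ) * x ^ p * (θ ^ p * (1 + θ) ^ (-2 : ℝ) *
          (1 + θ) ^ (-(p - 2))) := by rw [Real.rpow_two]; ring
    _ ≤ x ^ (γ - p + 2) / x ^ (2 : ℝ) * x ^ p * ((1 + θ) ^ p * (1 + θ) ^ (-2 : ℝ) *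
          (1 + θ) ^ (-(p - 2))) := by gcongr
    _ = _ := by
        rw [← Real.rpow_add (by positivity), ← Real.rpow_add (by positivity), ← Real.rpow_sub hx,
          ← Real.rpow_add hx, show p + -2 + -(p - 2) = 0 by ring, Real.rpow_zero, mul_one]
        congr 1; ring

theorem gradientWeight_mul_sq (hk : 0 < k) (hx : 0 < x) :
    degenWeight (γ - p + 2) p (-2) 1 ν k x * ((1 + k * x ^ ν) / x) ^ 2 =
      (k * x ^ ν) ^ p * x ^ (γ - p) := by
  have hθ : 0 < k * x ^ ν := by positivity
  unfold degenWeight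
  set θ := k * x ^ ν
  have h1 : (0 : ℝ) < 1 + θ := by positivity
  rw [one_mul, Real.rpow_neg h1.le, Real.rpow_two, Real.rpow_add hx, Real.rpow_two]
  field_simp

theorem gradientWeight_le_energyWeight (hp : 0 ≤ p) (hμ : μ ≤ p) (hε : 0 < ε) (hε1 : ε ≤ 1)
    (hk : 0 < k) (hx : 0 < x) :
    degenWeight (γ - p + 2) p (-2) 1 ν k x / x ^ 2 ≤ (1 + ε ^ (-(2 * p - 2 - μ))) *
      ((degenWeight (γ - 2 * p + 2) μ (2 * p - 2 - μ) ε ν k x * ((1 + k * x ^ ν) / x) ^ 2) *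
        x ^ p) := by
  have h := le_energyWeight (γ := γ) (ν := ν) hμ hε hε1 hk hx
  rw [← gradientWeight_mul_sq hk hx] at h
  have hθ : 0 < k * x ^ ν := by positivity
  have hψ : 0 < degenWeight (γ - 2 * p + 2) μ (2 * p - 2 - μ) ε ν k x :=
    degenWeight_pos hε.le hk hx
  have hψ' : 0 < degenWeight (γ - p + 2) p (-2) 1 ν k x := degenWeight_pos zero_le_one hk hx
  generalize degenWeight (γ - 2 * p + 2) μ (2 * p - 2 - μ) ε ν k x = A at *
  generalize degenWeight (γ - p + 2) p (-2) 1 ν k x = G at *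
  set θ := k * x ^ ν
  set C := 1 + ε ^ (-(2 * p - 2 - μ))
  have hC : 0 < C := by positivity
  have h1 : 1 ≤ (1 + θ) ^ p := Real.one_le_rpow (by linarith) hp
  have h2 : ((1 + θ) / x) ^ (2 - p) = ((1 + θ) / x) ^ 2 * x ^ p / (1 + θ) ^ p := by
    rw [Real.rpow_sub (by positivity), Real.rpow_two, Real.div_rpow (by positivity) hx.le]
    field_simp
  calc G / x ^ 2 ≤ G * ((1 + θ) / x) ^ 2 := by
        rw [div_pow, mul_div_assoc']
        gcongr
        exact le_mul_of_one_le_right hψ'.le (by nlinarith)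
    _ ≤ _ := h
    _ ≤ _ := by
        rw [h2]
        refine mul_le_mul_of_nonneg_left ?_ hC.le
        rw [mul_div_assoc', ← mul_assoc]
        exact div_le_self (by positivity) h1

end WeightComparison

section Estimates

theorem reg_zero {p δ : ℝ} (hδ : 0 < δ) : ((0 : ℝ) ^ 2 + δ ^ 2) ^ (p / 2) - δ ^ p = 0 := by
  rw [zero_pow two_ne_zero, zero_add, ← Real.rpow_natCast δ 2, ← Real.rpow_mul hδ.le]
  push_cast
  rw [mul_div_cancel₀ p two_ne_zero, sub_self]

theorem le_of_forall_rpow_mul {p a b d : ℝ} (hp : 0 < p) (h : ∀ δ : ℝ, 0 < δ → a ≤ b + δ ^ p * d) :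
    a ≤ b := by
  refine le_of_forall_pos_le_add fun ε hε => ?_
  have hq : 0 < ε / (|d| + 1) := by positivity
  have := h ((ε / (|d| + 1)) ^ (1 / p)) (by positivity)
  rw [← Real.rpow_mul hq.le, one_div_mul_cancel hp.ne', Real.rpow_one] at this
  refine this.trans (add_le_add_right ?_ _)
  rw [div_mul_eq_mul_div, div_le_iff₀ (by positivity)]
  nlinarith [le_abs_self d]

theorem continuousOn_comp_of_pos {X : Type*} [NormedAddCommGroup X] [NormedSpace ℝ X]
    {ℓ : X →L[ℝ] ℝ} {K : Set X} (hℓ : ∀ x ∈ K, 0 < ℓ x) {F : ℝ → ℝ}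
    (hF : ContinuousOn F (Ioi 0)) : ContinuousOn (fun x => F (ℓ x)) K :=
  hF.comp ℓ.continuous.continuousOn hℓ

theorem continuousOn_one_add_mul_rpow_div {k ν : ℝ} :
    ContinuousOn (fun s : ℝ => (1 + k * s ^ ν) / s) (Ioi 0) :=
  (continuousOn_const.add (continuousOn_const.mul
    (continuousOn_id.rpow_const fun _ hs => Or.inl (ne_of_gt hs)))).div continuousOn_id
    fun _ hs => ne_of_gt hs

theorem continuous_reg {X : Type*} [TopologicalSpace X] {δ : ℝ} (hδ : 0 < δ) (r : ℝ)
    {v : X → ℝ} (hv : Continuous v) :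
    Continuous fun x => (v x ^ 2 + δ ^ 2) ^ r :=
  ((hv.pow 2).add continuous_const).rpow_const fun x => Or.inl
    (add_pos_of_nonneg_of_pos (sq_nonneg (v x)) (by positivity)).ne'

variable {X : Type*} [NormedAddCommGroup X] [NormedSpace ℝ X]
  {ι : Type*} [Fintype ι] {ℓ : X →L[ℝ] ℝ} {τ : X} {e : ι → X} {p α γ : ℝ}

theorem continuousOn_degenOp {K : Set X} (hℓ : ∀ x ∈ K, 0 < ℓ x) {u : X → ℝ}
    (hu : ContDiff ℝ (⊤ : ℕ∞) u) (lam : ℝ) : ContinuousOn (degenOp ℓ τ e α lam u) K := by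
  have h : ContinuousOn (fun x => ℓ x ^ (-α)) K := continuousOn_comp_of_pos hℓ
    (F := fun s => s ^ (-α)) (continuousOn_id.rpow_const fun s hs => Or.inl (ne_of_gt hs))
  have h1 := (hu.dirDeriv τ).continuous
  have h2 := hu.continuous
  have h3 := fun i => ((hu.dirDeriv (e i)).dirDeriv (e i)).continuous
  unfold degenOp
  exact (h.mul (by fun_prop)).sub (by fun_prop)

variable [MeasurableSpace X] [FiniteDimensional ℝ X] [BorelSpace X]
  (μ : Measure X) [μ.IsAddHaarMeasure]

theorem mul_rpow_sq_div_sq {lam s : ℝ} (hlam : 0 < lam) (hs : 0 < s) :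
    lam * s ^ (-α) = (√lam * s ^ (1 - α / 2)) ^ 2 / s ^ 2 := by
  rw [mul_pow, Real.sq_sqrt hlam.le, ← Real.rpow_natCast (s ^ _) 2, ← Real.rpow_mul hs.le,
    mul_div_assoc, ← Real.rpow_natCast s 2, ← Real.rpow_sub hs]
  congr 2; push_cast; ring

theorem energy_estimate (hτ : ℓ τ = 0) (he : ∑ i, ℓ (e i) ^ 2 = 1) (hp : 1 < p) (hα : α < 2)
    (hγ : α * p / 2 - 1 < γ) (hγ' : γ < 2 * p - 1) :
    ∃ m ε c C : ℝ, 0 ≤ m ∧ m ≤ p ∧ 0 < ε ∧ ε ≤ 1 ∧ 0 < c ∧ 0 < C ∧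
      ∀ (lam : ℝ) (K : Set X) (u : X → ℝ) (δ : ℝ), 0 < lam → IsCompact K → (∀ x ∈ K, 0 < ℓ x) →
        ContDiff ℝ (⊤ : ℕ∞) u → (∀ x ∉ K, u x = 0) → 0 < δ →
        c * ∫ x in K, degenWeight (γ - 2 * p + 2) m (2 * p - 2 - m) ε (1 - α / 2) √lam (ℓ x) *
          ((u x ^ 2 + δ ^ 2) ^ (p / 2 - 1) * ∑ i, dirDeriv (e i) u x ^ 2 +
            ((1 + √lam * ℓ x ^ (1 - α / 2)) / ℓ x) ^ 2 * (u x ^ 2 + δ ^ 2) ^ (p / 2)) ∂μ ≤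
        C * ∫ x in K, |degenOp ℓ τ e α lam u x| ^ p * ℓ x ^ γ ∂μ + δ ^ p * (C *
          ∫ x in K, degenWeight (γ - 2 * p + 2) m (2 * p - 2 - m) ε (1 - α / 2) √lam (ℓ x) *
            ((1 + √lam * ℓ x ^ (1 - α / 2)) / ℓ x) ^ 2 ∂μ) := by
  have hν : 0 < 1 - α / 2 := by linarith
  obtain ⟨m, hm0, hmp, hb, hb1⟩ := exists_energy_params (p := p) (γ := γ) hp hν (by linarith)
    (by linarith)
  obtain ⟨ε, η, c₁, CQ, m₁, hε, hε1, hη, hη1, hc₁, hCQ, hco⟩ := exists_energy_coercive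
    (κ := 2 * p - 2 - m) hp hb hb1 hν.le
  obtain ⟨c, C, hc, hC, H⟩ := energy_pointwise (m := m₁) (CH := 1 + ε ^ (2 * p - 2 - m)) hp hη hη1
    hc₁ hCQ (by positivity)
  refine ⟨m, ε, c, C, hm0, hmp, hε, hε1, hc, hC, ?_⟩
  intro lam K u δ hlam hK hℓ hu huK hδ
  have hk : 0 < √lam := Real.sqrt_pos.2 hlam
  set ν := 1 - α / 2 with hνdef
  set ψ := degenWeight (γ - 2 * p + 2) m (2 * p - 2 - m) ε ν √lam with hψ
  set B := degenWeightLogDeriv (γ - 2 * p + 2) m (2 * p - 2 - m) ε ν √lam with hB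
  have hcψ : ContinuousOn (fun x => ψ (ℓ x)) K :=
    continuousOn_comp_of_pos hℓ (continuousOn_degenWeight hε.le hk)
  have hcΘ : ContinuousOn (fun x => (1 + √lam * ℓ x ^ ν) / ℓ x) K :=
    continuousOn_comp_of_pos hℓ continuousOn_one_add_mul_rpow_div
  have hcγ : ContinuousOn (fun x => ℓ x ^ γ) K := continuousOn_comp_of_pos hℓ
    (F := fun s => s ^ γ) (continuousOn_id.rpow_const fun s hs => Or.inl (ne_of_gt hs))
  have hcf : ContinuousOn (fun x => |degenOp ℓ τ e α lam u x| ^ p * ℓ x ^ γ) K :=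
    ((continuousOn_degenOp hℓ hu lam).abs.rpow_const fun _ _ => Or.inr (by linarith)).mul hcγ
  have hnull := isNullOn_energy μ (τ := τ) (e := e) (α := α) (lam := lam) hK hℓ hu huK hτ he
    (contDiff_reg (p := p) hδ) (contDiff_regDeriv hδ) (reg_zero hδ) (by simp [regDeriv])
    (hasDerivAt_reg hδ) (hasDerivAt_regDeriv hδ)
    (fun s hs => hasDerivAt_degenWeight (β := γ - 2 * p + 2) (μ := m) (κ := 2 * p - 2 - m)
      (ν := ν) hε.le hk hs)
    (fun s hs => hasDerivAt_degenWeightLogDeriv hε.le hk hs)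
    (continuousOn_degenWeightLogDeriv_deriv hε.le hk) m₁
  have hJ : ContinuousOn (fun x => c * (ψ (ℓ x) *
      ((u x ^ 2 + δ ^ 2) ^ (p / 2 - 1) * ∑ i, dirDeriv (e i) u x ^ 2 +
        ((1 + √lam * ℓ x ^ ν) / ℓ x) ^ 2 * (u x ^ 2 + δ ^ 2) ^ (p / 2)))) K := by
    have h1 := (continuous_reg hδ (p / 2 - 1) hu.continuous).continuousOn (s := K)
    have h2 := (continuous_reg hδ (p / 2) hu.continuous).continuousOn (s := K)
    have h3 : ContinuousOn (fun x => ∑ i, dirDeriv (e i) u x ^ 2) K :=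
      (continuous_finsetSum _ fun i _ => (hu.dirDeriv (e i)).continuous.pow 2).continuousOn
    exact continuousOn_const.mul (hcψ.mul ((h1.mul h3).add ((hcΘ.pow 2).mul h2)))
  have hZ₁ : IntegrableOn (fun x => C * (|degenOp ℓ τ e α lam u x| ^ p * ℓ x ^ γ)) K μ :=
    (continuousOn_const.mul hcf).integrableOn_compact hK
  have hZ₂ : IntegrableOn (fun x => C * (δ ^ p * (ψ (ℓ x) *
      ((1 + √lam * ℓ x ^ ν) / ℓ x) ^ 2))) K μ :=
    (continuousOn_const.mul (continuousOn_const.mul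
      (hcψ.mul (hcΘ.pow 2)))).integrableOn_compact hK
  have hfin := hnull.integral_le hK.measurableSet (hJ.integrableOn_compact hK) (hZ₁.add hZ₂)
    fun x hx => ?_
  · rw [integral_const_mul] at hfin
    refine hfin.trans (le_of_eq ?_)
    simp only [Pi.add_apply]
    rw [integral_add hZ₁ hZ₂, integral_const_mul, integral_const_mul, integral_const_mul]
    ring
  · have hx0 := hℓ x hx
    have hθ : 0 < √lam * ℓ x ^ ν := by positivity
    have hcs := Finset.sum_mul_sq_le_sq_mul_sq Finset.univ (fun i => ℓ (e i))
      fun i => dirDeriv (e i) u x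
    rw [he, one_mul] at hcs
    obtain ⟨q1, q2⟩ := hco (√lam * ℓ x ^ ν) _ (B (ℓ x)) hθ rfl rfl
    rw [mul_rpow_sq_div_sq hlam hx0]
    exact H δ (ℓ x) (√lam * ℓ x ^ ν) (ψ (ℓ x)) _ (u x) (∑ i, dirDeriv (e i) u x ^ 2)
      (∑ i, ℓ (e i) * dirDeriv (e i) u x) (degenOp ℓ τ e α lam u x) (ℓ x ^ γ) hδ hx0 hθ
      (degenWeight_pos hε.le hk hx0) (by positivity) q1 q2
      (energyWeight_le hm0 hε hε1 hk hx0)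
      hcs

end Estimates

section Subquadratic

theorem rpow_mul_le_reg {p δ s Y Θ : ℝ} (hp : 0 < p) (hp2 : p ≤ 2) (hδ : 0 < δ) (hY : 0 ≤ Y)
    (hΘ : 0 < Θ) :
    Θ ^ (2 - p) * Y ^ (p / 2) ≤
      (s ^ 2 + δ ^ 2) ^ (p / 2 - 1) * Y + Θ ^ 2 * (s ^ 2 + δ ^ 2) ^ (p / 2) := by
  have hR : 0 < s ^ 2 + δ ^ 2 := by positivity
  set R := s ^ 2 + δ ^ 2
  have h1 : 0 ≤ R ^ (p / 2 - 1) * Y := by positivity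
  have h2 : 0 ≤ Θ ^ 2 * R ^ (p / 2) := by positivity
  have h := Real.geom_mean_le_arith_mean2_weighted (w₁ := p / 2) (w₂ := 1 - p / 2) (by positivity)
    (by linarith) h1 h2 (by ring)
  have e : (R ^ (p / 2 - 1) * Y) ^ (p / 2) * (Θ ^ 2 * R ^ (p / 2)) ^ (1 - p / 2) =
      Θ ^ (2 - p) * Y ^ (p / 2) := by
    rw [Real.mul_rpow (by positivity) hY, Real.mul_rpow (by positivity) (by positivity),
      ← Real.rpow_mul hR.le, ← Real.rpow_mul hR.le, ← Real.rpow_natCast Θ 2,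
      ← Real.rpow_mul hΘ.le]
    calc _ = R ^ ((p / 2 - 1) * (p / 2)) * R ^ (p / 2 * (1 - p / 2)) *
          (Θ ^ (((2 : ℕ) : ℝ) * (1 - p / 2)) * Y ^ (p / 2)) := by ring
      _ = _ := by
        rw [← Real.rpow_add hR, show (p / 2 - 1) * (p / 2) + p / 2 * (1 - p / 2) = 0 by ring,
          Real.rpow_zero, one_mul]
        congr 2; push_cast; ring
  rw [e] at h
  nlinarith

variable {X : Type*} [NormedAddCommGroup X] [NormedSpace ℝ X]
  {ι : Type*} [Fintype ι] {ℓ : X →L[ℝ] ℝ} {τ : X} {e : ι → X} {p α γ : ℝ}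

theorem continuousOn_gradientWeight {K : Set X} (hℓ : ∀ x ∈ K, 0 < ℓ x) {k : ℝ}
    (hk : 0 < k) (ν : ℝ) :
    ContinuousOn (fun x => (k * ℓ x ^ ν) ^ p * ℓ x ^ (γ - p)) K := by
  refine continuousOn_comp_of_pos hℓ (F := fun s => (k * s ^ ν) ^ p * s ^ (γ - p)) ?_
  refine ((continuousOn_const.mul (continuousOn_id.rpow_const fun s hs =>
    Or.inl (ne_of_gt hs))).rpow_const fun s hs => Or.inl ?_).mul
      (continuousOn_id.rpow_const fun s hs => Or.inl (ne_of_gt hs))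
  exact (mul_pos hk (Real.rpow_pos_of_pos hs ν)).ne'

variable [MeasurableSpace X] [BorelSpace X]
  (μ : Measure X) [μ.IsAddHaarMeasure]

theorem integrableOn_gradient {K : Set X} (hK : IsCompact K) (hℓ : ∀ x ∈ K, 0 < ℓ x) {u : X → ℝ}
    (hu : ContDiff ℝ (⊤ : ℕ∞) u) (hp : 0 ≤ p) {k : ℝ} (hk : 0 < k) (ν : ℝ) :
    IntegrableOn (fun x => (k * ℓ x ^ ν) ^ p * ℓ x ^ (γ - p) *
      (∑ i, dirDeriv (e i) u x ^ 2) ^ (p / 2)) K μ := by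
  refine ((continuousOn_gradientWeight hℓ hk ν).mul ?_).integrableOn_compact hK
  have h3 : Continuous (fun x => ∑ i, dirDeriv (e i) u x ^ 2) :=
    continuous_finsetSum _ fun i _ => (hu.dirDeriv (e i)).continuous.pow 2
  exact (h3.rpow_const fun _ => Or.inr (by positivity)).continuousOn

variable [FiniteDimensional ℝ X]

theorem gradient_estimate_of_le_two (hτ : ℓ τ = 0) (he : ∑ i, ℓ (e i) ^ 2 = 1) (hp : 1 < p)
    (hp2 : p ≤ 2) (hα : α < 2) (hγ : α * p / 2 - 1 < γ) (hγ' : γ < 2 * p - 1) :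
    ∃ N : ℝ, 0 < N ∧
      ∀ (lam : ℝ) (K : Set X) (u : X → ℝ), 0 < lam → IsCompact K → (∀ x ∈ K, 0 < ℓ x) →
        ContDiff ℝ (⊤ : ℕ∞) u → (∀ x ∉ K, u x = 0) →
        ∫ x in K, (√lam * ℓ x ^ (1 - α / 2)) ^ p * ℓ x ^ (γ - p) *
          (∑ i, dirDeriv (e i) u x ^ 2) ^ (p / 2) ∂μ ≤
        N * ∫ x in K, |degenOp ℓ τ e α lam u x| ^ p * ℓ x ^ γ ∂μ := by
  obtain ⟨m, ε, c, C, -, hmp, hε, hε1, hc, hC, H⟩ := energy_estimate μ hτ he hp hα hγ hγ'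
  have hG : 0 < 1 + ε ^ (-(2 * p - 2 - m)) := by positivity
  set G := 1 + ε ^ (-(2 * p - 2 - m))
  refine ⟨G / c * C, by positivity, ?_⟩
  intro lam K u hlam hK hℓ hu huK
  have hk : 0 < √lam := Real.sqrt_pos.2 hlam
  set ν := 1 - α / 2
  set ψ := degenWeight (γ - 2 * p + 2) m (2 * p - 2 - m) ε ν √lam with hψ
  refine le_of_forall_rpow_mul (p := p) (d := G / c * (C * ∫ x in K, ψ (ℓ x) *
    ((1 + √lam * ℓ x ^ ν) / ℓ x) ^ 2 ∂μ)) (by linarith) fun δ hδ => ?_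
  have h := H lam K u δ hlam hK hℓ hu huK hδ
  have hcψ : ContinuousOn (fun x => ψ (ℓ x)) K :=
    continuousOn_comp_of_pos hℓ (continuousOn_degenWeight hε.le hk)
  have hcΘ : ContinuousOn (fun x => (1 + √lam * ℓ x ^ ν) / ℓ x) K :=
    continuousOn_comp_of_pos hℓ continuousOn_one_add_mul_rpow_div
  have hJ : IntegrableOn (fun x => ψ (ℓ x) *
      ((u x ^ 2 + δ ^ 2) ^ (p / 2 - 1) * ∑ i, dirDeriv (e i) u x ^ 2 +
        ((1 + √lam * ℓ x ^ ν) / ℓ x) ^ 2 * (u x ^ 2 + δ ^ 2) ^ (p / 2))) K μ := by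
    have h1 := (continuous_reg hδ (p / 2 - 1) hu.continuous).continuousOn (s := K)
    have h2 := (continuous_reg hδ (p / 2) hu.continuous).continuousOn (s := K)
    have h3 : ContinuousOn (fun x => ∑ i, dirDeriv (e i) u x ^ 2) K :=
      (continuous_finsetSum _ fun i _ => (hu.dirDeriv (e i)).continuous.pow 2).continuousOn
    exact (hcψ.mul ((h1.mul h3).add ((hcΘ.pow 2).mul h2))).integrableOn_compact hK
  have hle := setIntegral_mono_on
    (integrableOn_gradient (e := e) (γ := γ) μ hK hℓ hu (by linarith : 0 ≤ p) hk ν)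
    (hJ.const_mul G) hK.measurableSet fun x hx => by
      have hx0 := hℓ x hx
      have hY : 0 ≤ ∑ i, dirDeriv (e i) u x ^ 2 := Finset.sum_nonneg fun i _ => sq_nonneg _
      have hΘ : 0 < (1 + √lam * ℓ x ^ ν) / ℓ x := by positivity
      have hψ0 : 0 < ψ (ℓ x) := degenWeight_pos hε.le hk hx0
      calc _ ≤ G * (ψ (ℓ x) * ((1 + √lam * ℓ x ^ ν) / ℓ x) ^ (2 - p)) *
            (∑ i, dirDeriv (e i) u x ^ 2) ^ (p / 2) := by
            exact mul_le_mul_of_nonneg_right (le_energyWeight hmp hε hε1 hk hx0)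
              (by positivity)
        _ = G * (ψ (ℓ x) * (((1 + √lam * ℓ x ^ ν) / ℓ x) ^ (2 - p) *
            (∑ i, dirDeriv (e i) u x ^ 2) ^ (p / 2))) := by ring
        _ ≤ _ := by
            gcongr
            exact rpow_mul_le_reg (by linarith) hp2 hδ hY hΘ
  rw [integral_const_mul] at hle
  refine hle.trans ?_
  rw [← le_div_iff₀' hc] at h
  refine (mul_le_mul_of_nonneg_left h hG.le).trans (le_of_eq ?_)
  ring

end Subquadratic

section Superquadratic

variable {X : Type*} [NormedAddCommGroup X] [NormedSpace ℝ X] [MeasurableSpace X]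
  [FiniteDimensional ℝ X] [BorelSpace X] (μ : Measure X) [μ.IsAddHaarMeasure]
  {ι : Type*} [Fintype ι] {ℓ : X →L[ℝ] ℝ} {τ : X} {e : ι → X} {p α γ : ℝ}

theorem abs_rpow_le_reg (hp : 0 ≤ p) (s δ : ℝ) : |s| ^ p ≤ (s ^ 2 + δ ^ 2) ^ (p / 2) := by
  have : |s| ^ p = (s ^ 2) ^ (p / 2) := by
    rw [← sq_abs, ← Real.rpow_natCast, ← Real.rpow_mul (abs_nonneg s)]
    congr 1; push_cast; ring
  rw [this]
  gcongr
  nlinarith [sq_nonneg δ]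

theorem sum_sq_rpow_le (hp : 2 ≤ p) (v : ι → ℝ) (δ : ℝ) :
    (∑ i, v i ^ 2) ^ (p / 2) ≤
      (Fintype.card ι : ℝ) ^ (p / 2 - 1) * ∑ i, (v i ^ 2 + δ ^ 2) ^ (p / 2) := by
  have h := Real.rpow_sum_le_const_mul_sum_rpow (p := p / 2) Finset.univ (fun i => v i ^ 2)
    (by linarith)
  simp only [abs_pow, sq_abs, Finset.card_univ] at h
  refine h.trans ?_
  gcongr
  nlinarith [sq_nonneg δ]

theorem zeroth_order_estimate (hτ : ℓ τ = 0) (he : ∑ i, ℓ (e i) ^ 2 = 1) (hp : 1 < p)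
    (hα : α < 2) (hγ : α * p / 2 - 1 < γ) (hγ' : γ < 2 * p - 1) :
    ∃ m ε N : ℝ, m ≤ p ∧ 0 < ε ∧ ε ≤ 1 ∧ 0 < N ∧
      ∀ (lam : ℝ) (K : Set X) (u : X → ℝ), 0 < lam → IsCompact K → (∀ x ∈ K, 0 < ℓ x) →
        ContDiff ℝ (⊤ : ℕ∞) u → (∀ x ∉ K, u x = 0) →
        ∫ x in K, |u x| ^ p *
          (degenWeight (γ - 2 * p + 2) m (2 * p - 2 - m) ε (1 - α / 2) √lam (ℓ x) *
          ((1 + √lam * ℓ x ^ (1 - α / 2)) / ℓ x) ^ 2) ∂μ ≤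
        N * ∫ x in K, |degenOp ℓ τ e α lam u x| ^ p * ℓ x ^ γ ∂μ := by
  obtain ⟨m, ε, c, C, -, hmp, hε, hε1, hc, hC, H⟩ := energy_estimate μ hτ he hp hα hγ hγ'
  refine ⟨m, ε, C / c, hmp, hε, hε1, by positivity, ?_⟩
  intro lam K u hlam hK hℓ hu huK
  have hk : 0 < √lam := Real.sqrt_pos.2 hlam
  set ν := 1 - α / 2
  set ψ := degenWeight (γ - 2 * p + 2) m (2 * p - 2 - m) ε ν √lam with hψ
  refine le_of_forall_rpow_mul (p := p) (d := 1 / c * (C * ∫ x in K, ψ (ℓ x) *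
    ((1 + √lam * ℓ x ^ ν) / ℓ x) ^ 2 ∂μ)) (by linarith) fun δ hδ => ?_
  have h := H lam K u δ hlam hK hℓ hu huK hδ
  have hcψ : ContinuousOn (fun x => ψ (ℓ x)) K :=
    continuousOn_comp_of_pos hℓ (continuousOn_degenWeight hε.le hk)
  have hcΘ : ContinuousOn (fun x => (1 + √lam * ℓ x ^ ν) / ℓ x) K :=
    continuousOn_comp_of_pos hℓ continuousOn_one_add_mul_rpow_div
  have hJ : IntegrableOn (fun x => ψ (ℓ x) *
      ((u x ^ 2 + δ ^ 2) ^ (p / 2 - 1) * ∑ i, dirDeriv (e i) u x ^ 2 +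
        ((1 + √lam * ℓ x ^ ν) / ℓ x) ^ 2 * (u x ^ 2 + δ ^ 2) ^ (p / 2))) K μ := by
    have h1 := (continuous_reg hδ (p / 2 - 1) hu.continuous).continuousOn (s := K)
    have h2 := (continuous_reg hδ (p / 2) hu.continuous).continuousOn (s := K)
    have h3 : ContinuousOn (fun x => ∑ i, dirDeriv (e i) u x ^ 2) K :=
      (continuous_finsetSum _ fun i _ => (hu.dirDeriv (e i)).continuous.pow 2).continuousOn
    exact (hcψ.mul ((h1.mul h3).add ((hcΘ.pow 2).mul h2))).integrableOn_compact hK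
  have hU : IntegrableOn (fun x => |u x| ^ p * (ψ (ℓ x) *
      ((1 + √lam * ℓ x ^ ν) / ℓ x) ^ 2)) K μ :=
    ((hu.continuous.abs.rpow_const fun _ => Or.inr (by linarith)).continuousOn.mul
      (hcψ.mul (hcΘ.pow 2))).integrableOn_compact hK
  have hle := setIntegral_mono_on hU hJ hK.measurableSet fun x hx => by
    have hx0 := hℓ x hx
    have hψ0 : 0 < ψ (ℓ x) := degenWeight_pos hε.le hk hx0
    have hR : 0 < u x ^ 2 + δ ^ 2 := by positivity
    have hY : 0 ≤ (u x ^ 2 + δ ^ 2) ^ (p / 2 - 1) * ∑ i, dirDeriv (e i) u x ^ 2 :=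
      mul_nonneg (by positivity) (Finset.sum_nonneg fun i _ => sq_nonneg _)
    calc _ ≤ (u x ^ 2 + δ ^ 2) ^ (p / 2) * (ψ (ℓ x) *
          ((1 + √lam * ℓ x ^ ν) / ℓ x) ^ 2) := by
          exact mul_le_mul_of_nonneg_right (abs_rpow_le_reg (by linarith) _ _) (by positivity)
      _ = ψ (ℓ x) * (((1 + √lam * ℓ x ^ ν) / ℓ x) ^ 2 * (u x ^ 2 + δ ^ 2) ^ (p / 2)) := by ring
      _ ≤ _ := by
          exact mul_le_mul_of_nonneg_left (le_add_of_nonneg_left hY) hψ0.le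
  rw [← le_div_iff₀' hc] at h
  refine hle.trans (h.trans (le_of_eq ?_))
  ring

theorem gradient_estimate_of_two_le (hτ : ℓ τ = 0) (he : ∑ i, ℓ (e i) ^ 2 = 1)
    (hp2 : 2 ≤ p) (hα0 : 0 ≤ α) (hα : α < 2) (hγ : α * p / 2 - 1 < γ) (hγ' : γ < 2 * p - 1) :
    ∃ N : ℝ, 0 < N ∧
      ∀ (lam : ℝ) (K : Set X) (u : X → ℝ), 0 < lam → IsCompact K → (∀ x ∈ K, 0 < ℓ x) →
        ContDiff ℝ (⊤ : ℕ∞) u → (∀ x ∉ K, u x = 0) →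
        ∫ x in K, (√lam * ℓ x ^ (1 - α / 2)) ^ p * ℓ x ^ (γ - p) *
          (∑ i, dirDeriv (e i) u x ^ 2) ^ (p / 2) ∂μ ≤
        N * ∫ x in K, |degenOp ℓ τ e α lam u x| ^ p * ℓ x ^ γ ∂μ := by
  have hc1 : ∀ i, |ℓ (e i)| ≤ 1 := fun i => by
    rw [← sq_le_one_iff_abs_le_one, ← he]
    exact Finset.single_le_sum (f := fun i => ℓ (e i) ^ 2) (fun j _ => sq_nonneg _)
      (Finset.mem_univ i)
  obtain ⟨m, ε, N₀, hmp, hε, hε1, hN₀, H₀⟩ := zeroth_order_estimate μ hτ he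
    (by linarith : 1 < p) hα hγ hγ'
  have hG : 0 < 1 + ε ^ (-(2 * p - 2 - m)) := by positivity
  set G := 1 + ε ^ (-(2 * p - 2 - m)) with hGdef
  set ν := 1 - α / 2 with hνdef
  obtain ⟨M, C, hC, H⟩ := gradient_pointwise (ι := ι) (p := p) (α := α)
    (b₀ := |γ - p + 2 + p * ν| + |(-2) * ν|) (CG := G) hp2 hα0 (by positivity) hG.le
  set n := (Fintype.card ι : ℝ) ^ (p / 2 - 1) with hn
  have hn0 : 0 ≤ n := by positivity
  refine ⟨n * (8 / p) * (C + C * N₀) + 1, by positivity, ?_⟩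
  intro lam K u hlam hK hℓ hu huK
  have hk : 0 < √lam := Real.sqrt_pos.2 hlam
  have hF := H₀ lam K u hlam hK hℓ hu huK
  set ψ₁ := degenWeight (γ - 2 * p + 2) m (2 * p - 2 - m) ε ν √lam with hψ₁
  set ψ := degenWeight (γ - p + 2) p (-2) 1 ν √lam with hψ
  set B := degenWeightLogDeriv (γ - p + 2) p (-2) 1 ν √lam with hB
  set f := degenOp ℓ τ e α lam u with hf
  have hcψ₁ : ContinuousOn (fun x => ψ₁ (ℓ x)) K :=
    continuousOn_comp_of_pos hℓ (continuousOn_degenWeight hε.le hk)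
  have hcψ : ContinuousOn (fun x => ψ (ℓ x)) K :=
    continuousOn_comp_of_pos hℓ (continuousOn_degenWeight zero_le_one hk)
  have hcΘ : ContinuousOn (fun x => (1 + √lam * ℓ x ^ ν) / ℓ x) K :=
    continuousOn_comp_of_pos hℓ continuousOn_one_add_mul_rpow_div
  have hcγ : ContinuousOn (fun x => ℓ x ^ γ) K := continuousOn_comp_of_pos hℓ
    (F := fun s => s ^ γ) (continuousOn_id.rpow_const fun s hs => Or.inl (ne_of_gt hs))
  have hI₁ : IntegrableOn (fun x => C * (|f x| ^ p * ℓ x ^ γ)) K μ :=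
    (continuousOn_const.mul (((continuousOn_degenOp hℓ hu lam).abs.rpow_const fun _ _ =>
      Or.inr (by linarith)).mul hcγ)).integrableOn_compact hK
  have hI₂ : IntegrableOn (fun x => C * (|u x| ^ p * (ψ₁ (ℓ x) *
      ((1 + √lam * ℓ x ^ ν) / ℓ x) ^ 2))) K μ :=
    (continuousOn_const.mul ((hu.continuous.abs.rpow_const fun _ =>
      Or.inr (by linarith)).continuousOn.mul (hcψ₁.mul (hcΘ.pow 2)))).integrableOn_compact hK
  have hf0 : 0 ≤ ∫ x in K, |f x| ^ p * ℓ x ^ γ ∂μ :=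
    setIntegral_nonneg hK.measurableSet fun x hx => by
      have := hℓ x hx
      positivity
  suffices h : ∫ x in K, (√lam * ℓ x ^ ν) ^ p * ℓ x ^ (γ - p) *
      (∑ i, dirDeriv (e i) u x ^ 2) ^ (p / 2) ∂μ ≤
        n * (8 / p) * (C + C * N₀) * ∫ x in K, |f x| ^ p * ℓ x ^ γ ∂μ by
    refine h.trans ?_
    rw [add_mul]
    linarith
  refine le_of_forall_rpow_mul (p := p) (d := n * (8 / p) * (C * ∫ x in K, ψ (ℓ x) *
    ((1 + √lam * ℓ x ^ ν) / ℓ x) ^ 2 ∂μ)) (by linarith) fun δ hδ => ?_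
  have hI₃ : IntegrableOn (fun x => C * (δ ^ p * (ψ (ℓ x) *
      ((1 + √lam * ℓ x ^ ν) / ℓ x) ^ 2))) K μ :=
    (continuousOn_const.mul (continuousOn_const.mul
      (hcψ.mul (hcΘ.pow 2)))).integrableOn_compact hK
  have hJ : IntegrableOn (fun x => p / 8 * (ψ (ℓ x) * ((1 + √lam * ℓ x ^ ν) / ℓ x) ^ 2 *
      ∑ i, (dirDeriv (e i) u x ^ 2 + δ ^ 2) ^ (p / 2))) K μ := by
    have h3 : ContinuousOn (fun x => ∑ i, (dirDeriv (e i) u x ^ 2 + δ ^ 2) ^ (p / 2)) K :=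
      (continuous_finsetSum _ fun i _ =>
        continuous_reg hδ (p / 2) (hu.dirDeriv (e i)).continuous).continuousOn
    exact (continuousOn_const.mul ((hcψ.mul (hcΘ.pow 2)).mul h3)).integrableOn_compact hK
  have hψd : ∀ s, 0 < s → HasDerivAt ψ (B s * ψ s / s) s := fun s hs =>
    hasDerivAt_degenWeight zero_le_one hk hs
  have hBc : ContinuousOn B (Ioi 0) := continuousOn_degenWeightLogDeriv zero_le_one hk
  have hnull := IsNullOn.sum (μ := μ) (K := K) fun k : ι =>
    (isNullOn_gradient_energy μ (τ := τ) (e := e) (α := α) (lam := lam) hK hℓ hu huK hτ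
      (contDiff_reg (p := p) hδ) (contDiff_regDeriv hδ) (reg_zero hδ) (by simp [regDeriv])
      (hasDerivAt_reg hδ) (hasDerivAt_regDeriv hδ) hψd hBc k rfl).add
    ((isNullOn_interpolation μ hK hℓ hu huK (contDiff_regDeriv (p := p) hδ)
      (hasDerivAt_regDeriv hδ) hψd hBc (e k) rfl).const_mul M)
  have hfin := hnull.integral_le hK.measurableSet hJ ((hI₁.add hI₂).add hI₃) fun x hx => by
    have hx0 := hℓ x hx
    have hΘ : 0 < (1 + √lam * ℓ x ^ ν) / ℓ x := by positivity
    rw [mul_rpow_sq_div_sq hlam hx0]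
    exact H (fun i => ℓ (e i)) (fun k => dirDeriv (e k) u x)
      (fun k i => dirDeriv (e i) (dirDeriv (e k) u) x) δ (ℓ x) (√lam * ℓ x ^ ν) (ψ (ℓ x))
      (B (ℓ x)) (f x) (u x) (ℓ x ^ γ) (ψ₁ (ℓ x) * ((1 + √lam * ℓ x ^ ν) / ℓ x) ^ 2) hc1 hδ hx0
      (by positivity) (degenWeight_pos zero_le_one hk hx0) (by positivity)
      (mul_nonneg (degenWeight_pos hε.le hk hx0).le (by positivity))
      (abs_degenWeightLogDeriv_le zero_le_one hk hx0)
      ((gradientWeight_le (by linarith) hk hx0).trans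
        (le_mul_of_one_le_left (by positivity) (le_add_of_nonneg_right (by positivity))))
      (gradientWeight_le_energyWeight (by linarith) hmp hε hε1 hk hx0)
  have hle := setIntegral_mono_on
    (integrableOn_gradient (e := e) (γ := γ) μ hK hℓ hu (by linarith : 0 ≤ p) hk ν)
    (hJ.const_mul (n * (8 / p))) hK.measurableSet fun x hx => by
      have hx0 := hℓ x hx
      rw [← gradientWeight_mul_sq hk hx0]
      have hψ0 : 0 < ψ (ℓ x) := degenWeight_pos zero_le_one hk hx0
      calc _ ≤ ψ (ℓ x) * ((1 + √lam * ℓ x ^ ν) / ℓ x) ^ 2 *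
            (n * ∑ i, (dirDeriv (e i) u x ^ 2 + δ ^ 2) ^ (p / 2)) :=
            mul_le_mul_of_nonneg_left (sum_sq_rpow_le hp2 _ δ) (by positivity)
        _ = _ := by field_simp
  rw [integral_const_mul] at hle
  refine hle.trans ((mul_le_mul_of_nonneg_left hfin (by positivity)).trans ?_)
  rw [integral_add' (hI₁.add hI₂) hI₃, integral_add' hI₁ hI₂, integral_const_mul,
    integral_const_mul, integral_const_mul, integral_const_mul]
  have := mul_le_mul_of_nonneg_left hF hC.le
  calc _ ≤ n * (8 / p) * (C * (∫ x in K, |f x| ^ p * ℓ x ^ γ ∂μ) +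
        C * (N₀ * ∫ x in K, |f x| ^ p * ℓ x ^ γ ∂μ) + C * (δ ^ p * ∫ x in K, ψ (ℓ x) *
          ((1 + √lam * ℓ x ^ ν) / ℓ x) ^ 2 ∂μ)) := by
        gcongr
    _ = _ := by ring

theorem gradient_estimate (hτ : ℓ τ = 0) (he : ∑ i, ℓ (e i) ^ 2 = 1) (hp : 1 < p)
    (hα0 : 0 ≤ α) (hα : α < 2) (hγ : α * p / 2 - 1 < γ) (hγ' : γ < 2 * p - 1) :
    ∃ N : ℝ, 0 < N ∧
      ∀ (lam : ℝ) (K : Set X) (u : X → ℝ), 0 < lam → IsCompact K → (∀ x ∈ K, 0 < ℓ x) →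
        ContDiff ℝ (⊤ : ℕ∞) u → (∀ x ∉ K, u x = 0) →
        ∫ x in K, (√lam * ℓ x ^ (1 - α / 2)) ^ p * ℓ x ^ (γ - p) *
          (∑ i, dirDeriv (e i) u x ^ 2) ^ (p / 2) ∂μ ≤
        N * ∫ x in K, |degenOp ℓ τ e α lam u x| ^ p * ℓ x ^ γ ∂μ := by
  rcases le_total p 2 with h | h
  · exact gradient_estimate_of_le_two μ hτ he hp h hα hγ hγ'
  · exact gradient_estimate_of_two_le μ hτ he h hα0 hα hγ hγ'

end Superquadratic

section Conversion
variable {d : ℕ} {u : ℝ × Ed d → ℝ}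

theorem ut_eq_dirDeriv {z : ℝ × Ed d} (hu : DifferentiableAt ℝ u z) :
    ut u z = dirDeriv (1, 0) u z :=
  (HasFDerivAt.comp_hasDerivAt z.1 (show HasFDerivAt u (fderiv ℝ u z) (z.1, z.2) from
    hu.hasFDerivAt) ((hasDerivAt_id z.1).prodMk (hasDerivAt_const z.1 z.2))).deriv

theorem Du_apply {z : ℝ × Ed d} (hu : DifferentiableAt ℝ u z) (v : Ed d) :
    Du u z v = dirDeriv (0, v) u z := by
  have h := (show HasFDerivAt u (fderiv ℝ u z) (z.1, z.2) from hu.hasFDerivAt).comp z.2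
    ((hasFDerivAt_const z.1 z.2).prodMk (hasFDerivAt_id (𝕜 := ℝ) z.2))
  unfold Du
  rw [show (fun y => u (z.1, y)) = u ∘ fun y => (z.1, y) from rfl]
  erw [h.fderiv]
  simp [dirDeriv]

theorem D2u_apply (hu : ContDiff ℝ (⊤ : ℕ∞) u) (z : ℝ × Ed d) (v w : Ed d) :
    D2u u z v w = dirDeriv (0, v) (dirDeriv (0, w) u) z := by
  have hud : Differentiable ℝ u := hu.differentiable (by simp)
  have h : DifferentiableAt ℝ (fun y => Du u (z.1, y)) z.2 := by
    have h1 : ContDiff ℝ (⊤ : ℕ∞) fun y : Ed d => fderiv ℝ u (z.1, y) :=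
      (hu.fderiv_right (m := (⊤ : ℕ∞)) (by exact_mod_cast le_top)).comp
        (contDiff_const.prodMk contDiff_id)
    have h2 : (fun y => Du u (z.1, y)) =
        fun y => (fderiv ℝ u (z.1, y)).comp (ContinuousLinearMap.inr ℝ ℝ (Ed d)) := by
      funext y
      ext v
      rw [Du_apply (hud _)]
      simp [dirDeriv]
    rw [h2]
    exact (h1.clm_comp contDiff_const).differentiable (by simp) _
  have h3 : D2u u z v w = fderiv ℝ (fun y => Du u (z.1, y) w) z.2 v := by
    rw [fderiv_clm_apply h (differentiableAt_const w)]
    simp [D2u]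
  rw [h3, ← Du_apply ((hu.dirDeriv _).differentiable (by simp) z)]
  unfold Du
  congr 2
  funext y
  exact Du_apply (hud _) w

theorem norm_sq_eq_sum_apply_single (L : Ed d →L[ℝ] ℝ) :
    ‖L‖ ^ 2 = ∑ i, L (EuclideanSpace.single i 1) ^ 2 := by
  set g := (InnerProductSpace.toDual ℝ (Ed d)).symm L with hg
  have h1 : ‖g‖ = ‖L‖ := LinearIsometryEquiv.norm_map _ _
  have h2 : ∀ v, L v = inner ℝ g v := fun v => by
    rw [hg, InnerProductSpace.toDual_symm_apply]
  rw [← h1, EuclideanSpace.norm_sq_eq]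
  refine Finset.sum_congr rfl fun i _ => ?_
  rw [h2, EuclideanSpace.inner_single_right]
  simp

/-- The last coordinate as a continuous linear functional on space-time. -/
def lastCoord (hd : 0 < d) : ℝ × Ed d →L[ℝ] ℝ :=
  (EuclideanSpace.proj ⟨d - 1, Nat.sub_lt hd one_pos⟩).comp (ContinuousLinearMap.snd ℝ ℝ (Ed d))

theorem lastCoord_apply (hd : 0 < d) (z : ℝ × Ed d) : lastCoord hd z = xd z.2 := by
  simp [lastCoord, xd, hd]

theorem sum_lastCoord_sq (hd : 0 < d) :
    ∑ i, lastCoord hd ((0 : ℝ), EuclideanSpace.single i (1 : ℝ)) ^ 2 = 1 := by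
  simp [lastCoord]

theorem degenOp_lastCoord (hd : 0 < d) (hu : ContDiff ℝ (⊤ : ℕ∞) u) (α lam : ℝ) (z : ℝ × Ed d) :
    degenOp (lastCoord hd) (1, 0) (fun i => (0, EuclideanSpace.single i 1)) α lam u z =
      xd z.2 ^ (-α) * (ut u z + lam * u z) - lap u z := by
  simp only [degenOp, lastCoord_apply, lap, ut_eq_dirDeriv (hu.differentiable (by simp) z),
    D2u_apply hu]

theorem setLIntegral_ofReal_eq {X : Type*} [MeasurableSpace X] {μ : Measure X} {K Ω : Set X}
    (hK : MeasurableSet K) (hKΩ : K ⊆ Ω) {F : X → ℝ} (hF : IntegrableOn F K μ)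
    (hF0 : ∀ x ∈ K, 0 ≤ F x) (hFK : ∀ x ∉ K, F x = 0) :
    ∫⁻ x in Ω, ENNReal.ofReal (F x) ∂μ = ENNReal.ofReal (∫ x in K, F x ∂μ) := by
  rw [ofReal_integral_eq_lintegral_ofReal hF ((ae_restrict_iff' hK).2 (ae_of_all _ hF0))]
  have : (fun x => ENNReal.ofReal (F x)) = K.indicator fun x => ENNReal.ofReal (F x) := by
    funext x
    by_cases hx : x ∈ K
    · rw [indicator_of_mem hx]
    · rw [indicator_of_notMem hx, hFK x hx, ENNReal.ofReal_zero]
  conv_lhs => rw [this]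
  rw [lintegral_indicator hK, Measure.restrict_restrict hK, inter_eq_left.2 hKΩ]

theorem weighted_norm_gradient_rpow {x lam α p γ G : ℝ} (hx : 0 < x) (hG : 0 ≤ G) :
    √lam ^ p * (|x ^ (-(α / 2)) * G| ^ p * x ^ γ) =
      (√lam * x ^ (1 - α / 2)) ^ p * x ^ (γ - p) * (G ^ 2) ^ (p / 2) := by
  rw [abs_of_nonneg (by positivity), ← Real.rpow_natCast G 2, ← Real.rpow_mul hG,
    show ((2 : ℕ) : ℝ) * (p / 2) = p by push_cast; ring,
    Real.mul_rpow (by positivity) hG, Real.mul_rpow (Real.sqrt_nonneg _) (by positivity),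
    ← Real.rpow_mul hx.le, ← Real.rpow_mul hx.le]
  have : x ^ (-(α / 2) * p) * x ^ γ = x ^ ((1 - α / 2) * p) * x ^ (γ - p) := by
    rw [← Real.rpow_add hx, ← Real.rpow_add hx]; congr 1; ring
  linear_combination √lam ^ p * G ^ p * this

theorem ofReal_mul_rpow_le {p N a I J : ℝ} (hp : 0 < p) (hN : 0 ≤ N) (ha : 0 ≤ a) (hI : 0 ≤ I)
    (hJ : 0 ≤ J) (h : a ^ p * I ≤ N * J) :
    ENNReal.ofReal a * ENNReal.ofReal I ^ (1 / p) ≤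
      ENNReal.ofReal (N ^ (1 / p)) * ENNReal.ofReal J ^ (1 / p) := by
  have hp' : 0 ≤ 1 / p := by positivity
  rw [ENNReal.ofReal_rpow_of_nonneg hI hp', ENNReal.ofReal_rpow_of_nonneg hJ hp',
    ← ENNReal.ofReal_mul ha, ← ENNReal.ofReal_mul (by positivity), ← Real.mul_rpow hN hJ]
  refine ENNReal.ofReal_le_ofReal ?_
  have : a = (a ^ p) ^ (1 / p) := by
    rw [← Real.rpow_mul ha, mul_one_div_cancel hp.ne', Real.rpow_one]
  conv_lhs => rw [this]
  rw [← Real.mul_rpow (by positivity) hI]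
  gcongr

end Conversion

/-- Prototypical gradient estimate for the model equation
`u_t + λ u - x_d^α Δ u = x_d^α f` in `Ω_T` (Theorem 1.1, estimate (1.7)). -/
theorem stmt1 (d : ℕ) (hd : 1 ≤ d) (α p γ : ℝ)
    (hα : α ∈ Set.Ioo (0 : ℝ) 2) (hp : 1 < p)
    (hγ₁ : α * p / 2 - 1 < γ) (hγ₂ : γ < 2 * p - 1) :
    ∃ N : ℝ, 0 < N ∧
      ∀ (T : EReal) (lam : ℝ), 0 < lam →
        ∀ u : ℝ × Ed d → ℝ, ContDiff ℝ (⊤ : ℕ∞) u → HasCompactSupport u →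
          tsupport u ⊆ OmegaT d T →
          ENNReal.ofReal (Real.sqrt lam) *
              wLp d T p γ (fun z => xd z.2 ^ (-(α / 2)) * ‖Du u z‖)
          ≤ ENNReal.ofReal N *
              wLp d T p γ
                (fun z => xd z.2 ^ (-α) * (ut u z + lam * u z) - lap u z) := by
  obtain ⟨N, hN, H⟩ := gradient_estimate (volume.prod volume : Measure (ℝ × Ed d))
    (ℓ := lastCoord hd) (τ := (1, 0)) (by simp [lastCoord]) (sum_lastCoord_sq hd) hp hα.1.le hα.2
    hγ₁ hγ₂
  refine ⟨N ^ (1 / p), by positivity, ?_⟩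
  intro T lam hlam u hu hc hs
  have hK : IsCompact (tsupport u) := hc
  have hpos : ∀ z ∈ tsupport u, 0 < lastCoord hd z := fun z hz => by
    rw [lastCoord_apply]; exact (hs hz).2
  have huK : ∀ z ∉ tsupport u, u z = 0 := fun z hz => image_eq_zero_of_notMem_tsupport hz
  have hp0 : 0 < p := by linarith
  have hDu : ∀ z, ‖Du u z‖ ^ 2 =
      ∑ i, dirDeriv ((0 : ℝ), EuclideanSpace.single i (1 : ℝ)) u z ^ 2 := fun z => by
    simp only [norm_sq_eq_sum_apply_single, Du_apply (hu.differentiable (by simp) z)]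
  have hh := H lam (tsupport u) u hlam hK hpos hu huK
  have hd0 : ∀ v : ℝ × Ed d, ∀ z ∉ tsupport u, dirDeriv v u z = 0 := fun v =>
    dirDeriv_eq_zero_of_notMem (isClosed_tsupport u) huK v
  have hIg := integrableOn_gradient (p := p) (γ := γ)
    (e := fun i : Fin d => ((0 : ℝ), EuclideanSpace.single i (1 : ℝ)))
    (volume.prod volume : Measure (ℝ × Ed d)) hK hpos hu hp0.le (Real.sqrt_pos.2 hlam) (1 - α / 2)
  have hgrad : ∀ z ∈ tsupport u, (√lam * lastCoord hd z ^ (1 - α / 2)) ^ p *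
      lastCoord hd z ^ (γ - p) *
        (∑ i, dirDeriv ((0 : ℝ), EuclideanSpace.single i (1 : ℝ)) u z ^ 2) ^ (p / 2) =
      √lam ^ p * (|xd z.2 ^ (-(α / 2)) * ‖Du u z‖| ^ p * xd z.2 ^ γ) := fun z hz => by
    rw [← hDu, lastCoord_apply]
    exact (weighted_norm_gradient_rpow (hs hz).2 (norm_nonneg _)).symm
  have hm := hK.measurableSet
  have hsl : 0 < √lam ^ p := Real.rpow_pos_of_pos (Real.sqrt_pos.2 hlam) p
  rw [setIntegral_congr_fun hm hgrad, integral_const_mul] at hh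
  have hIDu := ((hIg.congr_fun hgrad hm).const_mul (√lam ^ p)⁻¹)
  simp only [inv_mul_cancel_left₀ hsl.ne'] at hIDu
  have hop : ∀ z, degenOp (lastCoord hd) (1, 0) (fun i => (0, EuclideanSpace.single i 1)) α lam u z =
      xd z.2 ^ (-α) * (ut u z + lam * u z) - lap u z := degenOp_lastCoord hd hu α lam
  have hIf : IntegrableOn (fun z => |xd z.2 ^ (-α) * (ut u z + lam * u z) - lap u z| ^ p *
      xd z.2 ^ γ) (tsupport u) (volume.prod volume : Measure (ℝ × Ed d)) := by
    have hcγ : ContinuousOn (fun z => lastCoord hd z ^ γ) (tsupport u) :=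
      continuousOn_comp_of_pos hpos (F := fun s => s ^ γ)
        (continuousOn_id.rpow_const fun s hs => Or.inl (ne_of_gt hs))
    have := (((continuousOn_degenOp (α := α) (τ := (1, 0))
      (e := fun i : Fin d => ((0 : ℝ), EuclideanSpace.single i (1 : ℝ))) hpos hu lam).abs.rpow_const
        fun _ _ => Or.inr hp0.le).mul hcγ).integrableOn_compact
          (μ := (volume.prod volume : Measure (ℝ × Ed d))) hK
    refine this.congr_fun (fun z _ => ?_) hm
    simp only [Pi.mul_apply, hop, lastCoord_apply]
  simp only [hop, lastCoord_apply] at hh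
  have e1 := setLIntegral_ofReal_eq hm hs hIDu (fun z hz => by
    have := (hs hz).2
    positivity) fun z hz => by
    have : ‖Du u z‖ = 0 := by
      rw [← sq_eq_zero_iff, hDu]
      exact Finset.sum_eq_zero fun i _ => by rw [hd0 _ z hz]; simp
    rw [this, mul_zero, abs_zero, Real.zero_rpow hp0.ne', zero_mul]
  have e2 := setLIntegral_ofReal_eq hm hs hIf (fun z hz => by
    have := (hs hz).2
    positivity) fun z hz => by
    have : degenOp (lastCoord hd) (1, 0) (fun i => (0, EuclideanSpace.single i 1)) α lam u z = 0 := by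
      simp only [degenOp, hd0 _ z hz, huK z hz,
        dirDeriv_eq_zero_of_notMem (isClosed_tsupport u) (hd0 _) _ z hz]
      simp
    rw [← hop, this, abs_zero, Real.zero_rpow hp0.ne', zero_mul]
  have hI := setIntegral_nonneg (μ := (volume.prod volume : Measure (ℝ × Ed d))) hm fun z hz =>
    show 0 ≤ |xd z.2 ^ (-(α / 2)) * ‖Du u z‖| ^ p * xd z.2 ^ γ by
      have := (hs hz).2
      positivity
  have hJ := setIntegral_nonneg (μ := (volume.prod volume : Measure (ℝ × Ed d))) hm fun z hz =>
    show 0 ≤ |xd z.2 ^ (-α) * (ut u z + lam * u z) - lap u z| ^ p * xd z.2 ^ γ by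
      have := (hs hz).2
      positivity
  unfold wLp
  erw [e1, e2]
  exact ofReal_mul_rpow_le hp0 hN.le (Real.sqrt_nonneg _) hI hJ hh
end
end

section
/- Let d = 1, p ∈ (1,∞), α ∈ [1,2), λ > 0, and T ∈ ℝ (so T < ∞). Let ξ : [0,∞) → [0,∞) be a smooth function with ξ = 1 on [0,1], ξ = 0 on [3,∞), and |ξ'| ≤ 1 everywhere. Set c = 2λ/((3-α)(2-α)), u(t,x) = (x + c x^{3-α}) ξ(x) e^{λt} for (t,x) ∈ Ω_T = (-∞,T) × (0,∞), and f(t,x) = x^{-α}(u_t(t,x) + λ u(t,x)) - u_{xx}(t,x) (so that u solves u_t + λu - x^α u_{xx} = x^α f in Ω_T). Then ∫_{Ω_T} |x^{-α} u(t,x)|^p x^{p(α-1)-1} dx dt = ∞, while ∫_{Ω_T} |f(t,x)|^p x^{p(α-1)-1} dx dt < ∞. -/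
open MeasureTheory ENNReal Set

noncomputable section

theorem setLIntegral_ofReal_exp_mul {a T : ℝ} {s : Set ℝ} {h : ℝ → ℝ} (hh : Measurable h) :
    ∫⁻ z in Iio T ×ˢ s, ENNReal.ofReal (Real.exp (a * z.1) * h z.2) =
      (∫⁻ t in Iio T, ENNReal.ofReal (Real.exp (a * t))) * ∫⁻ x in s, ENNReal.ofReal (h x) := by
  simp_rw [ENNReal.ofReal_mul (Real.exp_nonneg _)]
  rw [Measure.volume_eq_prod, ← Measure.prod_restrict]
  exact lintegral_prod_mul (f := fun t => ENNReal.ofReal (Real.exp (a * t)))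
    (g := fun x => ENNReal.ofReal (h x)) (by fun_prop) (by fun_prop)

theorem setLIntegral_Iio_ofReal_exp_mul_lt_top {a : ℝ} (ha : 0 < a) (T : ℝ) :
    ∫⁻ t in Iio T, ENNReal.ofReal (Real.exp (a * t)) < ⊤ :=
  (hasFiniteIntegral_iff_ofReal (ae_of_all _ fun _ => Real.exp_nonneg _)).1
    ((integrableOn_exp_mul_Iic ha T).mono_set Iio_subset_Iic_self).2

theorem setLIntegral_Iio_ofReal_exp_mul_ne_zero (a T : ℝ) :
    ∫⁻ t in Iio T, ENNReal.ofReal (Real.exp (a * t)) ≠ 0 := by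
  refine ((setLIntegral_pos_iff (by fun_prop)).2 ?_).ne'
  have : Function.support (fun t => ENNReal.ofReal (Real.exp (a * t))) = univ := by
    ext t; simp [Real.exp_pos]
  simp [this]

theorem setLIntegral_Ioo_ofReal_rpow_neg_one :
    ∫⁻ x in Ioo (0 : ℝ) 1, ENNReal.ofReal (x ^ (-1 : ℝ)) = ⊤ := by
  by_contra h
  have hnn : 0 ≤ᵐ[volume.restrict (Ioo (0 : ℝ) 1)] fun x => x ^ (-1 : ℝ) :=
    (ae_restrict_iff' measurableSet_Ioo).2 (ae_of_all _ fun x hx => Real.rpow_nonneg hx.1.le _)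
  have : IntegrableOn (fun x => x ^ (-1 : ℝ)) (Ioo (0 : ℝ) 1) :=
    ⟨(by fun_prop : Measurable fun x : ℝ => x ^ (-1 : ℝ)).aestronglyMeasurable,
      (hasFiniteIntegral_iff_ofReal hnn).2 (lt_top_iff_ne_top.2 h)⟩
  exact absurd ((intervalIntegral.integrableOn_Ioo_rpow_iff one_pos).1 this) (lt_irrefl _)

theorem setLIntegral_Ioo_ofReal_const_mul_rpow_lt_top (C : ℝ) {s b : ℝ} (hs : -1 < s)
    (hb : 0 < b) (hC : 0 ≤ C) :
    ∫⁻ x in Ioo (0 : ℝ) b, ENNReal.ofReal (C * x ^ s) < ⊤ := by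
  have hnn : 0 ≤ᵐ[volume.restrict (Ioo (0 : ℝ) b)] fun x => C * x ^ s :=
    (ae_restrict_iff' measurableSet_Ioo).2
      (ae_of_all _ fun x hx => mul_nonneg hC (Real.rpow_nonneg hx.1.le _))
  exact (hasFiniteIntegral_iff_ofReal hnn).1
    (((intervalIntegral.integrableOn_Ioo_rpow_iff hb).2 hs).const_mul C).2

theorem abs_mul_exp_rpow_mul (a lam t p y : ℝ) :
    |a * Real.exp (lam * t)| ^ p * y = Real.exp (lam * p * t) * (|a| ^ p * y) := by
  rw [abs_mul, Real.abs_exp, Real.mul_rpow (abs_nonneg _) (Real.exp_nonneg _), ← Real.exp_mul,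
    mul_right_comm lam p]
  ring

/-- If `|w| ≥ x ^ (1 - α)` near zero, then `w(x) e^{λt}` has infinite weighted norm. -/
theorem setLIntegral_weight_eq_top {p α lam T : ℝ} (hp : 0 < p) {w : ℝ → ℝ}
    (hw : ∀ x ∈ Ioo (0 : ℝ) 1, x ^ (1 - α) ≤ |w x|) :
    ∫⁻ z in {z : ℝ × ℝ | z.1 < T ∧ 0 < z.2}, ENNReal.ofReal
      (|w z.2 * Real.exp (lam * z.1)| ^ p * z.2 ^ (p * (α - 1) - 1)) = ⊤ := by
  rw [eq_top_iff]
  calc (⊤ : ℝ≥0∞) = ∫⁻ z in Iio T ×ˢ Ioo (0 : ℝ) 1,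
        ENNReal.ofReal (Real.exp (lam * p * z.1) * z.2 ^ (-1 : ℝ)) := by
        rw [setLIntegral_ofReal_exp_mul (h := fun x : ℝ => x ^ (-1 : ℝ)) (by fun_prop),
          setLIntegral_Ioo_ofReal_rpow_neg_one,
          ENNReal.mul_top (setLIntegral_Iio_ofReal_exp_mul_ne_zero _ _)]
    _ ≤ ∫⁻ z in Iio T ×ˢ Ioo (0 : ℝ) 1, ENNReal.ofReal
          (|w z.2 * Real.exp (lam * z.1)| ^ p * z.2 ^ (p * (α - 1) - 1)) := by
        refine setLIntegral_mono' (measurableSet_Iio.prod measurableSet_Ioo) fun z hz => ?_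
        have hz0 : 0 < z.2 := hz.2.1
        refine ENNReal.ofReal_le_ofReal ?_
        rw [abs_mul_exp_rpow_mul]
        refine mul_le_mul_of_nonneg_left ?_ (Real.exp_nonneg _)
        calc z.2 ^ (-1 : ℝ) = (z.2 ^ (1 - α)) ^ p * z.2 ^ (p * (α - 1) - 1) := by
              rw [← Real.rpow_mul hz0.le, ← Real.rpow_add hz0]; ring_nf
          _ ≤ _ := by gcongr; exact hw _ hz.2
    _ ≤ _ := lintegral_mono_set (prod_mono_right Ioo_subset_Ioi_self)

/-- If `|F| ≤ K x ^ (3 - 2α)` and `F` vanishes far away, then `F(x) e^{λt}` has finite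
weighted norm. -/
theorem setLIntegral_weight_lt_top {p α lam T b K : ℝ} (hp : 0 < p) (hα : α < 2)
    (hlam : 0 < lam) (hb : 0 < b) (hK : 0 ≤ K) {F : ℝ → ℝ}
    (hF : ∀ x ∈ Ioo (0 : ℝ) b, |F x| ≤ K * x ^ (3 - 2 * α)) (hF0 : ∀ x, b ≤ x → F x = 0) :
    ∫⁻ z in {z : ℝ × ℝ | z.1 < T ∧ 0 < z.2}, ENNReal.ofReal
      (|F z.2 * Real.exp (lam * z.1)| ^ p * z.2 ^ (p * (α - 1) - 1)) < ⊤ := by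
  have hm : MeasurableSet (Iio T ×ˢ Ioo (0 : ℝ) b) := measurableSet_Iio.prod measurableSet_Ioo
  calc ∫⁻ z in {z : ℝ × ℝ | z.1 < T ∧ 0 < z.2}, ENNReal.ofReal
        (|F z.2 * Real.exp (lam * z.1)| ^ p * z.2 ^ (p * (α - 1) - 1))
      = ∫⁻ z in Iio T ×ˢ Ioo (0 : ℝ) b, ENNReal.ofReal
          (|F z.2 * Real.exp (lam * z.1)| ^ p * z.2 ^ (p * (α - 1) - 1)) := by
        have hsub : Iio T ×ˢ Ioo (0 : ℝ) b ⊆ {z : ℝ × ℝ | z.1 < T ∧ 0 < z.2} :=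
          prod_mono_right Ioo_subset_Ioi_self
        conv_rhs => rw [← inter_eq_left.2 hsub]
        rw [← setLIntegral_indicator hm]
        refine setLIntegral_congr_fun (measurableSet_Iio.prod measurableSet_Ioi) fun z hz => ?_
        by_cases hzb : z.2 < b
        · have hzmem : z ∈ Iio T ×ˢ Ioo 0 b := ⟨hz.1, hz.2, hzb⟩
          simp only [indicator_of_mem hzmem]
        · have hzmem : z ∉ Iio T ×ˢ Ioo 0 b := fun h => hzb h.2.2
          simp only [indicator_of_notMem hzmem]
          simp [hF0 _ (not_lt.1 hzb), Real.zero_rpow hp.ne']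
    _ ≤ ∫⁻ z in Iio T ×ˢ Ioo (0 : ℝ) b, ENNReal.ofReal
          (Real.exp (lam * p * z.1) * (K ^ p * z.2 ^ (p * (2 - α) - 1))) := by
        refine setLIntegral_mono' hm fun z hz => ?_
        have hz0 : 0 < z.2 := hz.2.1
        refine ENNReal.ofReal_le_ofReal ?_
        rw [abs_mul_exp_rpow_mul]
        refine mul_le_mul_of_nonneg_left ?_ (Real.exp_nonneg _)
        calc |F z.2| ^ p * z.2 ^ (p * (α - 1) - 1)
            ≤ (K * z.2 ^ (3 - 2 * α)) ^ p * z.2 ^ (p * (α - 1) - 1) := by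
              gcongr; exact hF _ hz.2
          _ = K ^ p * z.2 ^ (p * (2 - α) - 1) := by
              rw [Real.mul_rpow hK (by positivity), ← Real.rpow_mul hz0.le, mul_assoc,
                ← Real.rpow_add hz0]
              ring_nf
    _ < ⊤ := by
        rw [setLIntegral_ofReal_exp_mul (h := fun x : ℝ => K ^ p * x ^ (p * (2 - α) - 1))
          (by fun_prop)]
        refine ENNReal.mul_lt_top (setLIntegral_Iio_ofReal_exp_mul_lt_top (by positivity) T)
          (setLIntegral_Ioo_ofReal_const_mul_rpow_lt_top _ ?_ hb (by positivity))
        have : 0 < p * (2 - α) := mul_pos hp (by linarith)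
        linarith

theorem deriv_deriv_add_const_mul_rpow (c s : ℝ) {x : ℝ} (hx : 0 < x) :
    deriv (deriv fun y : ℝ => y + c * y ^ s) x = c * (s * ((s - 1) * x ^ (s - 2))) := by
  have h1 : ∀ y : ℝ, 0 < y → HasDerivAt (fun y : ℝ => y + c * y ^ s)
      (1 + c * (s * y ^ (s - 1))) y := fun y hy =>
    (hasDerivAt_id y).add ((Real.hasDerivAt_rpow_const (Or.inl hy.ne')).const_mul c)
  have h2 : deriv (fun y : ℝ => y + c * y ^ s) =ᶠ[nhds x] fun y => 1 + c * (s * y ^ (s - 1)) := by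
    filter_upwards [Ioi_mem_nhds hx] with y hy using (h1 y hy).deriv
  rw [h2.deriv_eq]
  have h3 := (((Real.hasDerivAt_rpow_const (p := s - 1) (Or.inl hx.ne')).const_mul s).const_mul
    c).const_add 1
  rw [h3.deriv]
  ring_nf

/-- Remark 2.4: optimality of the lower bound `γ = p(α-1)-1` for `α ∈ [1,2)`,
via the explicit example `u(t,x) = (x + c x^{3-α}) ξ(x) e^{λ t}`. -/
theorem stmt5 (p α lam T : ℝ) (hp : 1 < p) (hα1 : 1 ≤ α) (hα2 : α < 2)
    (hlam : 0 < lam)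
    (ξ : ℝ → ℝ) (hξsmooth : ContDiffOn ℝ (⊤ : ℕ∞) ξ (Set.Ici 0))
    (hξnonneg : ∀ x : ℝ, 0 ≤ x → 0 ≤ ξ x)
    (hξone : ∀ x ∈ Set.Icc (0 : ℝ) 1, ξ x = 1)
    (hξzero : ∀ x : ℝ, 3 ≤ x → ξ x = 0)
    (hξder : ∀ x : ℝ, 0 ≤ x → |deriv ξ x| ≤ 1)
    (c : ℝ) (hc : c = 2 * lam / ((3 - α) * (2 - α)))
    (u f : ℝ → ℝ → ℝ)
    (hu : ∀ t x : ℝ, u t x = (x + c * x ^ (3 - α)) * ξ x * Real.exp (lam * t))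
    (hf : ∀ t x : ℝ,
      f t x = x ^ (-α) * (deriv (fun s => u s x) t + lam * u t x)
        - deriv (deriv (u t)) x) :
    (∫⁻ z in {z : ℝ × ℝ | z.1 < T ∧ 0 < z.2},
        ENNReal.ofReal (|z.2 ^ (-α) * u z.1 z.2| ^ p * z.2 ^ (p * (α - 1) - 1))) = ⊤
    ∧
    (∫⁻ z in {z : ℝ × ℝ | z.1 < T ∧ 0 < z.2},
        ENNReal.ofReal (|f z.1 z.2| ^ p * z.2 ^ (p * (α - 1) - 1))) < ⊤ := by
  have hS : {z : ℝ × ℝ | z.1 < T ∧ 0 < z.2} = Iio T ×ˢ Ioi 0 := rfl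
  have hms : MeasurableSet {z : ℝ × ℝ | z.1 < T ∧ 0 < z.2} :=
    hS ▸ measurableSet_Iio.prod measurableSet_Ioi
  have hc0 : 0 ≤ c := by
    rw [hc]
    have : 0 < 3 - α := by linarith
    have : 0 < 2 - α := by linarith
    positivity
  set v : ℝ → ℝ := fun x => (x + c * x ^ (3 - α)) * ξ x with hv
  have hut : ∀ t, u t = fun x => v x * Real.exp (lam * t) := fun t => funext (hu t)
  set F : ℝ → ℝ := fun x => x ^ (-α) * (2 * lam * v x) - deriv (deriv v) x with hFdef
  have hfF : ∀ t x, f t x = F x * Real.exp (lam * t) := by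
    intro t x
    have h1 : HasDerivAt (fun s => u s x) (v x * (Real.exp (lam * t) * lam)) t := by
      simp only [hut]
      simpa using (((hasDerivAt_id t).const_mul lam).exp).const_mul (v x)
    rw [hf, h1.deriv, hut, deriv_mul_const_field', deriv_mul_const_field, hFdef]
    ring
  have hvnear : ∀ x ∈ Ioo (0 : ℝ) 1, v x = x + c * x ^ (3 - α) := fun x hx => by
    simp [hv, hξone x ⟨hx.1.le, hx.2.le⟩]
  have hFnear : ∀ x ∈ Ioo (0 : ℝ) 1, F x = 2 * lam * c * x ^ (3 - 2 * α) := by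
    intro x hx
    have hev : v =ᶠ[nhds x] fun y => y + c * y ^ (3 - α) := by
      filter_upwards [Ioo_mem_nhds hx.1 hx.2] with y hy using hvnear y hy
    have h3 : x ^ (-α) * x = x ^ (1 - α) := by
      nth_rewrite 2 [← Real.rpow_one x]
      rw [← Real.rpow_add hx.1]; ring_nf
    have h4 : x ^ (-α) * x ^ (3 - α) = x ^ (3 - 2 * α) := by
      rw [← Real.rpow_add hx.1]; ring_nf
    have h5 : c * ((3 - α) * (2 - α)) = 2 * lam := by
      rw [hc]; exact div_mul_cancel₀ _ (mul_ne_zero (by linarith) (by linarith))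
    have h6 : (3 - α - 2 : ℝ) = 1 - α := by ring
    simp only [hFdef]
    rw [hev.deriv.deriv_eq, deriv_deriv_add_const_mul_rpow c _ hx.1, hvnear x hx, h6]
    linear_combination 2 * lam * h3 + 2 * lam * c * h4 - x ^ (1 - α) * h5
  have hFfar : ∀ x, 4 ≤ x → F x = 0 := by
    intro x hx
    have hev : v =ᶠ[nhds x] fun _ => (0 : ℝ) := by
      filter_upwards [Ioi_mem_nhds (show (3 : ℝ) < x by linarith)] with y hy
      simp [hv, hξzero y (le_of_lt hy)]
    simp only [hFdef]
    rw [hev.deriv.deriv_eq, hev.self_of_nhds]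
    simp
  have hrpow : ∀ s : ℝ, ContDiffOn ℝ (⊤ : ℕ∞) (fun x : ℝ => x ^ s) (Ioi 0) := fun s =>
    contDiffOn_id.rpow_const_of_ne fun x hx => ne_of_gt hx
  have hvs : ContDiffOn ℝ (⊤ : ℕ∞) v (Ioi 0) :=
    (contDiffOn_id.add (contDiffOn_const.mul (hrpow _))).mul (hξsmooth.mono Ioi_subset_Ici_self)
  have hv2 : ContDiffOn ℝ (⊤ : ℕ∞) (deriv (deriv v)) (Ioi 0) :=
    (hvs.deriv_of_isOpen (m := (⊤ : ℕ∞)) isOpen_Ioi (by simp)).deriv_of_isOpen isOpen_Ioi (by simp)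
  have hFc : ContinuousOn (fun x => F x * x ^ (2 * α - 3)) (Icc 1 4) :=
    ((((hrpow (-α)).continuousOn.mul (continuousOn_const.mul hvs.continuousOn)).sub
      hv2.continuousOn).mul (hrpow _).continuousOn).mono
        fun x hx => lt_of_lt_of_le one_pos hx.1
  obtain ⟨M, hM⟩ := isCompact_Icc.exists_bound_of_continuousOn hFc
  have hFbound : ∀ x ∈ Ioo (0 : ℝ) 4, |F x| ≤ max (2 * lam * c) M * x ^ (3 - 2 * α) := by
    intro x hx
    have hx0 : 0 < x := hx.1
    rcases lt_or_ge x 1 with h | h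
    · rw [hFnear x ⟨hx0, h⟩, abs_of_nonneg (by positivity)]
      gcongr
      exact le_max_left _ _
    · calc |F x| = |F x * x ^ (2 * α - 3)| * x ^ (3 - 2 * α) := by
            rw [abs_mul, abs_of_nonneg (Real.rpow_nonneg hx0.le (2 * α - 3)), mul_assoc,
              ← Real.rpow_add hx0]
            simp
        _ ≤ _ := by
            gcongr
            exact (hM x ⟨h, hx.2.le⟩).trans (le_max_right _ _)
  constructor
  · rw [← setLIntegral_weight_eq_top (p := p) (α := α) (lam := lam) (T := T)
      (w := fun x => x ^ (-α) * v x) (by linarith)]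
    · refine setLIntegral_congr_fun hms fun z _ => ?_
      simp only [hut, mul_assoc]
    · intro x hx
      have hx0 : 0 < x := hx.1
      have h3 : x ^ (1 - α) = x ^ (-α) * x := by
        nth_rewrite 3 [← Real.rpow_one x]
        rw [← Real.rpow_add hx0]; ring_nf
      refine le_trans ?_ (le_abs_self _)
      rw [hvnear x hx, h3]
      gcongr
      exact le_add_of_nonneg_right (by positivity)
  · simp_rw [hfF]
    exact setLIntegral_weight_lt_top (by linarith) hα2 hlam (by norm_num)
      (le_max_of_le_left (by positivity)) hFbound hFfar
end
end

section
/- Let d = 1, p ∈ (1,∞), α ∈ (0,2), λ > 0, and T ∈ ℝ (so T < ∞). Let ξ : [0,∞) → [0,∞) be a smooth function with ξ = 1 on [0,1], ξ = 0 on [3,∞), and |ξ'| ≤ 1 everywhere. Set c = 2λ/((3-α)(2-α)), u(t,x) = (x + c x^{3-α}) ξ(x) e^{λt} for (t,x) ∈ Ω_T = (-∞,T) × (0,∞), and f(t,x) = x^{-α}(u_t(t,x) + λ u(t,x)) - u_{xx}(t,x). Then ∫_{Ω_T} |x^{-α/2} u_x(t,x)|^p x^{αp/2-1} dx dt = ∞,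 while ∫_{Ω_T} |f(t,x)|^p x^{αp/2-1} dx dt < ∞. -/
open MeasureTheory ENNReal Set

noncomputable section

/-- The integral of a product `a t * b x` over a product set splits. -/
theorem setLIntegral_ofReal_mul_prod {a b : ℝ → ℝ} {S R : Set ℝ}
    (ha0 : ∀ t, 0 ≤ a t)
    (ha : AEMeasurable a (volume.restrict S)) (hb : AEMeasurable b (volume.restrict R)) :
    (∫⁻ z in S ×ˢ R, ENNReal.ofReal (a z.1 * b z.2)) =
      (∫⁻ t in S, ENNReal.ofReal (a t)) * ∫⁻ x in R, ENNReal.ofReal (b x) := by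
  rw [Measure.volume_eq_prod, ← Measure.prod_restrict,
    ← lintegral_prod_mul ha.ennreal_ofReal hb.ennreal_ofReal]
  exact lintegral_congr fun z => ENNReal.ofReal_mul (ha0 _)

theorem setLIntegral_ofReal_inv_Ioi_zero_eq_top {b : ℝ → ℝ}
    (hb : ∀ x ∈ Ioo (0 : ℝ) 1, x ^ (-1 : ℝ) ≤ b x) :
    ∫⁻ x in Ioi (0 : ℝ), ENNReal.ofReal (b x) = ⊤ := by
  have hle : ∫⁻ x in Ioo (0 : ℝ) 1, ENNReal.ofReal (x ^ (-1 : ℝ)) ≤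
      ∫⁻ x in Ioi (0 : ℝ), ENNReal.ofReal (b x) :=
    (setLIntegral_mono' measurableSet_Ioo fun x hx => ENNReal.ofReal_le_ofReal (hb x hx)).trans
      (lintegral_mono_set Ioo_subset_Ioi_self)
  refine top_le_iff.1 (le_trans ?_ hle)
  by_contra h
  have hm : AEStronglyMeasurable (fun x : ℝ => x ^ (-1 : ℝ)) (volume.restrict (Ioo 0 1)) :=
    (measurable_id.pow_const _).aestronglyMeasurable
  have hint : IntegrableOn (fun x : ℝ => x ^ (-1 : ℝ)) (Ioo 0 1) :=
    (lintegral_ofReal_ne_top_iff_integrable hm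
      ((ae_restrict_iff' measurableSet_Ioo).2 (.of_forall fun x hx =>
        Real.rpow_nonneg hx.1.le _))).1 fun h' => h (h' ▸ le_rfl)
  exact lt_irrefl _ ((intervalIntegral.integrableOn_Ioo_rpow_iff one_pos).1 hint)

theorem setLIntegral_exp_rpow_Iio_lt_top {lam p : ℝ} (hlam : 0 < lam) (hp : 0 < p) (T : ℝ) :
    ∫⁻ t in Iio T, ENNReal.ofReal (Real.exp (lam * t) ^ p) < ⊤ := by
  have h : IntegrableOn (fun t => Real.exp (lam * t) ^ p) (Iio T) := by
    simp_rw [← Real.exp_mul, mul_right_comm lam _ p]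
    exact (integrableOn_exp_mul_Iic (mul_pos hlam hp) T).mono_set Iio_subset_Iic_self
  exact h.lintegral_lt_top

theorem setLIntegral_exp_rpow_Iio_ne_zero (lam p T : ℝ) :
    ∫⁻ t in Iio T, ENNReal.ofReal (Real.exp (lam * t) ^ p) ≠ 0 := by
  refine (setLIntegral_pos_iff (by fun_prop) |>.2 ?_).ne'
  have : (Function.support fun t => ENNReal.ofReal (Real.exp (lam * t) ^ p)) = univ := by
    ext t
    simp [Real.rpow_pos_of_pos (Real.exp_pos _) p]
  simp [this]

/-- A continuous function on `(0, ∞)` which is a power near `0` and vanishes for large arguments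
has finite weighted `L^p` norm as soon as the weighted power is integrable near `0`. -/
theorem setLIntegral_abs_rpow_mul_rpow_lt_top {g : ℝ → ℝ} {K p r s R : ℝ} (hp : 0 < p)
    (hg : ContinuousOn g (Ioi 0)) (hg0 : ∀ x ∈ Ioo (0 : ℝ) 1, g x = K * x ^ r)
    (hg1 : ∀ x, R < x → g x = 0) (hs : -1 < r * p + s) :
    ∫⁻ x in Ioi (0 : ℝ), ENNReal.ofReal (|g x| ^ p * x ^ s) < ⊤ := by
  have h1 : IntegrableOn (fun x => |g x| ^ p * x ^ s) (Ioo 0 1) := by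
    refine IntegrableOn.congr_fun (f := fun x => |K| ^ p * x ^ (r * p + s))
      (((intervalIntegral.integrableOn_Ioo_rpow_iff one_pos).2 hs).const_mul _)
      (fun x hx => ?_) measurableSet_Ioo
    have hx0 := hx.1
    simp only [hg0 x hx]
    rw [abs_mul, abs_of_pos (Real.rpow_pos_of_pos hx0 r),
      Real.mul_rpow (abs_nonneg _) (Real.rpow_nonneg hx0.le _), ← Real.rpow_mul hx0.le,
      Real.rpow_add hx0, mul_assoc]
  have h2 : IntegrableOn (fun x => |g x| ^ p * x ^ s) (Icc 1 R) := by
    have hsub : Icc 1 R ⊆ Ioi (0 : ℝ) := fun x hx => one_pos.trans_le hx.1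
    refine ContinuousOn.integrableOn_Icc (ContinuousOn.mul ?_ ?_)
    · exact (hg.mono hsub).abs.rpow_const fun _ _ => Or.inr hp.le
    · exact continuousOn_id.rpow_const fun x hx => Or.inl (hsub hx).ne'
  have h3 : IntegrableOn (fun x => |g x| ^ p * x ^ s) (Ioi R) :=
    IntegrableOn.congr_fun (f := fun _ => (0 : ℝ)) integrableOn_zero
      (fun x hx => by simp [hg1 x hx, Real.zero_rpow hp.ne']) measurableSet_Ioi
  have h : IntegrableOn (fun x => |g x| ^ p * x ^ s) (Ioi 0) := by
    refine ((h1.union h2).union h3).mono_set fun x hx => ?_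
    by_cases hx1 : x < 1
    · exact Or.inl (Or.inl ⟨hx, hx1⟩)
    · by_cases hxR : x ≤ R
      · exact Or.inl (Or.inr ⟨not_lt.1 hx1, hxR⟩)
      · exact Or.inr (not_le.1 hxR)
  exact h.lintegral_lt_top

theorem hasDerivAt_add_const_mul_rpow (c β : ℝ) {x : ℝ} (hx : 0 < x) :
    HasDerivAt (fun y : ℝ => y + c * y ^ β) (1 + c * (β * x ^ (β - 1))) x :=
  (hasDerivAt_id x).add ((Real.hasDerivAt_rpow_const (Or.inl hx.ne')).const_mul c)

theorem hasDerivAt_deriv_add_const_mul_rpow (c β : ℝ) {x : ℝ} (hx : 0 < x) :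
    HasDerivAt (fun y : ℝ => 1 + c * (β * y ^ (β - 1)))
      (c * (β * ((β - 1) * x ^ (β - 1 - 1)))) x :=
  (((Real.hasDerivAt_rpow_const (Or.inl hx.ne')).const_mul β).const_mul c).const_add 1

/-- Remark 2.5: optimality of the lower bound `γ = αp/2 - 1` for the gradient
estimate, via the explicit example `u(t,x) = (x + c x^{3-α}) ξ(x) e^{λ t}`. -/
theorem stmt6 (p α lam T : ℝ) (hp : 1 < p) (hα1 : 0 < α) (hα2 : α < 2)
    (hlam : 0 < lam)
    (ξ : ℝ → ℝ) (hξsmooth : ContDiffOn ℝ (⊤ : ℕ∞) ξ (Set.Ici 0))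
    (hξnonneg : ∀ x : ℝ, 0 ≤ x → 0 ≤ ξ x)
    (hξone : ∀ x ∈ Set.Icc (0 : ℝ) 1, ξ x = 1)
    (hξzero : ∀ x : ℝ, 3 ≤ x → ξ x = 0)
    (hξder : ∀ x : ℝ, 0 ≤ x → |deriv ξ x| ≤ 1)
    (c : ℝ) (hc : c = 2 * lam / ((3 - α) * (2 - α)))
    (u f : ℝ → ℝ → ℝ)
    (hu : ∀ t x : ℝ, u t x = (x + c * x ^ (3 - α)) * ξ x * Real.exp (lam * t))
    (hf : ∀ t x : ℝ,
      f t x = x ^ (-α) * (deriv (fun s => u s x) t + lam * u t x)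
        - deriv (deriv (u t)) x) :
    (∫⁻ z in {z : ℝ × ℝ | z.1 < T ∧ 0 < z.2},
        ENNReal.ofReal
          (|z.2 ^ (-(α / 2)) * deriv (u z.1) z.2| ^ p * z.2 ^ (α * p / 2 - 1))) = ⊤
    ∧
    (∫⁻ z in {z : ℝ × ℝ | z.1 < T ∧ 0 < z.2},
        ENNReal.ofReal (|f z.1 z.2| ^ p * z.2 ^ (α * p / 2 - 1))) < ⊤ := by
  have h2α : 0 < 2 - α := by linarith
  have h3α : 0 < 3 - α := by linarith
  have hp0 : 0 < p := by linarith
  have hc0 : 0 ≤ c := by rw [hc]; positivity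
  set w : ℝ → ℝ := fun x => (x + c * x ^ (3 - α)) * ξ x with hw
  have hut : ∀ t, u t = fun x => w x * Real.exp (lam * t) := fun t => funext (hu t)
  have hw_near : ∀ x ∈ Ioo (0 : ℝ) 1, ∀ᶠ y in nhds x, w y = y + c * y ^ (3 - α) := by
    intro x hx
    filter_upwards [isOpen_Ioo.mem_nhds hx] with y hy
    simp [hw, hξone y ⟨hy.1.le, hy.2.le⟩]
  have hw' : ∀ x ∈ Ioo (0 : ℝ) 1, deriv w x = 1 + c * ((3 - α) * x ^ (3 - α - 1)) :=
    fun x hx => (Filter.EventuallyEq.deriv_eq (hw_near x hx)).trans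
      (hasDerivAt_add_const_mul_rpow c _ hx.1).deriv
  have hw'' : ∀ x ∈ Ioo (0 : ℝ) 1,
      deriv (deriv w) x = c * ((3 - α) * ((3 - α - 1) * x ^ (3 - α - 1 - 1))) := by
    intro x hx
    have : deriv w =ᶠ[nhds x] fun y => 1 + c * ((3 - α) * y ^ (3 - α - 1)) := by
      filter_upwards [isOpen_Ioo.mem_nhds hx] with y hy using hw' y hy
    exact this.deriv_eq.trans (hasDerivAt_deriv_add_const_mul_rpow c _ hx.1).deriv
  set g : ℝ → ℝ := fun x => x ^ (-α) * (2 * lam * w x) - deriv (deriv w) x with hgdef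
  have hux : ∀ t x, deriv (u t) x = deriv w x * Real.exp (lam * t) := fun t x => by
    rw [hut t, deriv_mul_const_field]
  have hfg : ∀ t x, f t x = Real.exp (lam * t) * g x := by
    intro t x
    have h1 : deriv (fun s => u s x) t = w x * (Real.exp (lam * t) * lam) := by
      have : (fun s => u s x) = fun s => w x * Real.exp (lam * s) := funext fun s => hu s x
      rw [this]
      simpa using (((hasDerivAt_id t).const_mul lam).exp.const_mul (w x)).deriv
    have h2 : deriv (deriv (u t)) x = deriv (deriv w) x * Real.exp (lam * t) := by
      rw [funext (hux t), deriv_mul_const_field]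
    rw [hf, h1, h2, hut t, hgdef]
    ring
  have hwC : ContDiffOn ℝ 2 w (Ioi 0) := by
    refine ContDiffOn.mul (contDiffOn_id.add (contDiffOn_const.mul ?_)) ?_
    · exact contDiffOn_id.rpow_const_of_ne fun x hx => ne_of_gt hx
    · exact (hξsmooth.mono Ioi_subset_Ici_self).of_le (WithTop.coe_le_coe.2 (le_top : (2 : ℕ∞) ≤ ⊤))
  have hgC : ContinuousOn g (Ioi 0) := by
    refine ContinuousOn.sub (ContinuousOn.mul ?_ (continuousOn_const.mul hwC.continuousOn)) ?_
    · exact continuousOn_id.rpow_const fun x hx => Or.inl (ne_of_gt hx)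
    · exact (hwC.deriv_of_isOpen (m := 1) isOpen_Ioi (by norm_num)).continuousOn_deriv_of_isOpen
        isOpen_Ioi le_rfl
  have hg0 : ∀ x ∈ Ioo (0 : ℝ) 1, g x = (2 * lam * c) * x ^ (3 - 2 * α) := by
    intro x hx
    have hx0 := hx.1
    have e1 : x ^ (-α) * x = x ^ (3 - α - 1 - 1) := by
      rw [← Real.rpow_add_one hx0.ne']; congr 1; ring
    have e2 : x ^ (-α) * x ^ (3 - α) = x ^ (3 - 2 * α) := by
      rw [← Real.rpow_add hx0]; congr 1; ring
    have e3 : c * ((3 - α) * (2 - α)) = 2 * lam := by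
      rw [hc]; field_simp
    simp only [hgdef, hw'' x hx, (hw_near x hx).self_of_nhds]
    linear_combination (2 * lam) * e1 + (2 * lam * c) * e2 - x ^ (3 - α - 1 - 1) * e3
  have hg1 : ∀ x, 3 < x → g x = 0 := by
    intro x hx
    have hev : ∀ y, 3 < y → w =ᶠ[nhds y] fun _ => 0 := fun y hy => by
      filter_upwards [isOpen_Ioi.mem_nhds hy] with z hz
      simp [hw, hξzero z (le_of_lt hz)]
    have hev' : deriv w =ᶠ[nhds x] fun _ => 0 := by
      filter_upwards [isOpen_Ioi.mem_nhds hx] with z hz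
      simpa using (hev z hz).deriv_eq
    have h2 : deriv (deriv w) x = 0 := by simpa using hev'.deriv_eq
    simp [hgdef, h2, (hev x hx).self_of_nhds]
  have hset : {z : ℝ × ℝ | z.1 < T ∧ 0 < z.2} = Iio T ×ˢ Ioi 0 := rfl
  have hexp0 : ∀ t, 0 ≤ Real.exp (lam * t) ^ p := fun t => by positivity
  have hexpm : Measurable fun t => Real.exp (lam * t) ^ p := by fun_prop
  rw [hset]
  constructor
  · have hb : Measurable fun x : ℝ => |x ^ (-(α / 2)) * deriv w x| ^ p * x ^ (α * p / 2 - 1) := by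
      have := measurable_deriv w
      fun_prop
    have hfac : ∀ z : ℝ × ℝ,
        |z.2 ^ (-(α / 2)) * deriv (u z.1) z.2| ^ p * z.2 ^ (α * p / 2 - 1) =
          Real.exp (lam * z.1) ^ p *
            (|z.2 ^ (-(α / 2)) * deriv w z.2| ^ p * z.2 ^ (α * p / 2 - 1)) := fun z => by
      rw [hux, ← mul_assoc, abs_mul _ (Real.exp _), Real.abs_exp,
        Real.mul_rpow (abs_nonneg _) (Real.exp_pos _).le]
      ring
    simp_rw [hfac]
    rw [setLIntegral_ofReal_mul_prod hexp0 hexpm.aemeasurable hb.aemeasurable,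
      setLIntegral_ofReal_inv_Ioi_zero_eq_top, ENNReal.mul_top]
    · exact setLIntegral_exp_rpow_Iio_ne_zero lam p T
    · intro x hx
      have hx0 := hx.1
      have h1 : 1 ≤ deriv w x := by
        rw [hw' x hx]
        have : 0 ≤ c * ((3 - α) * x ^ (3 - α - 1)) := by positivity
        linarith
      have h2 : x ^ (-(α / 2)) ≤ |x ^ (-(α / 2)) * deriv w x| :=
        (le_mul_of_one_le_right (by positivity) h1).trans (le_abs_self _)
      calc x ^ (-1 : ℝ) = (x ^ (-(α / 2))) ^ p * x ^ (α * p / 2 - 1) := by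
            rw [← Real.rpow_mul hx0.le, ← Real.rpow_add hx0]; congr 1; ring
        _ ≤ _ := by gcongr
  · have hb : ContinuousOn (fun x : ℝ => |g x| ^ p * x ^ (α * p / 2 - 1)) (Ioi 0) :=
      (hgC.abs.rpow_const fun _ _ => Or.inr hp0.le).mul
        (continuousOn_id.rpow_const fun x hx => Or.inl (ne_of_gt hx))
    have hfac : ∀ z : ℝ × ℝ, |f z.1 z.2| ^ p * z.2 ^ (α * p / 2 - 1) =
        Real.exp (lam * z.1) ^ p * (|g z.2| ^ p * z.2 ^ (α * p / 2 - 1)) := fun z => by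
      rw [hfg, abs_mul, Real.abs_exp, Real.mul_rpow (Real.exp_pos _).le (abs_nonneg _), mul_assoc]
    simp_rw [hfac]
    rw [setLIntegral_ofReal_mul_prod hexp0 hexpm.aemeasurable (hb.aemeasurable measurableSet_Ioi)]
    refine ENNReal.mul_lt_top (setLIntegral_exp_rpow_Iio_lt_top hlam hp0 T)
      (setLIntegral_abs_rpow_mul_rpow_lt_top hp0 hgC hg0 hg1 ?_)
    have : 0 < p * (2 - α) := mul_pos hp0 h2α
    nlinarith
end
end

section
/- Let p ∈ (1,∞) and define φ : (0,1/2) → ℝ by φ(x) = log(-log x). Then ∫_0^{1/2} (|φ(x)|^p + |φ'(x)|^p + |φ''(x)|^p) x^{2p-1} dx < ∞ (i.e., φ belongs to the weighted Sobolev space W²_p((0,1/2), x^{2p-1} dx)), while φ(x) → +∞ as x → 0⁺. (In particular, the trace at x = 0 of functions in W²_p with weight x^{2p-1} is not well defined.) -/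
open MeasureTheory ENNReal Set Filter

noncomputable section

lemma hasDerivAt_log_neg_log {x : ℝ} (h0 : 0 < x) (h1 : x < 1) :
    HasDerivAt (fun y : ℝ => Real.log (-Real.log y)) (x * Real.log x)⁻¹ x := by
  have hl : Real.log x < 0 := Real.log_neg h0 h1
  refine ((Real.hasDerivAt_log h0.ne').neg.log (neg_pos.2 hl).ne').congr_deriv ?_
  simp only [Pi.neg_apply]
  field_simp

lemma hasDerivAt_inv_mul_log {x : ℝ} (h0 : 0 < x) (h1 : x < 1) :
    HasDerivAt (fun y : ℝ => (y * Real.log y)⁻¹)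
      (-(Real.log x + 1) / (x * Real.log x) ^ 2) x := by
  have hl : Real.log x < 0 := Real.log_neg h0 h1
  exact (Real.hasDerivAt_mul_log h0.ne').fun_inv (mul_ne_zero h0.ne' hl.ne)

lemma tendsto_neg_log_nhdsGT_zero :
    Tendsto (fun x : ℝ => -Real.log x) (nhdsWithin 0 (Ioi 0)) atTop :=
  tendsto_neg_atBot_atTop.comp Real.tendsto_log_nhdsGT_zero

lemma integrableOn_inv_mul_neg_log_rpow {p : ℝ} (hp : 1 < p) :
    IntegrableOn (fun x : ℝ => x⁻¹ * (-Real.log x) ^ (-p)) (Ioc 0 (1 / 2)) := by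
  have hpos : ∀ x : ℝ, 0 < x → x ≤ 1 / 2 → 0 < -Real.log x := fun x h0 h1 =>
    neg_pos.2 (Real.log_neg h0 (by linarith))
  refine intervalIntegral.integrableOn_deriv_of_nonneg
    (g := fun x : ℝ => (-Real.log x) ^ (-(p - 1)) / (p - 1)) ?_ ?_ ?_
  · intro x hx
    rcases hx.1.eq_or_lt with rfl | h0
    · refine ContinuousWithinAt.mono (t := Ici 0) ?_ Icc_subset_Ici_self
      rw [← continuousWithinAt_Ioi_iff_Ici, ContinuousWithinAt]
      have h := ((tendsto_rpow_neg_atTop (sub_pos.2 hp)).comp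
        tendsto_neg_log_nhdsGT_zero).div_const (p - 1)
      simpa [Real.zero_rpow (show 1 - p ≠ 0 by linarith)] using h
    · exact (((Real.continuousAt_log h0.ne').neg.rpow_const
        (Or.inl (hpos x h0 hx.2).ne')).div_const _).continuousWithinAt
  · intro x hx
    have hL := hpos x hx.1 hx.2.le
    have hp' : p - 1 ≠ 0 := by linarith
    refine (((Real.hasDerivAt_log hx.1.ne').neg.rpow_const
      (p := -(p - 1)) (Or.inl hL.ne')).div_const (p - 1)).congr_deriv ?_
    rw [show -(p - 1) - 1 = -p by ring]
    simp only [Pi.neg_apply]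
    field_simp
  · intro x hx
    exact mul_nonneg (inv_nonneg.2 hx.1.le) (Real.rpow_nonneg (hpos x hx.1 hx.2.le).le _)

lemma abs_rpow_mul_rpow_le {p x L K a : ℝ} (hp : 0 < p) (hx : 0 < x) (hL : 0 < L)
    (hK : 0 ≤ K) (h : |a| ≤ K / (x ^ 2 * L)) :
    |a| ^ p * x ^ (2 * p - 1) ≤ K ^ p * (x⁻¹ * L ^ (-p)) := by
  have h2 : (x ^ 2) ^ p = x ^ (2 * p) := by
    rw [← Real.rpow_natCast, ← Real.rpow_mul hx.le]
    norm_num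
  have hxp : 0 < x ^ (2 * p) := Real.rpow_pos_of_pos hx _
  have hLp : 0 < L ^ p := Real.rpow_pos_of_pos hL _
  calc |a| ^ p * x ^ (2 * p - 1) ≤ (K / (x ^ 2 * L)) ^ p * x ^ (2 * p - 1) := by gcongr
    _ = K ^ p * (x⁻¹ * L ^ (-p)) := by
      rw [Real.div_rpow hK (by positivity), Real.mul_rpow (by positivity) hL.le, h2,
        Real.rpow_sub_one hx.ne', Real.rpow_neg hL.le]
      field_simp

lemma abs_log_neg_log_le {x : ℝ} (h0 : 0 < x) (h1 : x < 1) :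
    |Real.log (-Real.log x)| ≤ 3 / (x ^ 2 * -Real.log x) := by
  have hL : 0 < -Real.log x := neg_pos.2 (Real.log_neg h0 h1)
  have hxL : x * -Real.log x ≤ 1 := by
    have h := Real.log_le_sub_one_of_pos (inv_pos.2 h0)
    rw [Real.log_inv] at h
    calc x * -Real.log x ≤ x * (x⁻¹ - 1) := by gcongr
      _ = 1 - x := by field_simp
      _ ≤ 1 := by linarith
  generalize -Real.log x = L at hL hxL
  have hlog : |Real.log L| ≤ L + L⁻¹ := by
    have hi : 0 < L⁻¹ := inv_pos.2 hL
    have h₁ := Real.log_le_sub_one_of_pos hL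
    have h₂ := Real.log_le_sub_one_of_pos hi
    rw [Real.log_inv] at h₂
    exact abs_le.2 ⟨by linarith, by linarith⟩
  rw [le_div_iff₀ (by positivity)]
  calc |Real.log L| * (x ^ 2 * L) ≤ (L + L⁻¹) * (x ^ 2 * L) := by gcongr
    _ = (x * L) ^ 2 + x ^ 2 := by field_simp
    _ ≤ 1 ^ 2 + 1 ^ 2 := by gcongr
    _ ≤ 3 := by norm_num

lemma abs_inv_mul_log_le {x : ℝ} (h0 : 0 < x) (h1 : x < 1) :
    |(x * Real.log x)⁻¹| ≤ 3 / (x ^ 2 * -Real.log x) := by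
  have hl := Real.log_neg h0 h1
  have hL : 0 < -Real.log x := neg_pos.2 hl
  rw [abs_inv, abs_mul, abs_of_pos h0, abs_of_neg hl, le_div_iff₀ (by positivity)]
  generalize -Real.log x = L at hL
  calc (x * L)⁻¹ * (x ^ 2 * L) = x := by field_simp
    _ ≤ 3 := by linarith

lemma abs_neg_log_add_one_div_le {x : ℝ} (h0 : 0 < x) (h1 : x < 1 / 2) :
    |-(Real.log x + 1) / (x * Real.log x) ^ 2| ≤ 3 / (x ^ 2 * -Real.log x) := by
  have hL : 1 / 2 < -Real.log x := by
    have h := Real.log_lt_log h0 h1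
    rw [one_div, Real.log_inv] at h
    linarith [Real.log_two_gt_d9]
  have he : -(Real.log x + 1) / (x * Real.log x) ^ 2
      = (-Real.log x - 1) / (x ^ 2 * (-Real.log x) ^ 2) := by ring
  rw [he]
  generalize -Real.log x = L at hL
  have hL0 : 0 < L := by linarith
  rw [abs_div, abs_of_pos (show 0 < x ^ 2 * L ^ 2 by positivity),
    le_div_iff₀ (by positivity)]
  have hle : |L - 1| ≤ 3 * L := abs_le.2 ⟨by linarith, by linarith⟩
  calc |L - 1| / (x ^ 2 * L ^ 2) * (x ^ 2 * L) = |L - 1| / L := by field_simp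
    _ ≤ 3 := (div_le_iff₀ hL0).2 hle

/-- Remark 2.6: for `γ = 2p-1` the trace at `x_d = 0` is not well defined:
`φ(x) = log(-log x)` belongs to the weighted Sobolev space
`W²_p((0,1/2), x^{2p-1} dx)` but blows up at `0⁺`. -/
theorem stmt7 (p : ℝ) (hp : 1 < p) (φ : ℝ → ℝ)
    (hφ : ∀ x : ℝ, φ x = Real.log (-Real.log x)) :
    (∫⁻ x in Set.Ioo (0 : ℝ) (1 / 2),
        ENNReal.ofReal
          ((|φ x| ^ p + |deriv φ x| ^ p + |deriv (deriv φ) x| ^ p) * x ^ (2 * p - 1))) < ⊤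
    ∧ Tendsto φ (nhdsWithin 0 (Set.Ioi 0)) atTop := by
  obtain rfl : φ = fun x => Real.log (-Real.log x) := funext hφ
  refine ⟨?_, Real.tendsto_log_atTop.comp tendsto_neg_log_nhdsGT_zero⟩
  have hint : IntegrableOn (fun x : ℝ => 3 * (3 ^ p * (x⁻¹ * (-Real.log x) ^ (-p))))
      (Ioo 0 (1 / 2)) :=
    (((integrableOn_inv_mul_neg_log_rpow hp).mono_set Ioo_subset_Ioc_self).const_mul _).const_mul _
  refine lt_of_le_of_lt (setLIntegral_mono' measurableSet_Ioo fun x hx => ?_)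
    hint.lintegral_lt_top
  have h0 : 0 < x := hx.1
  have h1 : x < 1 := by linarith [hx.2]
  have hL : 0 < -Real.log x := neg_pos.2 (Real.log_neg h0 h1)
  have hd2 : deriv (deriv fun x => Real.log (-Real.log x)) x
      = -(Real.log x + 1) / (x * Real.log x) ^ 2 := by
    rw [← (hasDerivAt_inv_mul_log h0 h1).deriv]
    refine EventuallyEq.deriv_eq ?_
    filter_upwards [Ioo_mem_nhds h0 h1] with y hy
    exact (hasDerivAt_log_neg_log hy.1 hy.2).deriv
  rw [hd2, (hasDerivAt_log_neg_log h0 h1).deriv]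
  refine ENNReal.ofReal_le_ofReal ?_
  have hp0 : 0 < p := by linarith
  have e₀ := abs_rpow_mul_rpow_le hp0 h0 hL (by norm_num) (abs_log_neg_log_le h0 h1)
  have e₁ := abs_rpow_mul_rpow_le hp0 h0 hL (by norm_num) (abs_inv_mul_log_le h0 h1)
  have e₂ := abs_rpow_mul_rpow_le hp0 h0 hL (by norm_num) (abs_neg_log_add_one_div_le h0 hx.2)
  rw [add_mul, add_mul]
  linarith
end
end

section
/- Let d ≥ 1 and α ∈ (0,2). Define ϱ : (ℝ × ℝ^d_+) × (ℝ × ℝ^d_+) → [0,∞) by ϱ((t,x),(s,y)) = |t-s|^{1/(2-α)} + min{ |x-y|, |x-y|^{2/(2-α)} · min{x_d, y_d}^{-α/(2-α)} }. Then: (i) there exists a constant K₁ > 0, depending only on d and α, such that ϱ((t,x),(s,y)) ≤ K₁ ( ϱ((t,x),(t̂,x̂)) + ϱ((t̂,x̂),(s,y)) ) for all (t,x), (s,y), (t̂,x̂) ∈ ℝ × ℝ^d_+; and (ii) ϱ((t,x),(s,y)) = 0 if and only if (t,x) = (s,y). That is, ϱ is a quasi-metric on ℝ × ℝ^d_+.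 -/
open MeasureTheory ENNReal Set

noncomputable section

theorem xd_sub_le_dist {d : ℕ} (x y : Ed d) : |xd x - xd y| ≤ dist x y := by
  unfold xd
  split_ifs with h
  · rw [dist_eq_norm]
    simpa using PiLp.norm_apply_le (x - y) ⟨d - 1, Nat.sub_lt h one_pos⟩
  · simp

theorem min_rpow_mul_rpow_neg_le {β r a m M : ℝ} (hβ : 0 < β) (hr : 0 ≤ r) (ha : 0 ≤ a)
    (hm : 0 < m) (hM : 0 < M) (hra : r ≤ 2 * a) (hMm : M ≤ 2 * max m a) :
    min r (r ^ (1 + β) * m ^ (-β)) ≤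
      2 ^ (1 + 2 * β) * min a (a ^ (1 + β) * M ^ (-β)) := by
  have hC : (0 : ℝ) < 2 ^ (1 + 2 * β) := by positivity
  have htwo : (2 : ℝ) ^ (1 + 2 * β) = 2 ^ (1 + β) * 2 ^ β := by
    rw [← Real.rpow_add two_pos]; ring_nf
  have hone : (1 : ℝ) ≤ 2 ^ β := Real.one_le_rpow one_le_two hβ.le
  have hlin : ∀ x : ℝ, 0 ≤ x → x ^ (1 + β) = x * x ^ β := fun x hx => by
    rw [Real.rpow_add_of_nonneg hx zero_le_one hβ.le, Real.rpow_one]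
  rw [mul_min_of_nonneg _ _ hC.le]
  refine le_min ((min_le_left _ _).trans (hra.trans ?_)) ?_
  · gcongr
    exact Real.self_le_rpow_of_one_le one_le_two (by linarith)
  · rcases le_total a m with h | h
    · rw [max_eq_left h] at hMm
      refine (min_le_right _ _).trans ?_
      have h1 : r ^ (1 + β) ≤ 2 ^ (1 + β) * a ^ (1 + β) := by
        rw [← Real.mul_rpow two_pos.le ha]
        exact Real.rpow_le_rpow hr hra (by linarith)
      have h2 : m ^ (-β) ≤ 2 ^ β * M ^ (-β) := by
        rw [Real.rpow_neg hm.le, Real.rpow_neg hM.le, ← div_eq_mul_inv,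
          le_div_iff₀ (by positivity), inv_mul_le_iff₀ (by positivity), mul_comm,
          ← Real.mul_rpow two_pos.le hm.le]
        exact Real.rpow_le_rpow hM.le hMm hβ.le
      calc r ^ (1 + β) * m ^ (-β)
          ≤ (2 ^ (1 + β) * a ^ (1 + β)) * (2 ^ β * M ^ (-β)) := by gcongr
        _ = _ := by rw [htwo]; ring
    · rw [max_eq_right h] at hMm
      refine (min_le_left _ _).trans (hra.trans ?_)
      have h1 : 1 ≤ 2 ^ β * a ^ β * M ^ (-β) := by
        rw [Real.rpow_neg hM.le, ← div_eq_mul_inv, le_div_iff₀ (by positivity), one_mul,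
          ← Real.mul_rpow two_pos.le ha]
        exact Real.rpow_le_rpow hM.le hMm hβ.le
      calc 2 * a ≤ 2 * a * (2 ^ β * (2 ^ β * a ^ β * M ^ (-β))) :=
            le_mul_of_one_le_right (by positivity) (one_le_mul_of_one_le_of_one_le hone h1)
        _ = _ := by rw [htwo, hlin 2 two_pos.le, hlin a ha]; ring

theorem min_rpow_mul_rpow_neg_triangle {β r a b x y v : ℝ} (hβ : 0 < β) (hr : 0 ≤ r)
    (ha : 0 ≤ a) (hb : 0 ≤ b) (hx : 0 < x) (hy : 0 < y) (hv : 0 < v) (hrab : r ≤ a + b)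
    (hxv : |x - v| ≤ a) (hvy : |v - y| ≤ b) :
    min r (r ^ (1 + β) * min x y ^ (-β)) ≤
      2 ^ (1 + 2 * β) * (min a (a ^ (1 + β) * min x v ^ (-β)) +
        min b (b ^ (1 + β) * min v y ^ (-β))) := by
  have hxy : 0 < min x y := lt_min hx hy
  have hxv' : 0 < min x v := lt_min hx hv
  have hvy' : 0 < min v y := lt_min hv hy
  have hA : 0 ≤ min a (a ^ (1 + β) * min x v ^ (-β)) := le_min ha (by positivity)
  have hB : 0 ≤ min b (b ^ (1 + β) * min v y ^ (-β)) := le_min hb (by positivity)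
  rw [abs_le] at hxv hvy
  rcases le_total b a with h | h
  · refine (min_rpow_mul_rpow_neg_le hβ hr ha hxy hxv' (by linarith) ?_).trans ?_
    · have := le_max_left (min x y) a
      have := le_max_right (min x y) a
      have := min_le_left x v
      have := min_le_right x v
      rcases min_choice x y with h' | h' <;> linarith
    · gcongr
      linarith
  · refine (min_rpow_mul_rpow_neg_le hβ hr hb hxy hvy' (by linarith) ?_).trans ?_
    · have := le_max_left (min x y) b
      have := le_max_right (min x y) b
      have := min_le_left v y
      have := min_le_right v y
      rcases min_choice x y with h' | h' <;> linarith
    · gcongr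
      linarith

theorem rpow_le_two_rpow_mul_add {p r a b : ℝ} (hp : 0 ≤ p) (hr : 0 ≤ r) (ha : 0 ≤ a)
    (hb : 0 ≤ b) (hrab : r ≤ a + b) : r ^ p ≤ 2 ^ p * (a ^ p + b ^ p) := by
  have hA := Real.rpow_nonneg ha p
  have hB := Real.rpow_nonneg hb p
  rcases le_total b a with h | h
  · calc r ^ p ≤ (2 * a) ^ p := Real.rpow_le_rpow hr (by linarith) hp
      _ = 2 ^ p * a ^ p := Real.mul_rpow two_pos.le ha
      _ ≤ _ := by gcongr; linarith
  · calc r ^ p ≤ (2 * b) ^ p := Real.rpow_le_rpow hr (by linarith) hp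
      _ = 2 ^ p * b ^ p := Real.mul_rpow two_pos.le hb
      _ ≤ _ := by gcongr; linarith

/-- Section 3: the function `ϱ` is a quasi-metric on `ℝ × ℝ^d_+`. -/
theorem stmt8 (d : ℕ) (hd : 1 ≤ d) (α : ℝ) (hα : α ∈ Set.Ioo (0 : ℝ) 2)
    (ϱ : (ℝ × Ed d) → (ℝ × Ed d) → ℝ)
    (hϱ : ∀ z w : ℝ × Ed d,
      ϱ z w = |z.1 - w.1| ^ (1 / (2 - α)) +
        min (dist z.2 w.2)
          (dist z.2 w.2 ^ (2 / (2 - α)) *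
            (min (xd z.2) (xd w.2)) ^ (-(α / (2 - α))))) :
    (∃ K₁ : ℝ, 0 < K₁ ∧
      ∀ z w v : ℝ × Ed d, 0 < xd z.2 → 0 < xd w.2 → 0 < xd v.2 →
        ϱ z w ≤ K₁ * (ϱ z v + ϱ v w))
    ∧
    (∀ z w : ℝ × Ed d, 0 < xd z.2 → 0 < xd w.2 → (ϱ z w = 0 ↔ z = w)) := by
  obtain ⟨hα0, hα2⟩ := hα
  have hα' : 0 < 2 - α := by linarith
  have hβ : 0 < α / (2 - α) := div_pos hα0 hα'
  have hp : 0 < 1 / (2 - α) := by positivity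
  have h2 : 2 / (2 - α) = 1 + α / (2 - α) := by field_simp; ring
  have hpβ : 1 / (2 - α) ≤ 1 + 2 * (α / (2 - α)) := by
    have : 2 * (1 / (2 - α)) = 2 / (2 - α) := by ring
    linarith
  rw [h2] at hϱ
  generalize α / (2 - α) = β at *
  generalize 1 / (2 - α) = p at *
  refine ⟨⟨2 ^ (1 + 2 * β), by positivity, fun z w v hz hw hv => ?_⟩, fun z w hz hw => ?_⟩
  · have ht := rpow_le_two_rpow_mul_add hp.le (abs_nonneg (z.1 - w.1)) (abs_nonneg (z.1 - v.1))
      (abs_nonneg (v.1 - w.1)) (abs_sub_le _ _ _)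
    have hC : (2 : ℝ) ^ p ≤ 2 ^ (1 + 2 * β) := Real.rpow_le_rpow_of_exponent_le one_le_two hpβ
    have ht' := ht.trans (mul_le_mul_of_nonneg_right hC (by positivity))
    have hs := min_rpow_mul_rpow_neg_triangle hβ dist_nonneg dist_nonneg dist_nonneg hz hw hv
      (dist_triangle z.2 v.2 w.2) (xd_sub_le_dist _ _) (xd_sub_le_dist _ _)
    rw [hϱ, hϱ, hϱ]
    linarith
  · have hm : 0 < min (xd z.2) (xd w.2) := lt_min hz hw
    rw [hϱ]
    constructor
    · intro h
      rw [add_eq_zero_iff_of_nonneg (by positivity) (le_min dist_nonneg (by positivity))] at h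
      obtain ⟨h1, h3⟩ := h
      rw [Real.rpow_eq_zero (abs_nonneg _) hp.ne', abs_eq_zero, sub_eq_zero] at h1
      refine Prod.ext h1 (dist_le_zero.1 (not_lt.1 fun hd' => ?_))
      exact (lt_min hd' (by positivity)).ne' h3
    · rintro rfl
      have : (1 + β) ≠ 0 := by linarith
      simp [Real.zero_rpow hp.ne', Real.zero_rpow this]
end
end
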